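/- arXiv:2203.13128 — 4 statements merged into one kernel-verified Lean document; each statement's English description precedes it below -/
import Mathlib

section
/- For every p ∈ (1,∞) there exists a separable Banach space U_p which admits an equivalent p-AUS norm, is both injectively and surjectively universal for the class of separable p-AUS-able spaces (every separable Banach space admitting an equivalent p-AUS norm is isomorphic to a closed subspace of U_p and is a quotient of U_p), and which is isomorphic to the ℓ_p-sum ℓ_p(U_p) of countably many copies of itself. -/
open Metric Set Topology Filter

noncomputable def rhoN (X : Type*) [NormedAddCommGroup X] [NormedSpace ℝ X]
    (N : X → ℝ) (τ : ℝ) : ℝ :=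
  letI := Classical.propDecidable (FiniteDimensional ℝ X)
  if FiniteDimensional ℝ X then 0
  else
    sSup { r : ℝ | ∃ y : X, N y ≤ 1 ∧
      r = sInf { s : ℝ | ∃ E : Submodule ℝ X, IsClosed (E : Set X) ∧
            FiniteDimensional ℝ (X ⧸ E) ∧
            s = sSup { t : ℝ | ∃ x ∈ E, N x ≤ 1 ∧ t = N (y + τ • x) - 1 } } }

noncomputable def rho (X : Type*) [NormedAddCommGroup X] [NormedSpace ℝ X] (τ : ℝ) : ℝ :=
  rhoN X (fun x => ‖x‖) τ

def IsNormFn (X : Type*) [NormedAddCommGroup X] [NormedSpace ℝ X] (N : X → ℝ) : Prop :=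
  (∀ x : X, 0 ≤ N x) ∧ (∀ x : X, N x = 0 ↔ x = 0) ∧
    (∀ (a : ℝ) (x : X), N (a • x) = |a| * N x) ∧ ∀ x y : X, N (x + y) ≤ N x + N y

def IsEquivNorm (X : Type*) [NormedAddCommGroup X] [NormedSpace ℝ X] (N : X → ℝ) : Prop :=
  IsNormFn X N ∧ ∃ a > 0, ∃ b > 0, ∀ x : X, a * ‖x‖ ≤ N x ∧ N x ≤ b * ‖x‖

def IsPAUSNorm (X : Type*) [NormedAddCommGroup X] [NormedSpace ℝ X] (N : X → ℝ) (p : ℝ) : Prop :=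
  ∃ C > 0, ∀ τ : ℝ, 0 ≤ τ → rhoN X N τ ≤ C * τ ^ p

def PAUSable (p : ℝ) (X : Type*) [NormedAddCommGroup X] [NormedSpace ℝ X] : Prop :=
  ∃ N : X → ℝ, IsEquivNorm X N ∧ IsPAUSNorm X N p

def IsomToClosedSubspace (Y U : Type*) [NormedAddCommGroup Y] [NormedSpace ℝ Y]
    [NormedAddCommGroup U] [NormedSpace ℝ U] : Prop :=
  ∃ T : Y →L[ℝ] U, Function.Injective T ∧ ∃ c > 0, ∀ y : Y, c * ‖y‖ ≤ ‖T y‖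

def IsQuotientOf (Y U : Type*) [NormedAddCommGroup Y] [NormedSpace ℝ Y]
    [NormedAddCommGroup U] [NormedSpace ℝ U] : Prop :=
  ∃ Q : U →L[ℝ] Y, Function.Surjective Q


universe u

/-- The norm of `X` satisfies `ρ̄_X(τ) ≤ C * τ ^ p`, in terms of finite-codimensional subspaces. -/
def AUSBound (p C : ℝ) (X : Type*) [NormedAddCommGroup X] [NormedSpace ℝ X] : Prop :=
  ∀ y : X, ‖y‖ ≤ 1 → ∀ τ : ℝ, 0 ≤ τ → ∀ ε > 0, ∃ E : Submodule ℝ X,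
    IsClosed (E : Set X) ∧ E.CoFG ∧ ∀ x ∈ E, ‖x‖ ≤ 1 → ‖y + τ • x‖ ≤ 1 + C * τ ^ p + ε

theorem IsPAUSNorm.exists_submodule {p : ℝ} {X : Type*} [NormedAddCommGroup X] [NormedSpace ℝ X]
    {N : X → ℝ} (hN : IsNormFn X N) (h : IsPAUSNorm X N p) :
    ∃ C > 0, ∀ y : X, N y ≤ 1 → ∀ τ : ℝ, 0 ≤ τ → ∀ ε > 0, ∃ E : Submodule ℝ X,
      IsClosed (E : Set X) ∧ E.CoFG ∧ ∀ x ∈ E, N x ≤ 1 → N (y + τ • x) ≤ 1 + C * τ ^ p + ε := by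
  obtain ⟨C, hC, hρ⟩ := h
  obtain ⟨h0, hz, hs, ht⟩ := hN
  have hN0 : N 0 = 0 := (hz 0).2 rfl
  refine ⟨C, hC, fun y hy τ hτ ε hε => ?_⟩
  have hub : ∀ y x : X, N y ≤ 1 → N x ≤ 1 → N (y + τ • x) - 1 ≤ τ := by
    intro y x hy hx
    have h1 := ht y (τ • x)
    rw [hs, abs_of_nonneg hτ] at h1
    nlinarith
  by_cases hfin : FiniteDimensional ℝ X
  · refine ⟨⊥, isClosed_singleton, ?_, fun x hx _ => ?_⟩
    · exact Submodule.CoFG.of_finite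
    · have : x = 0 := by simpa using hx
      subst this
      have := Real.rpow_nonneg hτ p
      simp only [smul_zero, add_zero]
      nlinarith
  have hb := hρ τ hτ
  simp only [rhoN, if_neg hfin] at hb
  set I : X → Set ℝ := fun y => { s : ℝ | ∃ E : Submodule ℝ X, IsClosed (E : Set X) ∧
            FiniteDimensional ℝ (X ⧸ E) ∧
            s = sSup { t : ℝ | ∃ x ∈ E, N x ≤ 1 ∧ t = N (y + τ • x) - 1 } } with hI
  have htop : ∀ y : X, sSup { t : ℝ | ∃ x ∈ (⊤ : Submodule ℝ X), N x ≤ 1 ∧ t = N (y + τ • x) - 1 }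
      ∈ I y := fun y => ⟨⊤, isClosed_univ, inferInstance, rfl⟩
  have hbdd : ∀ y : X, N y ≤ 1 → BddBelow (I y) := by
    refine fun y hy => ⟨-1, ?_⟩
    rintro s ⟨E, -, -, rfl⟩
    have hmem : N y - 1 ∈ { t : ℝ | ∃ x ∈ E, N x ≤ 1 ∧ t = N (y + τ • x) - 1 } :=
      ⟨0, E.zero_mem, by rw [hN0]; exact zero_le_one, by simp⟩
    have := le_csSup (⟨τ, by rintro t ⟨x, -, hx, rfl⟩; exact hub y x hy hx⟩) hmem
    linarith [h0 y]
  have hle : sInf (I y) ≤ C * τ ^ p := by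
    refine le_trans (le_csSup (s := {r | ∃ y : X, N y ≤ 1 ∧ r = sInf (I y)}) ⟨τ, ?_⟩
      ⟨y, hy, rfl⟩) hb
    rintro r ⟨y', hy', rfl⟩
    refine (csInf_le (hbdd y' hy') (htop y')).trans (csSup_le ?_ ?_)
    · exact ⟨_, 0, Submodule.mem_top, by rw [hN0]; exact zero_le_one, rfl⟩
    · rintro t ⟨x, -, hx, rfl⟩; exact hub y' x hy' hx
  obtain ⟨s, ⟨E, hE1, hE2, rfl⟩, hs'⟩ := exists_lt_of_csInf_lt ⟨_, htop y⟩
    (lt_of_le_of_lt hle (lt_add_of_pos_right _ hε))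
  refine ⟨E, hE1, hE2, fun x hx hx1 => ?_⟩
  have := le_csSup (⟨τ, by rintro t ⟨x, -, hx, rfl⟩; exact hub y x hy hx⟩ :
    BddAbove { t : ℝ | ∃ x ∈ E, N x ≤ 1 ∧ t = N (y + τ • x) - 1 }) ⟨x, hx, hx1, rfl⟩
  linarith

theorem exists_normedSpace_of_norm {V : Type u} [AddCommGroup V] [Module ℝ V] {N : V → ℝ}
    (hz : ∀ x : V, N x = 0 ↔ x = 0) (hs : ∀ (a : ℝ) (x : V), N (a • x) = |a| * N x)
    (ht : ∀ x y : V, N (x + y) ≤ N x + N y) :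
    ∃ (Y : Type u) (_ : NormedAddCommGroup Y) (_ : NormedSpace ℝ Y) (e : V ≃ₗ[ℝ] Y),
      ∀ x, ‖e x‖ = N x := by
  let D : AddGroupNorm V :=
    { toFun := N
      map_zero' := (hz 0).2 rfl
      add_le' := ht
      neg' := fun x => by simpa using hs (-1) x
      eq_zero_of_map_eq_zero' := fun x hx => (hz x).1 hx }
  let i1 : NormedAddCommGroup V := D.toNormedAddCommGroup
  let i2 : NormedSpace ℝ V := { norm_smul_le := fun c x => le_of_eq (hs c x) }
  exact ⟨V, i1, i2, LinearEquiv.refl ℝ V, fun x => rfl⟩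

/-- A normed space renormed by an equivalent norm. -/
theorem exists_renorming {X : Type u} [NormedAddCommGroup X] [NormedSpace ℝ X]
    {N : X → ℝ} (hN : IsEquivNorm X N) :
    ∃ (Y : Type u) (_ : NormedAddCommGroup Y) (_ : NormedSpace ℝ Y) (e : X ≃L[ℝ] Y),
      ∀ x, ‖e x‖ = N x := by
  obtain ⟨⟨h0, hz, hs, ht⟩, a, ha, b, hb, hab⟩ := hN
  obtain ⟨Y, i1, i2, e, he⟩ := exists_normedSpace_of_norm hz hs ht
  refine ⟨Y, i1, i2, e.toContinuousLinearEquivOfBounds b a⁻¹ (fun x => ?_) (fun y => ?_), he⟩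
  · rw [he]; exact (hab x).2
  · have := (hab (e.symm y)).1
    rw [← he, e.apply_symm_apply] at this
    rw [inv_mul_eq_div, le_div_iff₀ ha]; linarith

theorem Submodule.CoFG.map_equiv {X Y : Type*} [AddCommGroup X] [Module ℝ X] [AddCommGroup Y]
    [Module ℝ Y] {E : Submodule ℝ X} (h : E.CoFG) (e : X ≃ₗ[ℝ] Y) :
    (E.comap (e.symm : Y →ₗ[ℝ] X)).CoFG := by
  have : E.comap (e.symm : Y →ₗ[ℝ] X)
      = LinearMap.ker (E.mkQ ∘ₗ (e.symm : Y →ₗ[ℝ] X)) := by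
    rw [LinearMap.ker_comp, Submodule.ker_mkQ]
  rw [this]
  have : IsNoetherian ℝ (X ⧸ E) := by
    have : Module.Finite ℝ (X ⧸ E) := h
    infer_instance
  exact Submodule.CoFG.ker _

theorem PAUSable.exists_ausBound {p : ℝ} {X : Type u} [NormedAddCommGroup X] [NormedSpace ℝ X]
    (h : PAUSable p X) :
    ∃ (Y : Type u) (_ : NormedAddCommGroup Y) (_ : NormedSpace ℝ Y) (_ : X ≃L[ℝ] Y),
      ∃ C > 0, AUSBound p C Y := by
  obtain ⟨N, hN, hp⟩ := h
  obtain ⟨Y, i1, i2, e, he⟩ := exists_renorming hN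
  refine ⟨Y, i1, i2, e, ?_⟩
  obtain ⟨C, hC, H⟩ := hp.exists_submodule hN.1
  refine ⟨C, hC, fun y hy τ hτ ε hε => ?_⟩
  obtain ⟨E, hE1, hE2, hE3⟩ := H (e.symm y) (by rw [← he]; simpa using hy) τ hτ ε hε
  refine ⟨E.comap (e.toLinearEquiv.symm : Y →ₗ[ℝ] X), ?_, hE2.map_equiv e.toLinearEquiv, ?_⟩
  · exact hE1.preimage e.symm.continuous
  · intro x hx hx1
    have := hE3 (e.symm x) hx (by rw [← he]; simpa using hx1)
    rw [← he] at this
    simpa using this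

section Approximation

variable {X : Type*} [NormedAddCommGroup X] [NormedSpace ℝ X]

theorem AUSBound.exists_submodule_of_isCompact {p C : ℝ} (hp : 0 < p) (h : AUSBound p C X)
    {K : Set (X × ℝ)} (hK : IsCompact K) (hK1 : ∀ z ∈ K, ‖z.1‖ ≤ 1 ∧ 0 ≤ z.2) {ε : ℝ}
    (hε : 0 < ε) :
    ∃ E : Submodule ℝ X, IsClosed (E : Set X) ∧ E.CoFG ∧
      ∀ z ∈ K, ∀ x ∈ E, ‖x‖ ≤ 1 → ‖z.1 + z.2 • x‖ ≤ 1 + C * z.2 ^ p + ε := by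
  refine hK.induction_on (p := fun K => ∃ E : Submodule ℝ X, IsClosed (E : Set X) ∧ E.CoFG ∧
      ∀ z ∈ K, ∀ x ∈ E, ‖x‖ ≤ 1 → ‖z.1 + z.2 • x‖ ≤ 1 + C * z.2 ^ p + ε) ?_ ?_ ?_ ?_
  · exact ⟨⊤, isClosed_univ, inferInstanceAs (Module.Finite ℝ (X ⧸ (⊤ : Submodule ℝ X))), by simp⟩
  · rintro s t hst ⟨E, h1, h2, h3⟩
    exact ⟨E, h1, h2, fun z hz => h3 z (hst hz)⟩
  · rintro s t ⟨E, h1, h2, h3⟩ ⟨F, k1, k2, k3⟩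
    refine ⟨E ⊓ F, h1.inter k1, h2.inf k2, ?_⟩
    rintro z (hz | hz) x hx
    · exact h3 z hz x hx.1
    · exact k3 z hz x hx.2
  · rintro ⟨y, τ⟩ hz
    obtain ⟨hy, hτ⟩ := hK1 _ hz
    obtain ⟨E, h1, h2, h3⟩ := h y hy τ hτ (ε / 2) (half_pos hε)
    have hc : ContinuousAt (fun z : X × ℝ => ‖z.1 - y‖ + |z.2 - τ| + C * τ ^ p - C * z.2 ^ p)
        (y, τ) := by
      have : ContinuousAt (fun z : X × ℝ => z.2 ^ p) (y, τ) :=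
        continuousAt_snd.rpow_const (Or.inr hp.le)
      fun_prop
    have hlt : ∀ᶠ z in 𝓝 (y, τ), ‖z.1 - y‖ + |z.2 - τ| + C * τ ^ p - C * z.2 ^ p < ε / 2 :=
      hc.eventually_lt continuousAt_const (by simpa using hε)
    refine ⟨_, mem_nhdsWithin_of_mem_nhds hlt, E, h1, h2, fun z hz x hx hx1 => ?_⟩
    have hz' : ‖z.1 - y‖ + |z.2 - τ| + C * τ ^ p - C * z.2 ^ p < ε / 2 := hz
    have e : z.1 + z.2 • x = (y + τ • x) + ((z.1 - y) + (z.2 - τ) • x) := by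
      rw [sub_smul]; abel
    have hxx : ‖(z.2 - τ) • x‖ ≤ |z.2 - τ| := by
      rw [norm_smul, Real.norm_eq_abs]
      exact mul_le_of_le_one_right (abs_nonneg _) hx1
    have := h3 x hx hx1
    rw [e]
    have := norm_add_le (y + τ • x) ((z.1 - y) + (z.2 - τ) • x)
    have := norm_add_le (z.1 - y) ((z.2 - τ) • x)
    linarith

theorem AUSBound.exists_submodule_functional {p q C : ℝ} (hpq : p.HolderConjugate q)
    (hC : 0 ≤ C) (h : AUSBound p C X) (G : Submodule ℝ X) [FiniteDimensional ℝ G] {ε : ℝ}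
    (hε : 0 < ε) (hε1 : ε ≤ 1) :
    ∃ E : Submodule ℝ X, IsClosed (E : Set X) ∧ E.CoFG ∧ ∀ g ∈ G, ‖g‖ ≤ 1 → ∀ x ∈ E, ‖x‖ ≤ 1 →
      ∀ (f : StrongDual ℝ X) (b : ℝ), 0 ≤ b → b ≤ 2 → 0 ≤ f g → (∀ t : ℝ, f (g + t • x) ≤ b * ‖g + t • x‖) →
      |f x| ^ q ≤ (2 + 2 * C) ^ q * (b - f g + ε) := by
  have hp := hpq.lt
  have hp0 : 0 < p := hpq.pos
  have hKc : IsCompact (((↑) '' (closedBall (0 : G) 1)) ×ˢ Icc (0 : ℝ) 3 : Set (X × ℝ)) :=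
    ((isCompact_closedBall (0 : G) 1).image continuous_subtype_val).prod isCompact_Icc
  obtain ⟨E, h1, h2, h3⟩ := h.exists_submodule_of_isCompact hp0 hKc (by
    rintro ⟨_, τ⟩ ⟨⟨g, hg, rfl⟩, hτ⟩
    exact ⟨by simpa using hg, hτ.1⟩) hε
  refine ⟨E, h1, h2, ?_⟩
  have key : ∀ g ∈ G, ‖g‖ ≤ 1 → ∀ x ∈ E, ‖x‖ ≤ 1 →
      ∀ (f : StrongDual ℝ X) (b : ℝ), 0 ≤ b → b ≤ 2 → 0 ≤ f g →
      (∀ t : ℝ, f (g + t • x) ≤ b * ‖g + t • x‖) →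
      f x ≤ (2 + 2 * C) * (b - f g + ε) ^ (1 / q) := by
    intro g hg hg1 x hx hx1 f b hb0 hb hfg H
    have h0 := H 0
    simp only [zero_smul, add_zero] at h0
    have hδ : f g ≤ b := by nlinarith
    set δ := b - f g with hδd
    have hδε : 0 < δ + ε := by linarith
    set τ := (δ + ε) ^ (1 / p) with hτ
    have hτ0 : 0 < τ := Real.rpow_pos_of_pos hδε _
    have hτ3 : τ ≤ 3 := by
      calc τ ≤ 3 ^ (1 / p) := Real.rpow_le_rpow hδε.le (by linarith) (by positivity)
        _ ≤ 3 ^ (1 : ℝ) := Real.rpow_le_rpow_of_exponent_le (by norm_num)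
            (by rw [div_le_one hp0]; exact hp.le)
        _ = 3 := Real.rpow_one 3
    have hτp : τ ^ p = δ + ε := by
      rw [hτ, ← Real.rpow_mul hδε.le, one_div_mul_cancel hp0.ne', Real.rpow_one]
    have hn := h3 (g, τ) ⟨⟨⟨g, hg⟩, by simpa using hg1, rfl⟩, hτ0.le, hτ3⟩ x hx hx1
    have hH := H τ
    rw [map_add, map_smul, smul_eq_mul] at hH
    simp only [hτp] at hn
    have h5 : τ * f x ≤ (2 + 2 * C) * (δ + ε) := by
      have h6 := hH.trans (mul_le_mul_of_nonneg_left hn hb0)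
      have h7 : b * (C * (δ + ε) + ε) ≤ 2 * (C * (δ + ε) + ε) :=
        mul_le_mul_of_nonneg_right hb (by positivity)
      nlinarith
    have h8 : δ + ε = τ * (δ + ε) ^ (1 / q) := by
      rw [hτ, ← Real.rpow_add hδε, one_div, one_div, hpq.inv_add_inv_eq_one, Real.rpow_one]
    rw [h8] at h5
    have : τ * f x ≤ τ * ((2 + 2 * C) * (δ + ε) ^ (1 / q)) := by linarith
    exact le_of_mul_le_mul_left this hτ0
  intro g hg hg1 x hx hx1 f b hb0 hb hfg H
  have k1 := key g hg hg1 x hx hx1 f b hb0 hb hfg H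
  have k2 := key g hg hg1 (-x) (E.neg_mem hx) (by simpa using hx1) f b hb0 hb hfg
    (fun t => by simpa using H (-t))
  have h0 := H 0
  simp only [zero_smul, add_zero] at h0
  rw [map_neg] at k2
  have k3 : |f x| ≤ (2 + 2 * C) * (b - f g + ε) ^ (1 / q) := abs_le.2 ⟨by linarith, k1⟩
  have hq0 : 0 < q := hpq.symm.pos
  have hnn : 0 ≤ b - f g + ε := by nlinarith
  calc |f x| ^ q ≤ ((2 + 2 * C) * (b - f g + ε) ^ (1 / q)) ^ q :=
        Real.rpow_le_rpow (abs_nonneg _) k3 hq0.le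
    _ = _ := by
      rw [Real.mul_rpow (by positivity) (Real.rpow_nonneg hnn _), ← Real.rpow_mul hnn,
        one_div_mul_cancel hq0.ne', Real.rpow_one]

theorem exists_finiteDimensional_lift {A B : Type*} [NormedAddCommGroup A] [NormedSpace ℝ A]
    [NormedAddCommGroup B] [NormedSpace ℝ B] [FiniteDimensional ℝ B] (T : A →L[ℝ] B)
    (hT : Function.Surjective T) {ε : ℝ} (hε : 0 < ε) :
    ∃ H : Submodule ℝ A, FiniteDimensional ℝ H ∧
      ∀ a, ∃ h ∈ H, T h = T a ∧ ‖h‖ ≤ (1 + ε) * ‖a‖ := by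
  obtain ⟨R, hR⟩ := (T : A →ₗ[ℝ] B).exists_rightInverse_of_surjective (LinearMap.range_eq_top.2 hT)
  have hR' : ∀ b, T (R b) = b := fun b => LinearMap.congr_fun hR b
  let R' : B →L[ℝ] A := LinearMap.toContinuousLinearMap R
  obtain ⟨M, hM0, hM⟩ : ∃ M > 0, ∀ b, ‖R b‖ ≤ M * ‖b‖ := R'.bound
  have htb : TotallyBounded (T '' closedBall (0 : A) 1) :=
    (T.lipschitz.isBounded_image isBounded_closedBall).isCompact_closure.totallyBounded.subset
      subset_closure
  obtain ⟨t, hts, htf, htc⟩ := totallyBounded_iff_subset.1 htb _ (dist_mem_uniformity (div_pos hε hM0))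
  have hts' : ∀ s ∈ t, ∃ a ∈ closedBall (0 : A) 1, T a = s := fun s hs => hts hs
  choose! c hc1 hc2 using hts'
  refine ⟨LinearMap.range R ⊔ Submodule.span ℝ (c '' t), ?_, fun a => ?_⟩
  · have : FiniteDimensional ℝ (Submodule.span ℝ (c '' t)) :=
      FiniteDimensional.span_of_finite ℝ (htf.image c)
    infer_instance
  rcases eq_or_ne a 0 with rfl | ha
  · exact ⟨0, Submodule.zero_mem _, rfl, by simp⟩
  have hn : 0 < ‖a‖ := norm_pos_iff.2 ha
  have hmem : T (‖a‖⁻¹ • a) ∈ T '' closedBall (0 : A) 1 :=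
    ⟨_, by simp [norm_smul, hn.ne'], rfl⟩
  obtain ⟨s, hs, hsd⟩ := mem_iUnion₂.1 (htc hmem)
  have hsd' : ‖T (‖a‖⁻¹ • a) - s‖ < ε / M := by simpa [dist_eq_norm] using hsd
  refine ⟨‖a‖ • (c s + R (T (‖a‖⁻¹ • a) - s)), ?_, ?_, ?_⟩
  · refine Submodule.smul_mem _ _ (Submodule.add_mem _ ?_ ?_)
    · exact Submodule.mem_sup_right (Submodule.subset_span ⟨s, hs, rfl⟩)
    · exact Submodule.mem_sup_left ⟨_, rfl⟩
  · rw [map_smul, map_add, hR', hc2 s hs, map_smul, add_sub_cancel, smul_smul,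
      mul_inv_cancel₀ hn.ne', one_smul]
  · rw [norm_smul, norm_norm, mul_comm]
    refine mul_le_mul_of_nonneg_right ((norm_add_le _ _).trans (add_le_add ?_ ?_)) hn.le
    · simpa using hc1 s hs
    · calc _ ≤ M * ‖T (‖a‖⁻¹ • a) - s‖ := hM _
        _ ≤ M * (ε / M) := by gcongr
        _ = ε := by field_simp

/-- An approximation scheme for a space with an asymptotically smooth norm: finite-dimensional
subspaces `G n` with dense union, cofinite subspaces `E n` on which functionals almost normed by
`G n` are small, and finite-dimensional spaces `V n` of almost norm-preserving extensions of
functionals on `G n`. -/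
structure AUSScheme (q K : ℝ) (X : Type*) [NormedAddCommGroup X] [NormedSpace ℝ X] where
  G : ℕ → Submodule ℝ X
  E : ℕ → Submodule ℝ X
  V : ℕ → Submodule ℝ (StrongDual ℝ X)
  finG : ∀ n, FiniteDimensional ℝ (G n)
  finV : ∀ n, FiniteDimensional ℝ (V n)
  monoG : Monotone G
  monoV : Monotone V
  antiE : Antitone E
  dense : Dense (⋃ n, (G n : Set X))
  small : ∀ n, ∀ g ∈ G n, ‖g‖ ≤ 1 → ∀ x ∈ E n, ‖x‖ ≤ 1 → ∀ (f : StrongDual ℝ X) (b : ℝ),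
    0 ≤ b → b ≤ 2 → 0 ≤ f g → (∀ t : ℝ, f (g + t • x) ≤ b * ‖g + t • x‖) →
      |f x| ^ q ≤ K * (b - f g + (1 / 2) ^ n)
  approx : ∀ n x, ∃ g ∈ G (n + 1), ‖g‖ ≤ 2 * ‖x‖ ∧ x - g ∈ E n
  extend : ∀ n (f : StrongDual ℝ X), ∃ f' ∈ V n, (∀ g ∈ G n, f' g = f g) ∧
    ‖f'‖ ≤ (1 + (1 / 2) ^ n) * ‖f.comp (G n).subtypeL‖

theorem exists_finiteDimensional_approx (E : Submodule ℝ X) (hE : IsClosed (E : Set X))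
    (hE' : E.CoFG) :
    ∃ H : Submodule ℝ X, FiniteDimensional ℝ H ∧ ∀ x, ∃ g ∈ H, ‖g‖ ≤ 2 * ‖x‖ ∧ x - g ∈ E := by
  have : IsClosed (E : Set X) := hE
  have : FiniteDimensional ℝ (X ⧸ E) := hE'
  obtain ⟨H, hH, h⟩ := exists_finiteDimensional_lift E.mkQL E.mkQ_surjective one_pos
  refine ⟨H, hH, fun x => ?_⟩
  obtain ⟨g, hg, hg1, hg2⟩ := h x
  refine ⟨g, hg, by linarith, ?_⟩
  exact (Submodule.Quotient.eq E).1 hg1.symm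

theorem exists_finiteDimensional_extend (G : Submodule ℝ X) [FiniteDimensional ℝ G] {ε : ℝ}
    (hε : 0 < ε) :
    ∃ H : Submodule ℝ (StrongDual ℝ X), FiniteDimensional ℝ H ∧
      ∀ f : StrongDual ℝ X, ∃ f' ∈ H, (∀ g ∈ G, f' g = f g) ∧
        ‖f'‖ ≤ (1 + ε) * ‖f.comp G.subtypeL‖ := by
  let T : StrongDual ℝ X →L[ℝ] StrongDual ℝ G := (ContinuousLinearMap.compL ℝ G X ℝ).flip G.subtypeL
  have hT : Function.Surjective T := fun f => by
    obtain ⟨g, hg, -⟩ := exists_extension_norm_eq G f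
    exact ⟨g, ContinuousLinearMap.ext fun x => hg x⟩
  obtain ⟨H, hH, h⟩ := exists_finiteDimensional_lift (A := StrongDual ℝ X) (B := StrongDual ℝ G) T hT hε
  refine ⟨H, hH, fun f => ?_⟩
  obtain ⟨f0, hf0, hf0'⟩ := exists_extension_norm_eq G (f.comp G.subtypeL)
  obtain ⟨f', hf', h1, h2⟩ := h f0
  refine ⟨f', hf', fun g hg => ?_, h2.trans (by rw [hf0'])⟩
  have := congrArg (fun φ : StrongDual ℝ G => φ ⟨g, hg⟩) h1
  exact this.trans (hf0 ⟨g, hg⟩)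

theorem AUSBound.exists_scheme [TopologicalSpace.SeparableSpace X] {p q C : ℝ}
    (hpq : p.HolderConjugate q) (hC : 0 ≤ C) (h : AUSBound p C X) :
    Nonempty (AUSScheme q ((2 + 2 * C) ^ q) X) := by
  have h1 : ∀ (n : ℕ) (G : Submodule ℝ X), FiniteDimensional ℝ G → _ := fun n G hG =>
    h.exists_submodule_functional hpq hC G (ε := (1 / 2) ^ n) (by positivity)
      (pow_le_one₀ (by norm_num) (by norm_num))
  choose! L hL1 hL2 hL3 using h1
  choose! H hH1 hH2 using exists_finiteDimensional_approx (X := X)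
  have h2 : ∀ (n : ℕ) (G : Submodule ℝ X), FiniteDimensional ℝ G → _ := fun n G hG =>
    exists_finiteDimensional_extend G (ε := (1 / 2) ^ n) (by positivity)
  choose! W hW1 hW2 using h2
  obtain ⟨x, hx⟩ := TopologicalSpace.exists_dense_seq X
  let next : ℕ → Submodule ℝ X × Submodule ℝ X → Submodule ℝ X := fun n s =>
    s.1 ⊔ H s.2 ⊔ Submodule.span ℝ {x n}
  let s : ℕ → Submodule ℝ X × Submodule ℝ X := fun n => Nat.rec (⊥, L 0 ⊥)
    (fun n s => (next n s, s.2 ⊓ L (n + 1) (next n s))) n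
  have s0 : s 0 = (⊥, L 0 ⊥) := rfl
  have ss : ∀ n, s (n + 1) = (next n (s n), (s n).2 ⊓ L (n + 1) (next n (s n))) := fun n => rfl
  have hs : ∀ n, FiniteDimensional ℝ (s n).1 ∧ IsClosed ((s n).2 : Set X) ∧ (s n).2.CoFG ∧
      (s n).2 ≤ L n (s n).1 := by
    intro n
    induction n with
    | zero =>
      rw [s0]
      have : FiniteDimensional ℝ (⊥ : Submodule ℝ X) := inferInstance
      exact ⟨this, hL1 0 ⊥ this, hL2 0 ⊥ this, le_rfl⟩
    | succ n ih =>
      obtain ⟨i1, i2, i3, i4⟩ := ih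
      have f1 : FiniteDimensional ℝ (H (s n).2) := hH1 _ i2 i3
      have f2 : FiniteDimensional ℝ (next n (s n)) := by
        have : FiniteDimensional ℝ (Submodule.span ℝ {x n}) :=
          FiniteDimensional.span_of_finite ℝ (finite_singleton _)
        infer_instance
      rw [ss]
      exact ⟨f2, i2.inter (hL1 _ _ f2), i3.inf (hL2 _ _ f2), inf_le_right⟩
  have hV : ∀ n, FiniteDimensional ℝ (partialSups (fun n => W n (s n).1) n) := by
    intro n
    induction n with
    | zero => rw [partialSups_zero]; exact hW1 _ _ (hs 0).1
    | succ n ih =>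
      rw [partialSups_add_one]
      have := hW1 (n + 1) _ (hs (n + 1)).1
      infer_instance
  refine ⟨⟨fun n => (s n).1, fun n => (s n).2, partialSups (fun n => W n (s n).1),
    fun n => (hs n).1, hV, ?_, (partialSups _).monotone, ?_, ?_, ?_, ?_, ?_⟩⟩
  · exact monotone_nat_of_le_succ fun n => le_sup_left.trans le_sup_left
  · exact antitone_nat_of_succ_le fun n => inf_le_left
  · refine hx.mono ?_
    rintro _ ⟨n, rfl⟩
    exact mem_iUnion.2 ⟨n + 1, (le_sup_right : _ ≤ next n (s n)) (Submodule.mem_span_singleton_self _)⟩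
  · intro n g hg hg1 y hy
    exact hL3 n _ (hs n).1 g hg hg1 y ((hs n).2.2.2 hy)
  · intro n y
    obtain ⟨g, hg, h3⟩ := hH2 _ (hs n).2.1 (hs n).2.2.1 y
    exact ⟨g, (le_sup_right.trans le_sup_left : _ ≤ next n (s n)) hg, h3⟩
  · intro n f
    obtain ⟨g, hg, h3⟩ := hW2 n _ (hs n).1 f
    exact ⟨g, le_partialSups (fun n => W n (s n).1) n hg, h3⟩

end Approximation

section BlockNorms

/-- Coordinates in levels `n ≤ k < m` and position `j < d k`. -/
def levelBox (d : ℕ → ℕ) (n m : ℕ) : Finset (ℕ × ℕ) :=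
  ((Finset.Ico n m).sigma fun k => Finset.range (d k)).map (Equiv.sigmaEquivProd ℕ ℕ).toEmbedding

theorem mem_levelBox {d : ℕ → ℕ} {n m : ℕ} {i : ℕ × ℕ} :
    i ∈ levelBox d n m ↔ (n ≤ i.1 ∧ i.1 < m) ∧ i.2 < d i.1 := by
  obtain ⟨k, j⟩ := i
  simp [levelBox]

theorem sum_levelBox {M : Type*} [AddCommMonoid M] (d : ℕ → ℕ) (n m : ℕ) (f : ℕ × ℕ → M) :
    ∑ i ∈ levelBox d n m, f i = ∑ k ∈ Finset.Ico n m, ∑ j ∈ Finset.range (d k), f (k, j) := by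
  simp [levelBox, Finset.sum_sigma]

/-- A seminorm on finitely supported double sequences, for which the coordinates `(k, j)` with
`j < d k` are exactly the relevant ones, satisfying upper `p`-estimates for cuts between levels. -/
structure IsBlockNorm (p : ℝ) (d : ℕ → ℕ) (N : Seminorm ℝ (ℕ × ℕ →₀ ℝ)) : Prop where
  eq_zero_iff : ∀ a, N a = 0 ↔ ∀ i, i.2 < d i.1 → a i = 0
  mono : ∀ n a, N (a.filter fun i => i.1 < n) ≤ N a
  cut : ∀ n a, N a ^ p ≤ N (a.filter fun i => i.1 < n) ^ p + N (a.filter fun i => n ≤ i.1) ^ p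

/-- Coefficient families whose partial sums against the test set have bounded `q`-variation. -/
def BoundedVar (q : ℝ) (d : ℕ → ℕ) (S : Set (ℕ × ℕ → ℝ)) (A : ℝ) (c : ℕ × ℕ → ℝ) : Prop :=
  (∀ i, d i.1 ≤ i.2 → c i = 0) ∧ ∃ μ : ℕ → ℝ, Monotone μ ∧ (∀ n, 0 ≤ μ n ∧ μ n ≤ A) ∧
    ∀ a ∈ S, ∀ n m, n ≤ m → |∑ i ∈ levelBox d n m, c i * a i| ^ q ≤ μ m - μ n

variable {p q : ℝ} {d : ℕ → ℕ} {S : Set (ℕ × ℕ → ℝ)}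

theorem BoundedVar.smul {A : ℝ} {c : ℕ × ℕ → ℝ} (h : BoundedVar q d S A c) {t : ℝ}
    (ht : 0 ≤ t) : BoundedVar q d S (t ^ q * A) (t • c) := by
  obtain ⟨h0, μ, h1, h2, h3⟩ := h
  have htq := Real.rpow_nonneg ht q
  refine ⟨fun i hi => by simp [h0 i hi], fun n => t ^ q * μ n, fun n m hnm => ?_, fun n => ⟨?_, ?_⟩,
    fun a ha n m hnm => ?_⟩
  · exact mul_le_mul_of_nonneg_left (h1 hnm) htq
  · exact mul_nonneg htq (h2 n).1
  · exact mul_le_mul_of_nonneg_left (h2 n).2 htq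
  · simp only [Pi.smul_apply, smul_eq_mul, mul_assoc, ← Finset.mul_sum]
    rw [abs_mul, abs_of_nonneg ht, Real.mul_rpow ht (abs_nonneg _), ← mul_sub]
    exact mul_le_mul_of_nonneg_left (h3 a ha n m hnm) htq

theorem BoundedVar.mono {A B : ℝ} (hAB : A ≤ B) {c : ℕ × ℕ → ℝ} (h : BoundedVar q d S A c) :
    BoundedVar q d S B c := by
  obtain ⟨h0, μ, h1, h2, h3⟩ := h
  exact ⟨h0, μ, h1, fun n => ⟨(h2 n).1, (h2 n).2.trans hAB⟩, h3⟩

theorem BoundedVar.split (hq : 0 < q) {A : ℝ} {c : ℕ × ℕ → ℝ} (h : BoundedVar q d S A c) (n : ℕ) :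
    ∃ B, 0 ≤ B ∧ B ≤ A ∧ BoundedVar q d S B (fun i => if i.1 < n then c i else 0) ∧
      BoundedVar q d S (A - B) (fun i => if n ≤ i.1 then c i else 0) := by
  obtain ⟨h0, μ, h1, h2, h3⟩ := h
  have hz : |(0 : ℝ)| ^ q = 0 := by rw [abs_zero, Real.zero_rpow hq.ne']
  refine ⟨μ n, (h2 n).1, (h2 n).2, ⟨fun i hi => ?_, fun k => μ (min k n), ?_, fun k => ⟨?_, ?_⟩, ?_⟩,
    ⟨fun i hi => ?_, fun k => μ (max k n) - μ n, ?_, fun k => ⟨?_, ?_⟩, ?_⟩⟩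
  · simp [h0 i hi]
  · exact fun k l hkl => h1 (min_le_min_right n hkl)
  · exact (h2 _).1
  · exact h1 (min_le_right _ _)
  · intro a ha l m hlm
    have : ∑ i ∈ levelBox d l m, (if i.1 < n then c i else 0) * a i
        = ∑ i ∈ levelBox d l (min m n), c i * a i := by
      simp only [ite_mul, zero_mul, ← Finset.sum_filter]
      congr 1
      ext i
      simp only [Finset.mem_filter, mem_levelBox]
      omega
    rw [this]
    rcases le_or_gt l n with hl | hl
    · have := h3 a ha l (min m n) (le_min hlm hl)
      simpa [min_eq_left hl] using this
    · have : levelBox d l (min m n) = ∅ := by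
        ext i
        simp only [mem_levelBox, Finset.notMem_empty, iff_false]
        omega
      rw [this, Finset.sum_empty, hz]
      exact sub_nonneg.2 (h1 (min_le_min_right n hlm))
  · simp [h0 i hi]
  · exact fun k l hkl => sub_le_sub_right (h1 (max_le_max_right n hkl)) _
  · exact sub_nonneg.2 (h1 (le_max_right _ _))
  · exact sub_le_sub_right (h2 _).2 _
  · intro a ha l m hlm
    have : ∑ i ∈ levelBox d l m, (if n ≤ i.1 then c i else 0) * a i
        = ∑ i ∈ levelBox d (max l n) m, c i * a i := by
      simp only [ite_mul, zero_mul, ← Finset.sum_filter]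
      congr 1
      ext i
      simp only [Finset.mem_filter, mem_levelBox]
      omega
    rw [this]
    rcases le_or_gt n m with hm | hm
    · have := h3 a ha (max l n) m (max_le hlm hm)
      simpa [max_eq_left hm] using this
    · have : levelBox d (max l n) m = ∅ := by
        ext i
        simp only [mem_levelBox, Finset.notMem_empty, iff_false]
        omega
      rw [this, Finset.sum_empty, hz]
      exact sub_nonneg.2 (sub_le_sub_right (h1 (max_le_max_right n hlm)) _)

theorem linearCombination_eq_sum_levelBox {M : Type*} [AddCommGroup M] [Module ℝ M]
    {v : ℕ × ℕ → M} (hv : ∀ i, d i.1 ≤ i.2 → v i = 0) (a : ℕ × ℕ →₀ ℝ) {m : ℕ}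
    (hm : ∀ i, a i ≠ 0 → i.1 < m) :
    Finsupp.linearCombination ℝ v a = ∑ i ∈ levelBox d 0 m, a i • v i := by
  rw [Finsupp.linearCombination_apply, Finsupp.sum,
    ← Finset.sum_filter_of_ne (p := fun i => i.2 < d i.1)]
  · refine Finset.sum_subset (fun i hi => ?_) fun i hi hi' => ?_
    · rw [Finset.mem_filter, Finsupp.mem_support_iff] at hi
      exact mem_levelBox.2 ⟨⟨Nat.zero_le _, hm i hi.1⟩, hi.2⟩
    · rw [Finset.mem_filter, Finsupp.mem_support_iff, not_and', not_not] at hi'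
      rw [hi' (mem_levelBox.1 hi).2, zero_smul]
  · intro i _ hi
    by_contra h
    exact hi (by rw [hv i (not_lt.1 h), smul_zero])

theorem exists_level_bound (a : ℕ × ℕ →₀ ℝ) : ∃ m, ∀ i, a i ≠ 0 → i.1 < m :=
  ⟨a.support.sup (fun i => i.1 + 1), fun _ hi =>
    Finset.le_sup (f := fun i : ℕ × ℕ => i.1 + 1) (Finsupp.mem_support_iff.2 hi)⟩

theorem linearCombination_ite (P : ℕ × ℕ → Prop) [DecidablePred P] (c : ℕ × ℕ → ℝ)
    (a : ℕ × ℕ →₀ ℝ) :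
    Finsupp.linearCombination ℝ (fun i => if P i then c i else 0) a
      = Finsupp.linearCombination ℝ c (a.filter P) := by
  induction a using Finsupp.induction_linear with
  | zero => rw [map_zero, Finsupp.filter_zero, map_zero]
  | add f g hf hg => rw [map_add, hf, hg, Finsupp.filter_add, map_add]
  | single i x =>
    by_cases h : P i <;> simp [h]

theorem linearCombination_ite_filter (P : ℕ × ℕ → Prop) [DecidablePred P] (c : ℕ × ℕ → ℝ)
    (a : ℕ × ℕ →₀ ℝ) :
    Finsupp.linearCombination ℝ (fun i => if P i then c i else 0) a
      = Finsupp.linearCombination ℝ (fun i => if P i then c i else 0) (a.filter P) := by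
  rw [linearCombination_ite, linearCombination_ite]
  congr 1
  ext i
  by_cases h : P i <;> simp [h]

/-- The test set separates each relevant coordinate within its level. -/
def SeparatesLevels (d : ℕ → ℕ) (S : Set (ℕ × ℕ → ℝ)) : Prop :=
  ∀ i : ℕ × ℕ, i.2 < d i.1 →
    ∃ a ∈ S, a i ≠ 0 ∧ ∀ j, j < d i.1 → j ≠ i.2 → a (i.1, j) = 0

theorem SeparatesLevels.exists_bound (hq : 0 < q) (hS : SeparatesLevels d S) (i : ℕ × ℕ) :
    ∃ M, ∀ c, BoundedVar q d S 1 c → |c i| ≤ M := by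
  by_cases hi : i.2 < d i.1
  · obtain ⟨a, ha, h1, h2⟩ := hS i hi
    refine ⟨1 / |a i|, fun c hc => ?_⟩
    obtain ⟨-, μ, -, k2, k3⟩ := hc
    have := k3 a ha i.1 (i.1 + 1) (Nat.le_succ _)
    rw [sum_levelBox, Nat.Ico_succ_singleton, Finset.sum_singleton,
      Finset.sum_eq_single_of_mem i.2 (Finset.mem_range.2 hi) (fun j hj hji => by
        rw [h2 j (Finset.mem_range.1 hj) hji, mul_zero])] at this
    have h3 : |c i * a i| ^ q ≤ 1 := by
      have := (k2 i.1).1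
      have := (k2 (i.1 + 1)).2
      simp only [Prod.mk.eta] at *
      linarith
    rw [le_div_iff₀ (abs_pos.2 h1), ← abs_mul]
    by_contra! hlt
    exact absurd h3 (not_le.2 (Real.one_lt_rpow hlt hq))
  · exact ⟨0, fun c hc => by rw [hc.1 i (not_lt.1 hi), abs_zero]⟩

/-- The seminorm dual to the coefficient families of bounded variation. -/
noncomputable def varNorm (q : ℝ) (d : ℕ → ℕ) (S : Set (ℕ × ℕ → ℝ)) : Seminorm ℝ (ℕ × ℕ →₀ ℝ) :=
  ⨆ c : {c // BoundedVar q d S 1 c}, (normSeminorm ℝ ℝ).comp (Finsupp.linearCombination ℝ c.1)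

theorem varNorm_bddAbove (hq : 0 < q) (hS : SeparatesLevels d S) :
    BddAbove (range fun c : {c // BoundedVar q d S 1 c} =>
      (normSeminorm ℝ ℝ).comp (Finsupp.linearCombination ℝ c.1)) := by
  rw [Seminorm.bddAbove_range_iff]
  intro a
  choose M hM using hS.exists_bound hq
  refine ⟨∑ i ∈ a.support, |a i| * M i, ?_⟩
  rintro _ ⟨c, rfl⟩
  simp only [Seminorm.comp_apply, coe_normSeminorm, Finsupp.linearCombination_apply, Finsupp.sum,
    Real.norm_eq_abs]
  refine (Finset.abs_sum_le_sum_abs _ _).trans (Finset.sum_le_sum fun i _ => ?_)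
  rw [smul_eq_mul, abs_mul]
  exact mul_le_mul_of_nonneg_left (hM i c.1 c.2) (abs_nonneg _)

theorem le_varNorm_one (hq : 0 < q) (hS : SeparatesLevels d S) {c : ℕ × ℕ → ℝ}
    (hc : BoundedVar q d S 1 c) (a : ℕ × ℕ →₀ ℝ) :
    |Finsupp.linearCombination ℝ c a| ≤ varNorm q d S a := by
  rw [varNorm, Seminorm.coe_iSup_eq (varNorm_bddAbove hq hS), iSup_apply]
  exact le_ciSup (f := fun c : {c // BoundedVar q d S 1 c} =>
      (normSeminorm ℝ ℝ).comp (Finsupp.linearCombination ℝ c.1) a)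
      (Seminorm.bddAbove_range_iff.1 (varNorm_bddAbove hq hS) a) ⟨c, hc⟩

theorem boundedVar_zero (hq : 0 < q) : BoundedVar q d S 1 0 :=
  ⟨fun _ _ => rfl, 0, monotone_const, fun _ => ⟨le_rfl, zero_le_one⟩, fun a _ n m _ => by
    simp [Real.zero_rpow hq.ne']⟩

theorem varNorm_le (hq : 0 < q) (hS : SeparatesLevels d S) {a : ℕ × ℕ →₀ ℝ} {r : ℝ}
    (h : ∀ c, BoundedVar q d S 1 c → |Finsupp.linearCombination ℝ c a| ≤ r) :
    varNorm q d S a ≤ r := by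
  rw [varNorm, Seminorm.coe_iSup_eq (varNorm_bddAbove hq hS), iSup_apply]
  have : Nonempty {c // BoundedVar q d S 1 c} := ⟨⟨0, boundedVar_zero hq⟩⟩
  exact ciSup_le fun c => h c.1 c.2

theorem le_varNorm (hq : 0 < q) (hS : SeparatesLevels d S) {c : ℕ × ℕ → ℝ} {A : ℝ} (hA : 0 ≤ A)
    (hc : BoundedVar q d S A c) (a : ℕ × ℕ →₀ ℝ) :
    |Finsupp.linearCombination ℝ c a| ≤ A ^ (1 / q) * varNorm q d S a := by
  have key : ∀ B, A < B → |Finsupp.linearCombination ℝ c a| ≤ B ^ (1 / q) * varNorm q d S a := by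
    intro B hB
    have hB0 : 0 < B := hA.trans_lt hB
    set t := B ^ (1 / q) with ht
    have ht0 : 0 < t := Real.rpow_pos_of_pos hB0 _
    have h1 := (hc.mono hB.le).smul (t := t⁻¹) (inv_nonneg.2 ht0.le)
    have h2 : t⁻¹ ^ q * B = 1 := by
      rw [Real.inv_rpow ht0.le, ht, ← Real.rpow_mul hB0.le, one_div_mul_cancel hq.ne', Real.rpow_one,
        inv_mul_cancel₀ hB0.ne']
    rw [h2] at h1
    have h3 := le_varNorm_one hq hS h1 a
    have h4 : Finsupp.linearCombination ℝ (t⁻¹ • c) a = t⁻¹ * Finsupp.linearCombination ℝ c a := by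
      simp only [Finsupp.linearCombination_apply, Finsupp.sum, Finset.mul_sum, Pi.smul_apply,
        smul_eq_mul]
      exact Finset.sum_congr rfl fun i _ => by ring
    rw [h4, abs_mul, abs_of_pos (inv_pos.2 ht0), inv_mul_eq_div, div_le_iff₀ ht0] at h3
    linarith
  have hcont : Tendsto (fun B : ℝ => B ^ (1 / q) * varNorm q d S a) (𝓝[>] A)
      (𝓝 (A ^ (1 / q) * varNorm q d S a)) := by
    have : ContinuousAt (fun B : ℝ => B ^ (1 / q) * varNorm q d S a) A :=
      (Real.continuousAt_rpow_const _ _ (Or.inr (by positivity))).mul continuousAt_const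
    exact this.tendsto.mono_left nhdsWithin_le_nhds
  exact ge_of_tendsto hcont (eventually_nhdsWithin_of_forall fun B hB => key B hB)

theorem varNorm_le_of_mem (hq : 0 < q) (hS : SeparatesLevels d S) {a : ℕ × ℕ →₀ ℝ} {r : ℝ}
    (hr : 0 < r) (h : (fun i => a i / r) ∈ S) : varNorm q d S a ≤ r := by
  refine varNorm_le hq hS fun c hc => ?_
  obtain ⟨m, hm⟩ := exists_level_bound a
  rw [linearCombination_eq_sum_levelBox hc.1 a hm]
  simp only [smul_eq_mul, mul_comm (a _)]
  obtain ⟨-, μ, -, k2, k3⟩ := hc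
  have h1 := k3 _ h 0 m (Nat.zero_le _)
  have h2 : |∑ i ∈ levelBox d 0 m, c i * (a i / r)| ^ q ≤ 1 := by
    have := (k2 0).1
    have := (k2 m).2
    linarith
  simp only [← mul_div_assoc, ← Finset.sum_div, abs_div, abs_of_pos hr] at h2
  by_contra! hlt
  exact absurd h2 (not_le.2 (Real.one_lt_rpow ((one_lt_div hr).2 hlt) hq))

theorem isBlockNorm_varNorm (hpq : p.HolderConjugate q) (hS : SeparatesLevels d S)
    (hb : ∀ i : ℕ × ℕ, i.2 < d i.1 → ∃ M, ∀ a ∈ S, |a i| ≤ M) : IsBlockNorm p d (varNorm q d S) := by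
  have hq : 0 < q := hpq.symm.pos
  have hp : 0 < p := hpq.pos
  refine ⟨fun a => ⟨fun h0 i hi => ?_, fun h => ?_⟩, fun n a => ?_, fun n a => ?_⟩
  · obtain ⟨M, hM⟩ := hb i hi
    set δ : ℝ := (|M| + 1)⁻¹ with hδ
    have hδ0 : 0 < δ := by positivity
    have hc : BoundedVar q d S 1 (Pi.single i δ) := by
      refine ⟨fun k hk => ?_, fun k => if i.1 < k then 1 else 0, fun k l hkl => ?_, fun k => ?_,
        fun a ha n m hnm => ?_⟩
      · rw [Pi.single_eq_of_ne]
        rintro rfl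
        omega
      · dsimp only
        split_ifs
        all_goals first | omega | norm_num
      · dsimp only
        split_ifs <;> norm_num
      · have e : ∑ k ∈ levelBox d n m, Pi.single (M := fun _ => ℝ) i δ k * a k
            = if i ∈ levelBox d n m then δ * a i else 0 := by
          simp only [Pi.single_apply, ite_mul, zero_mul, Finset.sum_ite_eq']
        rw [e]
        have hle : |δ * a i| ≤ 1 := by
          rw [abs_mul, abs_of_pos hδ0, hδ, inv_mul_le_one₀ (by positivity)]
          exact (hM a ha).trans ((le_abs_self M).trans (by linarith))
        simp only [mem_levelBox]
        split_ifs
        all_goals first | omega | skip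
        · rw [sub_zero]
          exact Real.rpow_le_one (abs_nonneg _) hle hq.le
        all_goals rw [abs_zero, Real.zero_rpow hq.ne']; norm_num
    have h1 := le_varNorm_one hq hS hc a
    rw [h0] at h1
    have h2 : Finsupp.linearCombination ℝ (Pi.single (M := fun _ => ℝ) i δ) a = a i * δ := by
      rw [Finsupp.linearCombination_apply, Finsupp.sum]
      simp only [Pi.single_apply, smul_eq_mul, mul_ite, mul_zero, Finset.sum_ite_eq']
      split_ifs with h
      · rfl
      · simp [Finsupp.notMem_support_iff.1 h]
    rw [h2] at h1
    have := abs_nonpos_iff.1 h1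
    exact (mul_eq_zero.1 this).resolve_right hδ0.ne'
  · refine le_antisymm (varNorm_le hq hS fun c hc => ?_) (apply_nonneg _ _)
    rw [Finsupp.linearCombination_apply, Finsupp.sum, Finset.sum_eq_zero, abs_zero]
    intro i _
    rcases lt_or_ge i.2 (d i.1) with hi | hi
    · rw [h i hi, zero_smul]
    · rw [hc.1 i hi, smul_zero]
  · refine varNorm_le hq hS fun c hc => ?_
    obtain ⟨B, hB0, hB1, h1, -⟩ := hc.split hq n
    rw [← linearCombination_ite]
    exact le_varNorm_one hq hS (h1.mono hB1) a
  · set u := varNorm q d S (a.filter fun i => i.1 < n) with hu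
    set v := varNorm q d S (a.filter fun i => n ≤ i.1) with hv
    have hu0 : 0 ≤ u := apply_nonneg _ _
    have hv0 : 0 ≤ v := apply_nonneg _ _
    have huv : 0 ≤ u ^ p + v ^ p := add_nonneg (Real.rpow_nonneg hu0 _) (Real.rpow_nonneg hv0 _)
    have key : varNorm q d S a ≤ (u ^ p + v ^ p) ^ (1 / p) := by
      refine varNorm_le hq hS fun c hc => ?_
      obtain ⟨B, hB0, hB1, h1, h2⟩ := hc.split hq n
      have hB2 : 0 ≤ 1 - B := sub_nonneg.2 hB1
      have e1 : Finsupp.linearCombination ℝ c a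
          = Finsupp.linearCombination ℝ (fun i => if i.1 < n then c i else 0) a
            + Finsupp.linearCombination ℝ (fun i => if n ≤ i.1 then c i else 0) a := by
        rw [linearCombination_ite, linearCombination_ite, ← map_add]
        congr 1
        ext i
        simp only [Finsupp.add_apply, Finsupp.filter_apply]
        rcases lt_or_ge i.1 n with h | h
        · rw [if_pos h, if_neg (not_le.2 h), add_zero]
        · rw [if_neg (not_lt.2 h), if_pos h, zero_add]
      have l1 := le_varNorm hq hS hB0 h1 (a.filter fun i => i.1 < n)
      have l2 := le_varNorm hq hS hB2 h2 (a.filter fun i => n ≤ i.1)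
      rw [← linearCombination_ite_filter] at l1 l2
      have hol := Real.inner_le_Lp_mul_Lq (Finset.univ : Finset (Fin 2)) ![u, v]
        ![B ^ (1 / q), (1 - B) ^ (1 / q)] hpq
      simp only [Fin.sum_univ_two, Matrix.cons_val_zero, Matrix.cons_val_one] at hol
      rw [abs_of_nonneg hu0, abs_of_nonneg hv0, abs_of_nonneg (Real.rpow_nonneg hB0 _),
        abs_of_nonneg (Real.rpow_nonneg hB2 _), ← Real.rpow_mul hB0, ← Real.rpow_mul hB2,
        one_div_mul_cancel hq.ne', Real.rpow_one, Real.rpow_one, add_sub_cancel, Real.one_rpow,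
        mul_one] at hol
      rw [e1]
      refine (abs_add_le _ _).trans ?_
      linarith
    calc varNorm q d S a ^ p ≤ ((u ^ p + v ^ p) ^ (1 / p)) ^ p :=
          Real.rpow_le_rpow (apply_nonneg _ _) key hp.le
      _ = u ^ p + v ^ p := by
        rw [← Real.rpow_mul huv, one_div_mul_cancel hp.ne', Real.rpow_one]

end BlockNorms

section Blocks

theorem exists_variation {α : ℕ → ℝ} (hα : Monotone α) (h0 : ∀ n, 0 ≤ α n) (h1 : ∀ n, α n ≤ 1) :
    ∃ μ : ℕ → ℝ, Monotone μ ∧ (∀ n, 0 ≤ μ n ∧ μ n ≤ 19) ∧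
      (∀ n l, 2 ≤ n → n < l → α l - α (n - 2) + (1 / 2) ^ (n - 2) ≤ μ l - μ n) ∧
      ∀ n l, n < 2 → n < l → 4 ≤ μ l - μ n := by
  have hpow : ∀ n l : ℕ, n < l → (1 / 2 : ℝ) ^ l ≤ (1 / 2) ^ n / 2 := fun n l hnl => by
    have : (1 / 2 : ℝ) ^ l ≤ (1 / 2) ^ (n + 1) :=
      pow_le_pow_of_le_one (by norm_num) (by norm_num) hnl
    rw [pow_succ] at this
    linarith
  have hpos : ∀ n : ℕ, 0 < (1 / 2 : ℝ) ^ n := fun n => by positivity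
  refine ⟨fun n => α n + α (n - 1) + α (n - 2) + 8 * (1 - (1 / 2) ^ n) + 4 * (min n 2 : ℕ),
    monotone_nat_of_le_succ fun n => ?_, fun n => ⟨?_, ?_⟩, fun n l hn hl => ?_,
    fun n l hn hl => ?_⟩
  · have e1 := hα (Nat.le_succ n)
    have e2 : α (n - 1) ≤ α (n + 1 - 1) := hα (by omega)
    have e3 : α (n - 2) ≤ α (n + 1 - 2) := hα (by omega)
    have e4 := hpow n (n + 1) (Nat.lt_succ_self n)
    have e5 := hpos n
    have e6 : ((min n 2 : ℕ) : ℝ) ≤ (min (n + 1) 2 : ℕ) := by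
      exact_mod_cast min_le_min_right 2 (Nat.le_succ n)
    simp only [Nat.succ_eq_add_one] at *
    linarith
  · have e := pow_le_one₀ (n := n) (by norm_num : (0 : ℝ) ≤ 1 / 2) (by norm_num)
    have := h0 n
    have := h0 (n - 1)
    have := h0 (n - 2)
    have : (0 : ℝ) ≤ (min n 2 : ℕ) := Nat.cast_nonneg _
    linarith
  · have := h1 n
    have := h1 (n - 1)
    have := h1 (n - 2)
    have := hpos n
    have : ((min n 2 : ℕ) : ℝ) ≤ (2 : ℕ) := by exact_mod_cast min_le_right n 2
    rw [Nat.cast_ofNat] at this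
    linarith
  · obtain ⟨n, rfl⟩ : ∃ k, n = k + 2 := ⟨n - 2, by omega⟩
    have e1 : α (n + 2) ≤ α (l - 1) := hα (by omega)
    have e2 : α (n + 2 - 1) ≤ α (l - 2) := hα (by omega)
    have e3 := hpow _ _ hl
    have e4 : (1 / 2 : ℝ) ^ (n + 2) = (1 / 2) ^ n / 4 := by rw [pow_add]; norm_num; ring
    dsimp only
    rw [min_eq_right hn, min_eq_right (hn.trans hl.le)]
    simp only [Nat.add_sub_cancel] at *
    linarith
  · have e1 := hα hl.le
    have e2 : α (n - 1) ≤ α (l - 1) := hα (by omega)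
    have e3 : α (n - 2) ≤ α (l - 2) := hα (by omega)
    have e4 := hpow _ _ hl
    have e5 := hpos n
    have e6 : ((min n 2 : ℕ) : ℝ) + 1 ≤ (min l 2 : ℕ) := by
      exact_mod_cast (by omega : min n 2 + 1 ≤ min l 2)
    linarith

theorem BoundedVar.of_estimates {q : ℝ} (hq : 0 < q) {d : ℕ → ℕ} {S : Set (ℕ × ℕ → ℝ)}
    {c : ℕ × ℕ → ℝ} (hc : ∀ i, d i.1 ≤ i.2 → c i = 0) {α : ℕ → ℝ} (hα : Monotone α)
    (h0 : ∀ n, 0 ≤ α n) (h1 : ∀ n, α n ≤ 1) {K : ℝ} (hK : 0 ≤ K)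
    (H1 : ∀ a ∈ S, ∀ n l, n + 2 < l →
      |∑ i ∈ levelBox d (n + 2) l, c i * a i| ^ q ≤ K * (α l - α n + (1 / 2) ^ n))
    (H2 : ∀ a ∈ S, ∀ n l, n < 2 → |∑ i ∈ levelBox d n l, c i * a i| ^ q ≤ K) :
    BoundedVar q d S (K * 19) c := by
  obtain ⟨μ, m1, m2, m3, m4⟩ := exists_variation hα h0 h1
  refine ⟨hc, fun n => K * μ n, fun n m h => mul_le_mul_of_nonneg_left (m1 h) hK,
    fun n => ⟨mul_nonneg hK (m2 n).1, mul_le_mul_of_nonneg_left (m2 n).2 hK⟩, ?_⟩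
  intro a ha n l hnl
  rcases hnl.eq_or_lt with rfl | hl
  · rw [sum_levelBox, Finset.Ico_self, Finset.sum_empty, abs_zero, Real.zero_rpow hq.ne', sub_self]
  rw [← mul_sub]
  rcases lt_or_ge n 2 with hn | hn
  · refine (H2 a ha n l hn).trans ?_
    have := m4 n l hn hl
    nlinarith
  · obtain ⟨n, rfl⟩ : ∃ k, n = k + 2 := ⟨n - 2, by omega⟩
    exact (H1 a ha n l hl).trans (mul_le_mul_of_nonneg_left (m3 _ l hn hl) hK)

theorem exists_coordinates {V : Type*} [NormedAddCommGroup V] [NormedSpace ℝ V]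
    (F : Submodule ℝ V) [FiniteDimensional ℝ F] :
    ∃ (d : ℕ) (v : ℕ → V), (∀ j, v j ∈ F) ∧ (∀ j, d ≤ j → v j = 0) ∧
      LinearIndependent ℝ (fun j : Fin d => v j) ∧
      (∀ z ∈ F, ∃ c : ℕ → ℝ, (z = 0 → c = 0) ∧ (∀ j, d ≤ j → c j = 0) ∧
        z = ∑ j ∈ Finset.range d, c j • v j) := by
  let b := Module.finBasis ℝ F
  refine ⟨Module.finrank ℝ F, fun j => if h : j < Module.finrank ℝ F then b ⟨j, h⟩ else 0,
    fun j => ?_, fun j hj => dif_neg (not_lt.2 hj), ?_, fun z hz => ?_⟩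
  · dsimp only
    split_ifs
    · exact Subtype.coe_prop _
    · exact F.zero_mem
  · have := b.linearIndependent.map' F.subtype (Submodule.ker_subtype F)
    have e : (fun j : Fin (Module.finrank ℝ F) =>
        if h : (j : ℕ) < Module.finrank ℝ F then (b ⟨j, h⟩ : V) else 0) = F.subtype ∘ b := by
      ext j
      simp
    exact e ▸ this
  · refine ⟨fun j => if h : j < Module.finrank ℝ F then b.repr ⟨z, hz⟩ ⟨j, h⟩ else 0,
      ?_, fun j hj => dif_neg (not_lt.2 hj), ?_⟩
    · rintro rfl
      have : (⟨0, hz⟩ : F) = 0 := rfl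
      ext j
      simp [this]
    · rw [Finset.sum_range]
      have := congrArg (Subtype.val) (b.sum_repr ⟨z, hz⟩)
      rw [AddSubmonoidClass.coe_finsetSum] at this
      simpa using this.symm

theorem exists_abs_le_norm_sum {V : Type*} [NormedAddCommGroup V] [NormedSpace ℝ V] {d : ℕ}
    {v : ℕ → V} (hv : LinearIndependent ℝ (fun j : Fin d => v j)) :
    ∃ M : ℝ, 0 ≤ M ∧ ∀ (c : ℕ → ℝ) (j : ℕ), j < d → |c j| ≤ M * ‖∑ j ∈ Finset.range d, c j • v j‖ := by
  let f : (Fin d → ℝ) →ₗ[ℝ] V := Fintype.linearCombination ℝ (fun j : Fin d => v j)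
  have hf : LinearMap.ker f = ⊥ := by
    rw [LinearMap.ker_eq_bot]
    exact hv.fintypeLinearCombination_injective
  obtain ⟨K, hK, h⟩ := f.exists_antilipschitzWith hf
  refine ⟨K, K.2, fun c j hj => ?_⟩
  have h1 := h.le_mul_dist (fun j : Fin d => c j) 0
  rw [dist_zero_right, map_zero, dist_zero_right] at h1
  have h2 : f (fun j : Fin d => c j) = ∑ j ∈ Finset.range d, c j • v j := by
    rw [Finset.sum_range]
    rfl
  rw [h2] at h1
  exact (norm_le_pi_norm (fun j : Fin d => c j) ⟨j, hj⟩).trans h1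

theorem exists_near_norming {X : Type*} [NormedAddCommGroup X] [NormedSpace ℝ X]
    (G : Submodule ℝ X) (f : StrongDual ℝ X) {η : ℝ} (hη : 0 < η) :
    ∃ g ∈ G, ‖g‖ ≤ 1 ∧ 0 ≤ f g ∧ ‖f.comp G.subtypeL‖ - η ≤ f g := by
  by_contra! H
  have h1 : ‖f.comp G.subtypeL‖ ≤ max 0 (‖f.comp G.subtypeL‖ - η) := by
    refine ContinuousLinearMap.opNorm_le_of_unit_norm (le_max_left _ _) fun g hg => ?_
    have hg1 : ‖(g : X)‖ ≤ 1 := hg.le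
    rw [Real.norm_eq_abs]
    change |f (g : X)| ≤ _
    rcases le_total 0 (f g) with h | h
    · rw [abs_of_nonneg h]
      exact (H g g.2 hg1 h).le.trans (le_max_right _ _)
    · rw [abs_of_nonpos h, ← map_neg]
      exact (H (-g) (G.neg_mem g.2) (by simpa using hg1) (by rw [map_neg]; linarith)).le.trans
        (le_max_right _ _)
  have h2 := H 0 G.zero_mem (by simp) (by simp)
  rw [map_zero] at h2
  rw [max_eq_right h2.le] at h1
  linarith

theorem norm_restrict_mono {X : Type*} [NormedAddCommGroup X] [NormedSpace ℝ X]
    (f : StrongDual ℝ X) {G G' : Submodule ℝ X} (h : G ≤ G') :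
    ‖f.comp G.subtypeL‖ ≤ ‖f.comp G'.subtypeL‖ := by
  refine ContinuousLinearMap.opNorm_le_bound _ (norm_nonneg (f.comp G'.subtypeL)) fun g => ?_
  exact (f.comp G'.subtypeL).le_opNorm ⟨g, h g.2⟩

theorem norm_restrict_le {X : Type*} [NormedAddCommGroup X] [NormedSpace ℝ X]
    (f : StrongDual ℝ X) (G : Submodule ℝ X) : ‖f.comp G.subtypeL‖ ≤ ‖f‖ :=
  ContinuousLinearMap.opNorm_le_bound _ (norm_nonneg _) fun g => f.le_opNorm g

end Blocks

section Representation

theorem sum_levelBox_consecutive {M : Type*} [AddCommMonoid M] (d : ℕ → ℕ) {n m : ℕ} (h : n ≤ m)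
    (f : ℕ × ℕ → M) :
    ∑ i ∈ levelBox d 0 n, f i + ∑ i ∈ levelBox d n m, f i = ∑ i ∈ levelBox d 0 m, f i := by
  simp only [sum_levelBox]
  exact Finset.sum_Ico_consecutive _ (Nat.zero_le _) h

variable {X : Type*} [NormedAddCommGroup X] [NormedSpace ℝ X] {p q K : ℝ}

theorem AUSScheme.abs_rpow_le (hK : 0 ≤ K) (s : AUSScheme q K X)
    (n : ℕ) (f : StrongDual ℝ X) {b : ℝ} (hb : 0 ≤ b) (hb2 : b ≤ 2) {x : X} (hx : x ∈ s.E n)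
    {R : ℝ} (hR : 0 < R) (hxR : ‖x‖ ≤ R)
    (H : ∀ g ∈ s.G n, ∀ t : ℝ, f (g + t • x) ≤ b * ‖g + t • x‖) :
    |f x| ^ q ≤ R ^ q * (K * (b - ‖f.comp (s.G n).subtypeL‖ + 2 * (1 / 2) ^ n)) := by
  obtain ⟨g, hg, hg1, hg2, hg3⟩ := exists_near_norming (s.G n) f (η := (1 / 2) ^ n) (by positivity)
  have h1 := s.small n g hg hg1 (R⁻¹ • x) ((s.E n).smul_mem _ hx)
    (by
      rw [norm_smul, Real.norm_eq_abs, abs_of_pos (inv_pos.2 hR), inv_mul_eq_div]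
      exact (div_le_one hR).2 hxR) f b hb hb2 hg2
    (fun t => by rw [smul_smul]; exact H g hg _)
  have h2 : |f x| = R * |f (R⁻¹ • x)| := by
    rw [map_smul, smul_eq_mul, abs_mul, abs_of_pos (inv_pos.2 hR), mul_inv_cancel_left₀ hR.ne']
  rw [h2, Real.mul_rpow hR.le (abs_nonneg _)]
  refine mul_le_mul_of_nonneg_left (h1.trans (mul_le_mul_of_nonneg_left ?_ hK))
    (Real.rpow_nonneg hR.le _)
  linarith

theorem AUSScheme.exists_blockNorm_quotient (hpq : p.HolderConjugate q) (hK : 0 ≤ K)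
    (s : AUSScheme q K X) :
    ∃ d N, IsBlockNorm p d N ∧ ∃ T : (ℕ × ℕ →₀ ℝ) →ₗ[ℝ] X, (∃ C, ∀ a, ‖T a‖ ≤ C * N a) ∧
      ∀ n, ∀ x ∈ s.G n, ∃ a, T a = x ∧ N a ≤ 2 * ‖x‖ := by
  have hq : 0 < q := hpq.symm.pos
  obtain ⟨F, hF0, hF1⟩ : ∃ F : ℕ → Submodule ℝ X, F 0 = s.G 1 ∧
      ∀ k, F (k + 1) = s.G (k + 2) ⊓ s.E k :=
    ⟨fun k => Nat.casesOn k (s.G 1) fun k => s.G (k + 2) ⊓ s.E k, rfl, fun k => rfl⟩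
  have hFG : ∀ k, F k ≤ s.G (k + 1) := by
    rintro (_ | k)
    · exact hF0.le
    · rw [hF1]; exact inf_le_left
  have hFd : ∀ k, FiniteDimensional ℝ (F k) := fun k =>
    have := s.finG (k + 1)
    Submodule.finiteDimensional_of_le (hFG k)
  choose d v hv1 hv2 hv3 hv4 using fun k => exists_coordinates (F k)
  let w : ℕ × ℕ → X := fun i => v i.1 i.2
  have hw : ∀ i : ℕ × ℕ, d i.1 ≤ i.2 → w i = 0 := fun i hi => hv2 _ _ hi
  let S : Set (ℕ × ℕ → ℝ) := {a | ∀ n, ‖∑ i ∈ levelBox d 0 n, a i • w i‖ ≤ 1}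
  have hS : SeparatesLevels d S := by
    intro i hi
    have hpos : 0 < (‖w i‖ + 1)⁻¹ := by positivity
    refine ⟨Pi.single i (‖w i‖ + 1)⁻¹, fun n => ?_, ?_, fun j hj hji => ?_⟩
    · simp only [Pi.single_apply, ite_smul, zero_smul, Finset.sum_ite_eq']
      split_ifs
      · rw [norm_smul, Real.norm_eq_abs, abs_of_pos hpos, inv_mul_le_one₀ (by positivity)]
        linarith
      · simp
    · rw [Pi.single_eq_same]
      exact hpos.ne'
    · exact Pi.single_eq_of_ne (fun h => hji (congrArg Prod.snd h)) _
  have hS2 : ∀ a ∈ S, ∀ n m, n ≤ m → ‖∑ i ∈ levelBox d n m, a i • w i‖ ≤ 2 := by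
    intro a ha n m hnm
    have h1 := ha n
    have h2 := ha m
    rw [← sum_levelBox_consecutive d hnm] at h2
    have h3 := norm_sub_le (∑ i ∈ levelBox d 0 n, a i • w i + ∑ i ∈ levelBox d n m, a i • w i)
      (∑ i ∈ levelBox d 0 n, a i • w i)
    rw [add_sub_cancel_left] at h3
    linarith
  have hSb : ∀ i : ℕ × ℕ, i.2 < d i.1 → ∃ M, ∀ a ∈ S, |a i| ≤ M := by
    rintro ⟨k, j⟩ hj
    obtain ⟨M, hM0, hM⟩ := exists_abs_le_norm_sum (hv3 k)
    refine ⟨M * 2, fun a ha => (hM (fun j => a (k, j)) j hj).trans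
      (mul_le_mul_of_nonneg_left ?_ hM0)⟩
    have := hS2 a ha k (k + 1) (Nat.le_succ k)
    rwa [sum_levelBox, Nat.Ico_succ_singleton, Finset.sum_singleton] at this
  have hwG : ∀ (a : ℕ × ℕ → ℝ) n m, ∑ i ∈ levelBox d n m, a i • w i ∈ s.G m := fun a n m =>
    Submodule.sum_mem _ fun i hi => Submodule.smul_mem _ _
      (s.monoG (mem_levelBox.1 hi).1.2 (hFG _ (hv1 _ _)))
  have hwE : ∀ (a : ℕ × ℕ → ℝ) n m, ∑ i ∈ levelBox d (n + 2) m, a i • w i ∈ s.E n := by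
    intro a n m
    refine Submodule.sum_mem _ fun i hi => Submodule.smul_mem _ _ ?_
    obtain ⟨k, hk⟩ : ∃ k, i.1 = k + 1 := ⟨i.1 - 1, by have := (mem_levelBox.1 hi).1.1; omega⟩
    have h1 : w i ∈ F (k + 1) := hk ▸ hv1 i.1 i.2
    rw [hF1] at h1
    exact s.antiE (by have := (mem_levelBox.1 hi).1.1; omega) h1.2
  set A : ℝ := (2 ^ q * (2 * K) + 2 ^ q) * 19 with hA
  have h2q : (0 : ℝ) < 2 ^ q := Real.rpow_pos_of_pos two_pos _
  have hvar : ∀ f : StrongDual ℝ X, ‖f‖ ≤ 1 → BoundedVar q d S A (fun i => f (w i)) := by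
    intro f hf
    have hsum : ∀ (a : ℕ × ℕ → ℝ) n m, ∑ i ∈ levelBox d n m, f (w i) * a i
        = f (∑ i ∈ levelBox d n m, a i • w i) := by
      intro a n m
      rw [map_sum]
      exact Finset.sum_congr rfl fun i _ => by rw [map_smul, smul_eq_mul, mul_comm]
    refine BoundedVar.of_estimates hq (fun i hi => by rw [hw i hi, map_zero])
      (α := fun n => ‖f.comp (s.G n).subtypeL‖) (fun n m h => norm_restrict_mono f (s.monoG h))
      (fun n => norm_nonneg (f.comp (s.G n).subtypeL))
      (fun n => (norm_restrict_le f _).trans hf) (by positivity) ?_ ?_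
    · intro a ha n l hnl
      rw [hsum]
      set α := ‖f.comp (s.G l).subtypeL‖ with hα
      have hα1 : α ≤ 1 := (norm_restrict_le f _).trans hf
      have h1 := s.abs_rpow_le hK n f (b := α) (norm_nonneg (f.comp (s.G l).subtypeL)) (by linarith) (hwE a n l)
        two_pos (hS2 a ha _ _ hnl.le) (fun g hg t => by
          have hmem : g + t • ∑ i ∈ levelBox d (n + 2) l, a i • w i ∈ s.G l :=
            Submodule.add_mem _ (s.monoG (by omega) hg) (Submodule.smul_mem _ _ (hwG _ _ _))
          exact (le_abs_self _).trans ((f.comp (s.G l).subtypeL).le_opNorm ⟨_, hmem⟩))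
      refine h1.trans ?_
      have h3 : ‖f.comp (s.G n).subtypeL‖ ≤ α := norm_restrict_mono f (s.monoG (by omega))
      have h4 : (0 : ℝ) < (1 / 2) ^ n := by positivity
      have h5 : K * (α - ‖f.comp (s.G n).subtypeL‖ + 2 * (1 / 2) ^ n)
          ≤ K * (2 * (α - ‖f.comp (s.G n).subtypeL‖ + (1 / 2) ^ n)) :=
        mul_le_mul_of_nonneg_left (by linarith) hK
      have h6 := mul_le_mul_of_nonneg_left h5 h2q.le
      have h7 : 0 ≤ 2 ^ q * (α - ‖f.comp (s.G n).subtypeL‖ + (1 / 2) ^ n) :=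
        mul_nonneg h2q.le (by linarith)
      linarith
    · intro a ha n l _
      rw [hsum]
      have hb : |f (∑ i ∈ levelBox d n l, a i • w i)| ≤ 2 := by
        rcases le_or_gt n l with hnl | hnl
        · refine (f.le_opNorm _).trans ?_
          have := hS2 a ha n l hnl
          have := norm_nonneg (∑ i ∈ levelBox d n l, a i • w i)
          nlinarith
        · rw [sum_levelBox, Finset.Ico_eq_empty (by omega)]
          simp
      refine (Real.rpow_le_rpow (abs_nonneg _) hb hq.le).trans ?_
      have : 0 ≤ (2 : ℝ) ^ q * (2 * K) := by positivity
      linarith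
  refine ⟨d, varNorm q d S, isBlockNorm_varNorm hpq hS hSb, Finsupp.linearCombination ℝ w,
    ⟨A ^ (1 / q), fun a => ?_⟩, fun n x hx => ?_⟩
  · obtain ⟨f, hf1, hf2⟩ := exists_dual_vector'' ℝ (Finsupp.linearCombination ℝ w a)
    have h1 := le_varNorm hq hS (by positivity) (hvar f hf1) a
    have h2 : Finsupp.linearCombination ℝ (fun i => f (w i)) a
        = f (Finsupp.linearCombination ℝ w a) := by
      simp only [Finsupp.linearCombination_apply, Finsupp.sum, map_sum, map_smul]
    rw [h2, hf2] at h1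
    exact (le_abs_self _).trans h1
  · rcases eq_or_ne x 0 with rfl | hx0
    · exact ⟨0, by simp⟩
    choose g hg1 hg2 hg3 using fun k => s.approx k x
    let t : ℕ → X := fun k => Nat.casesOn k 0 fun k => if n ≤ k + 1 then x else g k
    have t0 : t 0 = 0 := rfl
    have t1 : ∀ k, t (k + 1) = if n ≤ k + 1 then x else g k := fun k => rfl
    have tG : ∀ k, t (k + 1) ∈ s.G (k + 1) := by
      intro k
      rw [t1]
      split_ifs with h
      · exact s.monoG h hx
      · exact hg1 k
    have tE : ∀ k, x - t (k + 1) ∈ s.E k := by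
      intro k
      rw [t1]
      split_ifs
      · simp
      · exact hg3 k
    have tn : ∀ k, ‖t k‖ ≤ 2 * ‖x‖ := by
      rintro (_ | k)
      · rw [t0, norm_zero]; positivity
      · rw [t1]
        split_ifs
        · linarith [norm_nonneg x]
        · exact hg2 k
    have tx : ∀ k, n ≤ k → 0 < k → t k = x := by
      rintro (_ | k) h1 h2
      · omega
      · rw [t1, if_pos h1]
    have tF : ∀ k, t (k + 1) - t k ∈ F k := by
      rintro (_ | k)
      · rw [t0, sub_zero, hF0]; exact tG 0
      · rw [hF1]
        refine ⟨Submodule.sub_mem _ (tG (k + 1)) (s.monoG (Nat.le_succ _) (tG k)), ?_⟩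
        have := Submodule.sub_mem _ (tE k) (s.antiE (Nat.le_succ k) (tE (k + 1)))
        rwa [sub_sub_sub_cancel_left] at this
    choose c hc1 hc2 hc3 using fun k => hv4 k _ (tF k)
    let a : ℕ × ℕ →₀ ℝ := Finsupp.onFinset (levelBox d 0 (n + 1)) (fun i => c i.1 i.2) (by
      intro i hi
      rw [mem_levelBox]
      by_contra hcon
      apply hi
      rcases le_or_gt (d i.1) i.2 with h | h
      · exact hc2 _ _ h
      · rw [hc1 i.1 (by
          rw [tx i.1 (by omega) (by omega), tx (i.1 + 1) (by omega) (by omega), sub_self])]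
        rfl)
    have ha : ∀ i, a i = c i.1 i.2 := fun i => rfl
    have hsum : ∀ m, ∑ i ∈ levelBox d 0 m, a i • w i = t m := by
      intro m
      rw [sum_levelBox]
      calc _ = ∑ k ∈ Finset.Ico 0 m, (t (k + 1) - t k) :=
            Finset.sum_congr rfl fun k _ => (hc3 k).symm
        _ = t m := by rw [← Finset.range_eq_Ico, Finset.sum_range_sub, t0, sub_zero]
    refine ⟨a, ?_, varNorm_le_of_mem hq hS (by positivity) fun m => ?_⟩
    · obtain ⟨m, hm⟩ := exists_level_bound a
      rw [linearCombination_eq_sum_levelBox hw a (m := max m (n + 1))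
        fun i hi => (hm i hi).trans_le (le_max_left _ _), hsum]
      exact tx _ (by omega) (by omega)
    · have h1 : ∑ i ∈ levelBox d 0 m, (a i / (2 * ‖x‖)) • w i = (2 * ‖x‖)⁻¹ • t m := by
        rw [← hsum, Finset.smul_sum]
        exact Finset.sum_congr rfl fun i _ => by rw [smul_smul, div_eq_inv_mul]
      have hpos : 0 < 2 * ‖x‖ := by positivity
      rw [h1, norm_smul, Real.norm_eq_abs, abs_of_pos (inv_pos.2 hpos), inv_mul_le_one₀ hpos]
      exact tn m

theorem LinearIndependent.exists_separating {d : ℕ} {v : ℕ → StrongDual ℝ X}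
    (hv : LinearIndependent ℝ (fun j : Fin d => v j)) {k : ℕ} (hk : k < d) :
    ∃ x : X, v k x ≠ 0 ∧ ∀ j, j < d → j ≠ k → v j x = 0 := by
  have hv' : LinearIndependent ℝ (fun j : Fin d => (v j : X →ₗ[ℝ] ℝ)) :=
    hv.map' (ContinuousLinearMap.coeLM ℝ) (LinearMap.ker_eq_bot.2 ContinuousLinearMap.coe_injective)
  have h1 := (linearIndependent_iff_notMem_span.1 hv') ⟨k, hk⟩
  have h2 : ¬ (⨅ j : {j : Fin d // j ≠ ⟨k, hk⟩}, LinearMap.ker (v j.1 : X →ₗ[ℝ] ℝ))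
      ≤ LinearMap.ker (v k : X →ₗ[ℝ] ℝ) := by
    intro h
    refine h1 (Submodule.span_mono ?_ (mem_span_of_iInf_ker_le_ker h))
    rintro _ ⟨j, rfl⟩
    exact ⟨j.1, ⟨mem_univ _, j.2⟩, rfl⟩
  obtain ⟨x, hx1, hx2⟩ := SetLike.not_le_iff_exists.1 h2
  refine ⟨x, hx2, fun j hj hjk => ?_⟩
  exact (Submodule.mem_iInf _).1 hx1 ⟨⟨j, hj⟩, fun h => hjk (congrArg Fin.val h)⟩

theorem abs_sub_rpow_le (hq : 0 < q) {u v M : ℝ} (hu : |u| ^ q ≤ M) (hv : |v| ^ q ≤ M) :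
    |u - v| ^ q ≤ 2 ^ q * M := by
  have h1 : |u - v| ≤ 2 * max |u| |v| := by
    have := abs_sub u v
    have := le_max_left |u| |v|
    have := le_max_right |u| |v|
    linarith
  have h0 : 0 ≤ max |u| |v| := (abs_nonneg u).trans (le_max_left _ _)
  refine (Real.rpow_le_rpow (abs_nonneg _) h1 hq.le).trans ?_
  rw [Real.mul_rpow two_pos.le h0]
  refine mul_le_mul_of_nonneg_left ?_ (Real.rpow_nonneg two_pos.le _)
  rcases max_choice |u| |v| with h | h <;> rw [h] <;> assumption

theorem AUSScheme.exists_blockNorm_embedding (hpq : p.HolderConjugate q) (hK : 0 ≤ K)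
    (s : AUSScheme q K X) :
    ∃ d N, IsBlockNorm p d N ∧ ∃ J : (⨆ n, s.G n : Submodule ℝ X) →ₗ[ℝ] (ℕ × ℕ →₀ ℝ),
      (∀ x, N (J x) ≤ ‖x‖) ∧ ∃ C, ∀ x, ‖x‖ ≤ C * N (J x) := by
  have hq : 0 < q := hpq.symm.pos
  obtain ⟨L, hL0, hL1⟩ : ∃ L : ℕ → Submodule ℝ (StrongDual ℝ X), (L 0 = s.V 0) ∧
      ∀ k φ, φ ∈ L (k + 1) ↔ φ ∈ s.V (k + 1) ∧ ∀ g ∈ s.G k, φ g = 0 :=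
    ⟨fun k => Nat.casesOn k (s.V 0) fun k => s.V (k + 1) ⊓
      (s.G k).dualAnnihilator.comap (ContinuousLinearMap.coeLM ℝ), rfl, fun k φ => by
        simp [Submodule.mem_dualAnnihilator]⟩
  have hLV : ∀ k, L k ≤ s.V k := by
    rintro (_ | k)
    · exact hL0.le
    · exact fun φ hφ => ((hL1 k φ).1 hφ).1
  have hLd : ∀ k, FiniteDimensional ℝ (L k) := fun k =>
    have := s.finV k
    Submodule.finiteDimensional_of_le (hLV k)
  choose d v hv1 hv2 hv3 hv4 using fun k => exists_coordinates (L k)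
  let w : ℕ × ℕ → StrongDual ℝ X := fun i => v i.1 i.2
  have hw : ∀ i : ℕ × ℕ, d i.1 ≤ i.2 → w i = 0 := fun i hi => hv2 _ _ hi
  have hw0 : ∀ m, ∀ x ∈ s.G m, ∀ i : ℕ × ℕ, w i x ≠ 0 → i ∈ levelBox d 0 (m + 1) := by
    intro m x hx i hi
    rw [mem_levelBox]
    by_contra hcon
    rcases le_or_gt (d i.1) i.2 with h | h
    · exact hi (by rw [hw i h]; rfl)
    · obtain ⟨k, hk⟩ : ∃ k, i.1 = k + 1 := ⟨i.1 - 1, by omega⟩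
      have h1 : w i ∈ L (k + 1) := hk ▸ hv1 i.1 i.2
      exact hi (((hL1 k _).1 h1).2 x (s.monoG (by omega) hx))
  let S : Set (ℕ × ℕ → ℝ) := {a | ∃ x, ‖x‖ ≤ 1 ∧ a = fun i => w i x}
  have hS : SeparatesLevels d S := by
    intro i hi
    obtain ⟨x, hx1, hx2⟩ := (hv3 i.1).exists_separating hi
    have hx0 : 0 < ‖x‖ := norm_pos_iff.2 (by rintro rfl; exact hx1 (map_zero _))
    refine ⟨_, ⟨‖x‖⁻¹ • x, by simp [norm_smul, hx0.ne'], rfl⟩, ?_, fun j hj hji => ?_⟩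
    · rw [map_smul]
      exact smul_ne_zero (inv_ne_zero hx0.ne') hx1
    · change v i.1 j _ = 0
      rw [map_smul, hx2 j hj hji, smul_zero]
  have hSb : ∀ i : ℕ × ℕ, i.2 < d i.1 → ∃ M, ∀ a ∈ S, |a i| ≤ M := by
    refine fun i _ => ⟨‖w i‖, ?_⟩
    rintro _ ⟨x, hx, rfl⟩
    exact (w i).unit_le_opNorm x hx
  have hmem : ∀ x : (⨆ n, s.G n : Submodule ℝ X), ∃ m, (x : X) ∈ s.G m := fun x =>
    (Submodule.mem_iSup_of_directed _ s.monoG.directed_le).1 x.2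
  let J : (⨆ n, s.G n : Submodule ℝ X) →ₗ[ℝ] (ℕ × ℕ →₀ ℝ) :=
    { toFun := fun x => Finsupp.ofSupportFinite (fun i => w i x) (by
        obtain ⟨m, hm⟩ := hmem x
        exact (levelBox d 0 (m + 1)).finite_toSet.subset fun i hi => hw0 m x hm i hi)
      map_add' := fun x y => by ext i; exact map_add (w i) (x : X) (y : X)
      map_smul' := fun r x => by ext i; exact map_smul (w i) r (x : X) }
  have hJ : ∀ x i, J x i = w i x := fun x i => rfl
  set B : ℝ := 2 ^ q * (3 ^ q * (3 * K)) + 4 ^ q with hB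
  have hB0 : 0 ≤ B := by positivity
  refine ⟨d, varNorm q d S, isBlockNorm_varNorm hpq hS hSb, J, fun x => ?_,
    (B * 19) ^ (1 / q), fun x => ?_⟩
  · rcases eq_or_ne x 0 with rfl | hx0
    · simp
    have hpos : 0 < ‖x‖ := norm_pos_iff.2 hx0
    refine varNorm_le_of_mem hq hS hpos ⟨‖x‖⁻¹ • (x : X), ?_, ?_⟩
    · rw [norm_smul, Real.norm_eq_abs, abs_of_pos (inv_pos.2 hpos)]
      exact (inv_mul_cancel₀ hpos.ne').le
    · ext i
      rw [hJ, map_smul, smul_eq_mul, div_eq_inv_mul]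
  · obtain ⟨f0, hf1, hf2⟩ := exists_dual_vector'' ℝ (x : X)
    set α : ℕ → ℝ := fun n => ‖f0.comp (s.G n).subtypeL‖ with hα
    have hα0 : ∀ n, 0 ≤ α n := fun n => norm_nonneg (f0.comp (s.G n).subtypeL)
    have hα1 : ∀ n, α n ≤ 1 := fun n => (norm_restrict_le f0 _).trans hf1
    have hαm : Monotone α := fun n m h => norm_restrict_mono f0 (s.monoG h)
    choose f hfV hfG hfn using fun n => s.extend n f0
    have hhalf : ∀ n : ℕ, (0 : ℝ) < (1 / 2) ^ n := fun n => by positivity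
    have hhalf1 : ∀ n : ℕ, (1 / 2 : ℝ) ^ n ≤ 1 := fun n => pow_le_one₀ (by norm_num) (by norm_num)
    have hfn2 : ∀ n, (1 + (1 / 2) ^ n) * α n ≤ 2 := fun n => by
      have := hα0 n
      have := hα1 n
      have := hhalf n
      have := hhalf1 n
      nlinarith
    let h : ℕ → StrongDual ℝ X := fun n => Nat.casesOn n 0 f
    have h0 : h 0 = 0 := rfl
    have h1 : ∀ n, h (n + 1) = f n := fun n => rfl
    have hn2 : ∀ n, ‖h n‖ ≤ 2 := by
      rintro (_ | n)
      · rw [h0, norm_zero]; exact zero_le_two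
      · exact (hfn n).trans (hfn2 n)
    have hL : ∀ k, h (k + 1) - h k ∈ L k := by
      rintro (_ | k)
      · rw [h0, sub_zero, hL0]; exact hfV 0
      · rw [hL1]
        refine ⟨Submodule.sub_mem _ (hfV (k + 1)) (s.monoV (Nat.le_succ k) (hfV k)), fun g hg => ?_⟩
        rw [h1, h1, sub_apply, hfG k g hg,
          hfG (k + 1) g (s.monoG (Nat.le_succ k) hg), sub_self]
    choose c hc1 hc2 hc3 using fun k => hv4 k _ (hL k)
    have hsum : ∀ n l, n ≤ l → ∀ y : X, ∑ i ∈ levelBox d n l, c i.1 i.2 * w i y = h l y - h n y := by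
      intro n l hnl y
      rw [sum_levelBox, ← Finset.sum_Ico_sub (fun k => h k y) hnl]
      refine Finset.sum_congr rfl fun k _ => ?_
      rw [← sub_apply, hc3 k, sum_apply]
      rfl
    have hvar : BoundedVar q d S (B * 19) (fun i => c i.1 i.2) := by
      refine BoundedVar.of_estimates hq (fun i hi => hc2 _ _ hi) hαm hα0 hα1 hB0 ?_ ?_
      · rintro _ ⟨y, hy, rfl⟩ n l hnl
        rw [hsum _ _ hnl.le]
        obtain ⟨l, rfl⟩ : ∃ k, l = k + 1 := ⟨l - 1, by omega⟩
        rw [h1, h1]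
        obtain ⟨g, hg, hg1, hg2⟩ := s.approx n y
        set e := y - g with he
        have he3 : ‖e‖ ≤ 3 := (norm_sub_le _ _).trans (by linarith)
        have hdiff : f l y - f (n + 1) y = f l e - f (n + 1) e := by
          rw [he, map_sub, map_sub, hfG l g (s.monoG (by omega) hg), hfG (n + 1) g hg]
          ring
        set D := α (l + 1) - α n + (1 / 2) ^ n with hD
        have hD0 : 0 ≤ D := by
          have := hαm (show n ≤ l + 1 by omega)
          have := hhalf n
          linarith
        have key : ∀ i, n ≤ i → i ≤ l + 1 → |f i e| ^ q ≤ 3 ^ q * (3 * K) * D := by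
          intro i hni hil
          have hr : (f i).comp (s.G n).subtypeL = f0.comp (s.G n).subtypeL :=
            ContinuousLinearMap.ext fun z => hfG i z (s.monoG hni z.2)
          have k1 := s.abs_rpow_le hK n (f i) (mul_nonneg (by linarith [hhalf i]) (hα0 i)) (hfn2 i)
            hg2 three_pos he3 (fun z _ t => (le_abs_self _).trans (((f i).le_opNorm _).trans
              (mul_le_mul_of_nonneg_right (hfn i) (norm_nonneg _))))
          rw [hr] at k1
          have k2 : (1 / 2 : ℝ) ^ i ≤ (1 / 2) ^ n :=
            pow_le_pow_of_le_one (by norm_num) (by norm_num) hni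
          have k3 := hαm hil
          have k4 : (1 / 2) ^ i * α i ≤ (1 / 2 : ℝ) ^ i := mul_le_of_le_one_right (hhalf i).le (hα1 i)
          have k5 := hαm (show n ≤ l + 1 by omega)
          have k6 : K * ((1 + (1 / 2) ^ i) * α i - α n + 2 * (1 / 2) ^ n) ≤ K * (3 * D) := by
            refine mul_le_mul_of_nonneg_left ?_ hK
            rw [hD]
            linarith
          refine k1.trans ((mul_le_mul_of_nonneg_left k6 (by positivity)).trans (le_of_eq ?_))
          ring
        rw [hdiff]
        refine (abs_sub_rpow_le hq (key l (by omega) (by omega))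
          (key (n + 1) (by omega) (by omega))).trans ?_
        have : 0 ≤ (4 : ℝ) ^ q * D := by positivity
        rw [hB, add_mul, ← mul_assoc]
        linarith
      · rintro _ ⟨y, hy, rfl⟩ n l _
        have hb : |∑ i ∈ levelBox d n l, c i.1 i.2 * w i y| ≤ 4 := by
          rcases le_or_gt n l with hnl | hnl
          · rw [hsum _ _ hnl]
            refine (abs_sub _ _).trans ?_
            have k1 := (h l).unit_le_opNorm y hy
            have k2 := (h n).unit_le_opNorm y hy
            rw [Real.norm_eq_abs] at k1 k2
            linarith [hn2 l, hn2 n]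
          · rw [sum_levelBox, Finset.Ico_eq_empty (by omega)]
            simp
        refine (Real.rpow_le_rpow (abs_nonneg _) hb hq.le).trans ?_
        rw [hB]
        have : 0 ≤ (2 : ℝ) ^ q * (3 ^ q * (3 * K)) := by positivity
        linarith
    obtain ⟨m, hm⟩ := hmem x
    have hfin := le_varNorm hq hS (by positivity) hvar (J x)
    rw [linearCombination_eq_sum_levelBox (fun i hi => hc2 _ _ hi) (J x) (m := m + 1)
      fun i hi => (mem_levelBox.1 (hw0 m x hm i hi)).1.2] at hfin
    simp only [hJ, smul_eq_mul, mul_comm (w _ _)] at hfin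
    rw [hsum 0 (m + 1) (Nat.zero_le _), h0, h1, zero_apply, sub_zero,
      hfG m x hm, hf2] at hfin
    exact (le_abs_self _).trans hfin

end Representation

section Codes

/-- Norms on a finite-dimensional space form a separable family: countably many codes suffice to
determine a norm up to the factor `2`. -/
theorem exists_seminorm_code (V : Type*) [NormedAddCommGroup V] [NormedSpace ℝ V]
    [FiniteDimensional ℝ V] :
    ∃ code : Seminorm ℝ V → ℕ, ∀ N N' : Seminorm ℝ V, (∀ v, N v = 0 → v = 0) →
      (∀ v, N' v = 0 → v = 0) → code N = code N' → ∀ v, N v ≤ 2 * N' v := by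
  have hcont : ∀ N : Seminorm ℝ V, Continuous N := fun N =>
    continuousOn_univ.1 (N.convexOn.continuousOn isOpen_univ)
  have : CompactSpace (sphere (0 : V) 1) := isCompact_iff_compactSpace.1 (isCompact_sphere 0 1)
  let R : Seminorm ℝ V → C(sphere (0 : V) 1, ℝ) := fun N =>
    ⟨fun v => N v, (hcont N).comp continuous_subtype_val⟩
  have key : ∀ N : Seminorm ℝ V, ∃ c : ℕ, (∀ v, N v = 0 → v = 0) →
      (∀ v : sphere (0 : V) 1, 1 / ((c.unpair.1 : ℝ) + 1) ≤ N v) ∧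
        dist (R N) (TopologicalSpace.denseSeq _ c.unpair.2) < 1 / ((c.unpair.1 : ℝ) + 1) / 2 := by
    intro N
    by_cases hN : ∀ v, N v = 0 → v = 0
    swap
    · exact ⟨0, fun h => absurd h hN⟩
    obtain ⟨δ, hδ, h⟩ := (isCompact_sphere (0 : V) 1).exists_forall_le' (hcont N).continuousOn
      (a := 0) (fun v hv => lt_of_le_of_ne (apply_nonneg N v) fun h0 => by
        have := hN v h0.symm
        subst this
        simp at hv)
    obtain ⟨m, hm⟩ := exists_nat_one_div_lt hδ
    obtain ⟨k, hk⟩ := (TopologicalSpace.denseRange_denseSeq C(sphere (0 : V) 1, ℝ)).exists_dist_lt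
      (R N) (show (0 : ℝ) < 1 / ((m : ℝ) + 1) / 2 by positivity)
    refine ⟨Nat.pair m k, fun _ => ⟨fun v => ?_, ?_⟩⟩
    · rw [Nat.unpair_pair]
      exact hm.le.trans (h v v.2)
    · rwa [Nat.unpair_pair]
  choose code hcode using key
  refine ⟨code, fun N N' hN hN' h v => ?_⟩
  obtain ⟨-, h2⟩ := hcode N hN
  obtain ⟨h1', h2'⟩ := hcode N' hN'
  rw [h] at h2
  rcases eq_or_ne v 0 with rfl | hv
  · simp
  have hv0 : 0 < ‖v‖ := norm_pos_iff.2 hv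
  let w : sphere (0 : V) 1 := ⟨‖v‖⁻¹ • v, by simp [norm_smul, inv_mul_cancel₀ hv0.ne']⟩
  have hw : N w ≤ 2 * N' w := by
    have h3 := (ContinuousMap.dist_apply_le_dist (f := R N) (g := R N') w).trans
      (dist_triangle_right _ _ (TopologicalSpace.denseSeq _ (code N').unpair.2))
    have h4 := h1' w
    have h5 : N w - N' w ≤ dist (R N w) (R N' w) := (le_abs_self _).trans (Real.dist_eq _ _).ge
    linarith
  have hs : ∀ L : Seminorm ℝ V, L (w : V) = ‖v‖⁻¹ * L v := fun L => by
    rw [show (w : V) = ‖v‖⁻¹ • v from rfl, map_smul_eq_mul, Real.norm_eq_abs,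
      abs_of_pos (inv_pos.2 hv0)]
  rw [hs, hs, mul_left_comm] at hw
  exact le_of_mul_le_mul_left hw (inv_pos.2 hv0)

theorem exists_seminorm_code_finset {ι : Type*} (s : Finset ι) :
    ∃ code : Seminorm ℝ (ι →₀ ℝ) → ℕ, ∀ N N' : Seminorm ℝ (ι →₀ ℝ),
      (∀ a : ι →₀ ℝ, a.support ⊆ s → N a = 0 → a = 0) →
      (∀ a : ι →₀ ℝ, a.support ⊆ s → N' a = 0 → a = 0) → code N = code N' →
      ∀ a : ι →₀ ℝ, a.support ⊆ s → N a ≤ 2 * N' a := by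
  classical
  obtain ⟨code, h⟩ := exists_seminorm_code (s → ℝ)
  let L : (s → ℝ) →ₗ[ℝ] (ι →₀ ℝ) :=
    Finsupp.lmapDomain ℝ ℝ (Subtype.val : s → ι) ∘ₗ (Finsupp.linearEquivFunOnFinite ℝ ℝ s).symm
  have hL : Function.Injective L := (Finsupp.mapDomain_injective Subtype.val_injective).comp
    (LinearEquiv.injective _)
  have hLs : ∀ v, (L v).support ⊆ s := fun v i hi => by
    have := Finsupp.mapDomain_support hi
    obtain ⟨j, -, rfl⟩ := Finset.mem_image.1 this
    exact j.2
  refine ⟨fun N => code (N.comp L), fun N N' hN hN' hc a ha => ?_⟩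
  have := h (N.comp L) (N'.comp L)
    (fun v hv => hL ((hN _ (hLs v) hv).trans (map_zero L).symm))
    (fun v hv => hL ((hN' _ (hLs v) hv).trans (map_zero L).symm)) hc (fun i => a i)
  have hLa : L (fun i => a i) = a := by
    ext i
    by_cases hi : i ∈ s
    · exact Finsupp.mapDomain_apply Subtype.val_injective _ (⟨i, hi⟩ : s)
    · rw [Finsupp.notMem_support_iff.1 fun h => hi (hLs _ h),
        Finsupp.notMem_support_iff.1 fun h => hi (ha h)]
  simpa [hLa] using this

/-- A tree of nodes, indexed by natural numbers, in which every block norm is a branch; block norms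
sharing a node are `2`-equivalent up to the level of that node. -/
theorem exists_branching (p : ℝ) {B : Type*} (d : B → ℕ → ℕ)
    (N : B → Seminorm ℝ (ℕ × ℕ →₀ ℝ)) (hN : ∀ b, IsBlockNorm p (d b) (N b)) :
    ∃ node : B → ℕ → ℕ, ∀ b b' k l, node b k = node b' l →
      k = l ∧ (∀ j ≤ k, node b j = node b' j) ∧ d b k = d b' k ∧
        ∀ a : ℕ × ℕ →₀ ℝ, (∀ i, a i ≠ 0 → i.1 ≤ k) → N b a ≤ 2 * N b' a := by
  choose code hcode using exists_seminorm_code_finset (ι := ℕ × ℕ)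
  let c : B → ℕ → ℕ := fun b k =>
    Encodable.encode (levelBox (d b) 0 (k + 1), code (levelBox (d b) 0 (k + 1)) (N b))
  have hlist : ∀ b b' k l, (List.range (k + 1)).map (c b) = (List.range (l + 1)).map (c b') →
      k = l ∧ ∀ j ≤ k, c b j = c b' j := by
    intro b b' k l h
    have hkl : k = l := by simpa using congrArg List.length h
    subst hkl
    refine ⟨rfl, fun j hj => ?_⟩
    exact (List.map_inj_left.1 h) j (List.mem_range.2 (by omega))
  refine ⟨fun b k => Encodable.encode ((List.range (k + 1)).map (c b)), fun b b' k l h => ?_⟩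
  obtain ⟨rfl, h1⟩ := hlist _ _ _ _ (Encodable.encode_injective h)
  have h2 := Encodable.encode_injective (h1 k le_rfl)
  rw [Prod.mk.injEq] at h2
  obtain ⟨h2, h3⟩ := h2
  have hd : ∀ i ≤ k, ∀ j, j < d b i ↔ j < d b' i := by
    intro i hi j
    have := Finset.ext_iff.1 h2 (i, j)
    simpa [mem_levelBox, Nat.lt_succ_of_le hi] using this
  refine ⟨rfl, fun j hj => ?_, ?_, fun a ha => ?_⟩
  · refine congrArg Encodable.encode (List.map_inj_left.2 fun i hi => h1 i ?_)
    have := List.mem_range.1 hi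
    omega
  · exact eq_of_forall_lt_iff (hd k le_rfl)
  · have hsplit : ∀ b'', (∀ i ≤ k, ∀ j, j < d b i ↔ j < d b'' i) →
        N b'' a = N b'' (a.filter fun i => i.2 < d b i.1) := by
      intro b'' hb''
      have h0 : N b'' (a.filter fun i => ¬ i.2 < d b i.1) = 0 := by
        refine ((hN b'').eq_zero_iff _).2 fun i hi => ?_
        by_cases hai : a i = 0
        · rw [Finsupp.filter_apply]
          simp [hai]
        · exact Finsupp.filter_apply_neg _ _ (not_not.2 ((hb'' _ (ha i hai) _).2 hi))
      have h4 : a = a.filter (fun i => i.2 < d b i.1) + a.filter fun i => ¬ i.2 < d b i.1 :=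
        (Finsupp.filter_add_filter_not _ _).symm
      refine le_antisymm ?_ ?_
      · conv_lhs => rw [h4]
        linarith [map_add_le_add (N b'') (a.filter fun i => i.2 < d b i.1)
          (a.filter fun i => ¬ i.2 < d b i.1)]
      · rw [show a.filter (fun i => i.2 < d b i.1) = a - a.filter fun i => ¬ i.2 < d b i.1 from
          eq_sub_of_add_eq h4.symm]
        linarith [map_sub_le_add (N b'') a (a.filter fun i => ¬ i.2 < d b i.1)]
    have hdef : ∀ b'', (∀ i ≤ k, ∀ j, j < d b i ↔ j < d b'' i) → ∀ a : ℕ × ℕ →₀ ℝ,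
        a.support ⊆ levelBox (d b) 0 (k + 1) → N b'' a = 0 → a = 0 := by
      intro b'' hb'' a ha h0
      ext i
      by_contra hi
      have := mem_levelBox.1 (ha (Finsupp.mem_support_iff.2 hi))
      exact hi (((hN b'').eq_zero_iff a).1 h0 i ((hb'' i.1 (by omega) i.2).1 this.2))
    have hb : ∀ i ≤ k, ∀ j, j < d b i ↔ j < d b i := fun _ _ _ => Iff.rfl
    rw [hsplit b hb, hsplit b' hd]
    rw [← h2] at h3
    refine hcode (levelBox (d b) 0 (k + 1)) (N b) (N b') (hdef b hb) (hdef b' hd) h3 _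
      fun i hi => ?_
    have := Finsupp.mem_support_iff.1 hi
    rw [Finsupp.filter_apply] at this
    have h5 : i.2 < d b i.1 := by by_contra h; simp [h] at this
    rw [if_pos h5] at this
    exact mem_levelBox.2 ⟨⟨Nat.zero_le _, Nat.lt_succ_of_le (ha i this)⟩, h5⟩

end Codes

section Tree

/-- A tree of nodes in which the block norms `N b` are the branches, and block norms sharing a node
are `2`-equivalent up to the level of that node. -/
structure IsBlockTree (p : ℝ) {B : Type*} (d : B → ℕ → ℕ) (N : B → Seminorm ℝ (ℕ × ℕ →₀ ℝ))
    (node : B → ℕ → ℕ) : Prop where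
  block : ∀ b, IsBlockNorm p (d b) (N b)
  compat : ∀ b b' k l, node b k = node b' l →
    k = l ∧ (∀ j ≤ k, node b j = node b' j) ∧ d b k = d b' k ∧
      ∀ a : ℕ × ℕ →₀ ℝ, (∀ i, a i ≠ 0 → i.1 ≤ k) → N b a ≤ 2 * N b' a

namespace IsBlockTree

variable {p : ℝ} {B : Type*} {d : B → ℕ → ℕ} {N : B → Seminorm ℝ (ℕ × ℕ →₀ ℝ)}
  {node : B → ℕ → ℕ}

theorem branch_injective (h : IsBlockTree p d N node) (b : B) :
    Function.Injective (fun i : ℕ × ℕ => (node b i.1, i.2)) := fun i j hij => by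
  rw [Prod.mk.injEq] at hij
  exact Prod.ext (h.compat b b _ _ hij.1).1 hij.2

/-- Restriction of a finitely supported function on the tree to the branch `b`. -/
noncomputable def ev (h : IsBlockTree p d N node) (b : B) : (ℕ × ℕ →₀ ℝ) →ₗ[ℝ] (ℕ × ℕ →₀ ℝ) :=
  Finsupp.lcomapDomain _ (h.branch_injective b)

/-- Extension by zero from the branch `b` to the tree. -/
noncomputable def extend (_ : IsBlockTree p d N node) (b : B) :
    (ℕ × ℕ →₀ ℝ) →ₗ[ℝ] (ℕ × ℕ →₀ ℝ) :=
  Finsupp.lmapDomain ℝ ℝ fun i : ℕ × ℕ => (node b i.1, i.2)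

theorem ev_apply (h : IsBlockTree p d N node) (b : B) (u : ℕ × ℕ →₀ ℝ) (i : ℕ × ℕ) :
    h.ev b u i = u (node b i.1, i.2) := rfl

theorem extend_single (h : IsBlockTree p d N node) (b : B) (k j : ℕ) (r : ℝ) :
    h.extend b (Finsupp.single (k, j) r) = Finsupp.single (node b k, j) r :=
  Finsupp.mapDomain_single (f := fun i : ℕ × ℕ => (node b i.1, i.2)) (a := (k, j)) (b := r)

theorem ev_extend (h : IsBlockTree p d N node) (b : B) (a : ℕ × ℕ →₀ ℝ) :
    h.ev b (h.extend b a) = a := by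
  ext i
  exact Finsupp.mapDomain_apply (h.branch_injective b) a i

theorem ev_extend_apply (h : IsBlockTree p d N node) (b b' : B) (a : ℕ × ℕ →₀ ℝ) (i : ℕ × ℕ) :
    h.ev b' (h.extend b a) i = if node b' i.1 = node b i.1 then a i else 0 := by
  split_ifs with hi
  · rw [ev_apply, hi]
    exact Finsupp.mapDomain_apply (h.branch_injective b) a i
  · refine Finsupp.mapDomain_of_notMem_range _ _ ?_
    rintro ⟨j, hj⟩
    rw [Prod.mk.injEq] at hj
    have := (h.compat b b' _ _ hj.1).1
    exact hi (by rw [← hj.1, this])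

theorem bddAbove_ev (h : IsBlockTree p d N node) (u : ℕ × ℕ →₀ ℝ) :
    BddAbove (range fun b => N b (h.ev b u)) := by
  induction u using Finsupp.induction_linear with
  | zero => exact ⟨0, by rintro _ ⟨b, rfl⟩; simp⟩
  | add f g hf hg =>
    obtain ⟨c, hc⟩ := hf
    obtain ⟨c', hc'⟩ := hg
    refine ⟨c + c', ?_⟩
    rintro _ ⟨b, rfl⟩
    simp only [map_add]
    exact (map_add_le_add (N b) _ _).trans (add_le_add (hc ⟨b, rfl⟩) (hc' ⟨b, rfl⟩))
  | single i r =>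
    obtain ⟨t, j⟩ := i
    by_cases ht : ∃ b k, node b k = t
    · obtain ⟨b, k, rfl⟩ := ht
      refine ⟨2 * N b (Finsupp.single (k, j) r), ?_⟩
      rintro _ ⟨b', rfl⟩
      simp only [← h.extend_single b]
      by_cases hb : node b' k = node b k
      · have : h.ev b' (h.extend b (Finsupp.single (k, j) r)) = Finsupp.single (k, j) r := by
          ext i
          rw [ev_extend_apply]
          rcases eq_or_ne (k, j) i with rfl | hi
          · rw [if_pos hb]
          · simp [hi]
        rw [this]
        refine (h.compat b' b k k hb).2.2.2 _ fun i hi => ?_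
        have : (k, j) = i := by
          by_contra hne
          exact hi (by simp [hne])
        rw [← this]
      · have : h.ev b' (h.extend b (Finsupp.single (k, j) r)) = 0 := by
          ext i
          rw [ev_extend_apply]
          rcases eq_or_ne (k, j) i with rfl | hi
          · rw [if_neg hb]; rfl
          · simp [hi]
        rw [this, map_zero]
        positivity
    · refine ⟨0, ?_⟩
      rintro _ ⟨b, rfl⟩
      have : h.ev b (Finsupp.single (t, j) r) = 0 := by
        ext i
        rw [ev_apply]
        exact Finsupp.single_eq_of_ne fun hi => ht ⟨b, i.1, (Prod.mk.injEq _ _ _ _ ▸ hi).1⟩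
      simp [this]

/-- The supremum of the branch norms. -/
noncomputable def treeNorm (h : IsBlockTree p d N node) : Seminorm ℝ (ℕ × ℕ →₀ ℝ) :=
  ⨆ b, (N b).comp (h.ev b)

theorem treeNorm_apply (h : IsBlockTree p d N node) (u : ℕ × ℕ →₀ ℝ) :
    h.treeNorm u = ⨆ b, N b (h.ev b u) := by
  have hb : BddAbove (range fun b => (N b).comp (h.ev b)) :=
    Seminorm.bddAbove_range_iff.2 fun u => h.bddAbove_ev u
  rw [treeNorm, Seminorm.coe_iSup_eq hb, iSup_apply]
  rfl

theorem le_treeNorm (h : IsBlockTree p d N node) (b : B) (u : ℕ × ℕ →₀ ℝ) :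
    N b (h.ev b u) ≤ h.treeNorm u := by
  rw [treeNorm_apply]
  exact le_ciSup (h.bddAbove_ev u) b

theorem treeNorm_le (h : IsBlockTree p d N node) {u : ℕ × ℕ →₀ ℝ} {r : ℝ} (hr : 0 ≤ r)
    (hu : ∀ b, N b (h.ev b u) ≤ r) : h.treeNorm u ≤ r := by
  rw [treeNorm_apply]
  exact Real.iSup_le hu hr

theorem treeNorm_extend_le (h : IsBlockTree p d N node) (b : B) (a : ℕ × ℕ →₀ ℝ) :
    h.treeNorm (h.extend b a) ≤ 2 * N b a := by
  refine h.treeNorm_le (by positivity) fun b' => ?_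
  have key : ∀ n, (∀ k < n, node b' k = node b k) →
      (∀ i, a i ≠ 0 → node b' i.1 = node b i.1 → i.1 < n) →
        N b' (h.ev b' (h.extend b a)) ≤ 2 * N b a := by
    intro n hn hn'
    have heq : h.ev b' (h.extend b a) = a.filter fun i => i.1 < n := by
      ext i
      rw [ev_extend_apply, Finsupp.filter_apply]
      by_cases hai : a i = 0
      · simp [hai]
      · exact if_congr ⟨hn' i hai, hn i.1⟩ rfl rfl
    rw [heq]
    rcases n with _ | n
    · rw [show (a.filter fun i => i.1 < 0) = 0 by ext; simp, map_zero]
      positivity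
    · refine ((h.compat b' b n n (hn n n.lt_succ_self)).2.2.2 _ fun i hi => ?_).trans
        (mul_le_mul_of_nonneg_left ((h.block b).mono _ a) zero_le_two)
      by_contra hlt
      exact hi (by rw [Finsupp.filter_apply, if_neg (by omega)])
  by_cases hall : ∀ k, node b' k = node b k
  · obtain ⟨m, hm⟩ := exists_level_bound a
    exact key m (fun k _ => hall k) fun i hi _ => hm i hi
  · classical
    push Not at hall
    refine key (Nat.find hall) (fun k hk => not_not.1 (Nat.find_min hall hk)) fun i _ hi => ?_
    by_contra hlt
    exact Nat.find_spec hall ((h.compat b' b _ _ hi).2.1 _ (not_lt.1 hlt))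

/-- Every finite set of nodes is contained in a finite set closed under taking predecessors. -/
theorem exists_finset_closed (h : IsBlockTree p d N node) (s : Finset ℕ) :
    ∃ T : Finset ℕ, s ⊆ T ∧ ∀ b k, node b k ∈ T → ∀ j ≤ k, node b j ∈ T := by
  classical
  have hpred : ∀ t, ∃ P : Finset ℕ, t ∈ P ∧ ∀ b k, node b k ∈ P → ∀ j ≤ k, node b j ∈ P := by
    intro t
    by_cases ht : ∃ b k, node b k = t
    · obtain ⟨b, k, rfl⟩ := ht
      refine ⟨(Finset.range (k + 1)).image (node b),
        Finset.mem_image_of_mem _ (Finset.self_mem_range_succ k), fun b' l hl j hj => ?_⟩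
      obtain ⟨i, hi, hil⟩ := Finset.mem_image.1 hl
      obtain ⟨rfl, h2, -⟩ := h.compat b b' _ _ hil
      rw [← h2 j hj]
      refine Finset.mem_image_of_mem _ (Finset.mem_range.2 ?_)
      have := Finset.mem_range.1 hi
      omega
    · exact ⟨{t}, Finset.mem_singleton_self t, fun b k hk =>
        absurd ⟨b, k, Finset.mem_singleton.1 hk⟩ ht⟩
  choose P hP1 hP2 using hpred
  refine ⟨s.biUnion P, fun t ht => Finset.mem_biUnion.2 ⟨t, ht, hP1 t⟩, fun b k hk j hj => ?_⟩
  obtain ⟨t, ht, htk⟩ := Finset.mem_biUnion.1 hk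
  exact Finset.mem_biUnion.2 ⟨t, ht, hP2 t b k htk j hj⟩

theorem treeNorm_add_rpow_le (h : IsBlockTree p d N node) (hp : 0 < p) {T : Finset ℕ}
    (hT : ∀ b k, node b k ∈ T → ∀ j ≤ k, node b j ∈ T) {u x : ℕ × ℕ →₀ ℝ}
    (hu : ∀ i, u i ≠ 0 → i.1 ∈ T) (hx : ∀ i, i.1 ∈ T → x i = 0) :
    h.treeNorm (u + x) ^ p ≤ h.treeNorm u ^ p + h.treeNorm x ^ p := by
  have h0 : 0 ≤ h.treeNorm u ^ p + h.treeNorm x ^ p :=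
    add_nonneg (Real.rpow_nonneg (apply_nonneg _ _) _) (Real.rpow_nonneg (apply_nonneg _ _) _)
  rw [← Real.le_rpow_inv_iff_of_pos (apply_nonneg _ _) h0 hp]
  refine h.treeNorm_le (Real.rpow_nonneg h0 _) fun b => ?_
  rw [Real.le_rpow_inv_iff_of_pos (apply_nonneg _ _) h0 hp]
  have hinj : Function.Injective (node b) := fun k l hkl => (h.compat b b k l hkl).1
  have hex : ∃ k, node b k ∉ T := by
    by_contra! hall
    exact Set.infinite_range_of_injective hinj
      (T.finite_toSet.subset (range_subset_iff.2 fun k => hall k))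
  classical
  have hlt : ∀ k, node b k ∈ T ↔ k < Nat.find hex := fun k =>
    ⟨fun hk => by
      by_contra hle
      exact Nat.find_spec hex (hT b k hk _ (not_lt.1 hle)),
    fun hk => not_not.1 (Nat.find_min hex hk)⟩
  have h1 : (h.ev b (u + x)).filter (fun i => i.1 < Nat.find hex) = h.ev b u := by
    ext i
    rw [Finsupp.filter_apply, map_add, Finsupp.add_apply, ev_apply, ev_apply]
    split_ifs with hi
    · rw [hx _ ((hlt _).2 hi), add_zero]
    · by_contra hne
      exact hi ((hlt _).1 (hu (node b i.1, i.2) (Ne.symm hne)))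
  have h2 : (h.ev b (u + x)).filter (fun i => Nat.find hex ≤ i.1) = h.ev b x := by
    ext i
    rw [Finsupp.filter_apply, map_add, Finsupp.add_apply, ev_apply, ev_apply]
    split_ifs with hi
    · have : u (node b i.1, i.2) = 0 := by
        by_contra hne
        exact absurd ((hlt _).1 (hu (node b i.1, i.2) hne)) (not_lt.2 hi)
      rw [this, zero_add]
    · exact (hx (node b i.1, i.2) ((hlt _).2 (not_le.1 hi))).symm
  have := (h.block b).cut (Nat.find hex) (h.ev b (u + x))
  rw [h1, h2] at this
  exact this.trans (add_le_add
    (Real.rpow_le_rpow (apply_nonneg _ _) (h.le_treeNorm b u) hp.le)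
    (Real.rpow_le_rpow (apply_nonneg _ _) (h.le_treeNorm b x) hp.le))

/-- Only finitely many coordinates at a given node are not null for the tree norm. -/
theorem exists_treeNorm_single_eq_zero (h : IsBlockTree p d N node) (t : ℕ) :
    ∃ D, ∀ j, D ≤ j → ∀ r, h.treeNorm (Finsupp.single (t, j) r) = 0 := by
  by_cases ht : ∃ b k, node b k = t
  · obtain ⟨b, k, rfl⟩ := ht
    refine ⟨d b k, fun j hj r => le_antisymm ?_ (apply_nonneg _ _)⟩
    rw [← h.extend_single b]
    have h0 : N b (Finsupp.single (k, j) r) = 0 := by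
      refine ((h.block b).eq_zero_iff _).2 fun i hi => Finsupp.single_eq_of_ne ?_
      rintro rfl
      exact absurd hi (not_lt.2 hj)
    simpa [h0] using h.treeNorm_extend_le b (Finsupp.single (k, j) r)
  · refine ⟨0, fun j _ r => le_antisymm (h.treeNorm_le le_rfl fun b => ?_) (apply_nonneg _ _)⟩
    have : h.ev b (Finsupp.single (t, j) r) = 0 := by
      ext i
      rw [ev_apply]
      exact Finsupp.single_eq_of_ne fun hi => ht ⟨b, i.1, (Prod.mk.injEq _ _ _ _ ▸ hi).1⟩
    simp [this]

end IsBlockTree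
end Tree

section Universal

theorem exists_completion {V : Type u} [AddCommGroup V] [Module ℝ V] (M : Seminorm ℝ V) :
    ∃ (U : Type u) (_ : NormedAddCommGroup U) (_ : NormedSpace ℝ U) (_ : CompleteSpace U)
      (ι : V →ₗ[ℝ] U), DenseRange ι ∧ ∀ v, ‖ι v‖ = M v := by
  let i1 : SeminormedAddCommGroup V := M.toAddGroupSeminorm.toSeminormedAddCommGroup
  let i2 : NormedSpace ℝ V := { norm_smul_le := fun c x => (map_smul_eq_mul M c x).le }
  exact ⟨UniformSpace.Completion V, inferInstance, inferInstance, inferInstance,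
    (UniformSpace.Completion.toComplₗᵢ (𝕜 := ℝ) (E := V)).toLinearMap,
    UniformSpace.Completion.denseRange_coe, fun v => UniformSpace.Completion.norm_coe v⟩

/-- Adding vectors of a finite-codimensional subspace to `y` obeys an upper `p`-estimate. -/
def SplitsAt (p : ℝ) {U : Type*} [NormedAddCommGroup U] [NormedSpace ℝ U] (y : U) : Prop :=
  ∃ E : Submodule ℝ U, IsClosed (E : Set U) ∧ E.CoFG ∧
    ∀ x ∈ E, ‖y + x‖ ^ p ≤ ‖y‖ ^ p + ‖x‖ ^ p

theorem separableSpace_of_denseRange_finsupp {ι U : Type*} [Countable ι] [NormedAddCommGroup U]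
    [NormedSpace ℝ U] (f : (ι →₀ ℝ) →ₗ[ℝ] U) (hf : DenseRange f) :
    TopologicalSpace.SeparableSpace U := by
  have h1 : TopologicalSpace.IsSeparable (range f) := by
    refine ((countable_range fun i => f (Finsupp.single i 1)).isSeparable.span (R := ℝ)).mono ?_
    rintro _ ⟨u, rfl⟩
    rw [SetLike.mem_coe, ← Finsupp.sum_single u, map_finsuppSum]
    refine Submodule.sum_mem _ fun i _ => ?_
    change f (Finsupp.single i (u i)) ∈ _
    rw [← mul_one (u i), ← smul_eq_mul, ← Finsupp.smul_single, map_smul]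
    exact Submodule.smul_mem _ _ (Submodule.subset_span ⟨i, rfl⟩)
  have := h1.closure
  rw [hf.closure_range] at this
  exact TopologicalSpace.isSeparable_univ_iff.1 this

/-- A closed subspace over which the image of a dense subspace is finite-dimensional has finite
codimension. -/
theorem cofg_of_denseRange {V U : Type*} [AddCommGroup V] [Module ℝ V] [NormedAddCommGroup U]
    [NormedSpace ℝ U] (f : V →ₗ[ℝ] U) (hf : DenseRange f) (E : Submodule ℝ U)
    (hE : IsClosed (E : Set U)) (F : Submodule ℝ V) [FiniteDimensional ℝ F]
    (h : ∀ v, ∃ w ∈ F, f v - f w ∈ E) : E.CoFG := by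
  have : IsClosed (E : Set U) := hE
  let R : Submodule ℝ (U ⧸ E) := F.map (E.mkQ ∘ₗ f)
  have hR : IsClosed (R : Set (U ⧸ E)) := R.closed_of_finiteDimensional
  have hd : DenseRange (E.mkQ ∘ f) :=
    (Submodule.mkQ_surjective E).denseRange.comp hf E.mkQL.continuous
  have htop : R = ⊤ := by
    refine SetLike.coe_injective (hR.closure_eq.symm.trans ?_)
    refine (Dense.mono ?_ hd).closure_eq
    rintro _ ⟨v, rfl⟩
    obtain ⟨w, hw, hvw⟩ := h v
    exact ⟨w, hw, ((Submodule.Quotient.eq E).2 hvw).symm⟩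
  have : FiniteDimensional ℝ (⊤ : Submodule ℝ (U ⧸ E)) := htop ▸ inferInstanceAs
    (FiniteDimensional ℝ (F.map (E.mkQ ∘ₗ f)))
  exact Module.finite_def.2 (Module.Finite.iff_fg.1 this)

theorem exists_universal {p : ℝ} (hp : 1 < p) :
    ∃ (U : Type) (_ : NormedAddCommGroup U) (_ : NormedSpace ℝ U) (_ : CompleteSpace U),
      TopologicalSpace.SeparableSpace U ∧ Dense {y : U | SplitsAt p y} ∧
      ∀ d N, IsBlockNorm p d N → ∃ e : (ℕ × ℕ →₀ ℝ) →ₗ[ℝ] U,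
        (∀ a, ‖e a‖ ≤ 2 * N a) ∧ (∀ a, N a ≤ ‖e a‖) ∧
        ∀ (Y : Type u) (_ : NormedAddCommGroup Y) (_ : NormedSpace ℝ Y) (_ : CompleteSpace Y)
          (T : (ℕ × ℕ →₀ ℝ) →ₗ[ℝ] Y) (C : ℝ), (∀ a, ‖T a‖ ≤ C * N a) →
            ∃ Q : U →L[ℝ] Y, ∀ a, Q (e a) = T a := by
  let B : Type := {b : (ℕ → ℕ) × Seminorm ℝ (ℕ × ℕ →₀ ℝ) // IsBlockNorm p b.1 b.2}
  obtain ⟨node, hnode⟩ := exists_branching p (B := B) (fun b => b.1.1) (fun b => b.1.2)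
    fun b => b.2
  have h : IsBlockTree p (B := B) (fun b => b.1.1) (fun b => b.1.2) node :=
    ⟨fun b => b.2, hnode⟩
  obtain ⟨U, i1, i2, i3, ι, hι, hιn⟩ := exists_completion h.treeNorm
  refine ⟨U, i1, i2, i3, separableSpace_of_denseRange_finsupp ι hι, hι.mono ?_,
    fun d N hN => ⟨ι ∘ₗ h.extend ⟨(d, N), hN⟩, fun a => ?_, fun a => ?_,
      fun Y _ _ _ T C hT => ?_⟩⟩
  · rintro _ ⟨u, rfl⟩
    obtain ⟨T, hT1, hT2⟩ := h.exists_finset_closed (u.support.image Prod.fst)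
    let Z : Submodule ℝ (ℕ × ℕ →₀ ℝ) := Finsupp.supported ℝ ℝ {i | i.1 ∉ T}
    refine ⟨(Z.map ι).topologicalClosure, Submodule.isClosed_topologicalClosure _, ?_, ?_⟩
    · choose D hD using h.exists_treeNorm_single_eq_zero
      let s : Finset (ℕ × ℕ) := T.biUnion fun t => (Finset.range (D t)).image fun j => (t, j)
      have hs : ∀ i, i ∈ s ↔ i.1 ∈ T ∧ i.2 < D i.1 := by
        rintro ⟨t, j⟩
        simp [s]
      have : FiniteDimensional ℝ (Finsupp.supported ℝ ℝ (s : Set (ℕ × ℕ))) :=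
        Module.Finite.equiv (Finsupp.supportedEquivFinsupp (M := ℝ) (R := ℝ)
          (s : Set (ℕ × ℕ))).symm
      refine cofg_of_denseRange ι hι _ (Submodule.isClosed_topologicalClosure _)
        (Finsupp.supported ℝ ℝ (s : Set (ℕ × ℕ))) fun v => ?_
      refine ⟨v.filter (· ∈ s), fun i hi => (Finset.mem_filter.1 hi).2, ?_⟩
      have hv : v - v.filter (· ∈ s)
          = v.filter (fun i => i.1 ∉ T) + v.filter fun i => i.1 ∈ T ∧ D i.1 ≤ i.2 := by
        ext i
        simp only [Finsupp.sub_apply, Finsupp.add_apply, Finsupp.filter_apply, hs]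
        by_cases h1 : i.1 ∈ T <;> by_cases h2 : i.2 < D i.1 <;> simp [h1, h2, not_le.2, not_lt.1]
      have h0 : ι (v.filter fun i => i.1 ∈ T ∧ D i.1 ≤ i.2) = 0 := by
        rw [← Finsupp.sum_single (v.filter _), map_finsuppSum]
        refine Finset.sum_eq_zero fun i hi => ?_
        have := (Finset.mem_filter.1 hi).2
        exact norm_eq_zero.1 ((hιn _).trans (hD i.1 i.2 this.2 _))
      rw [← map_sub, hv, map_add, h0, add_zero]
      exact Submodule.le_topologicalClosure _ (Submodule.mem_map_of_mem
        fun i hi => (Finset.mem_filter.1 hi).2)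
    · have hp0 : 0 < p := by linarith
      have hcl : IsClosed {x : U | ‖ι u + x‖ ^ p ≤ ‖ι u‖ ^ p + ‖x‖ ^ p} :=
        isClosed_le ((continuous_const.add continuous_id).norm.rpow_const fun _ => Or.inr hp0.le)
          (continuous_const.add (continuous_id.norm.rpow_const fun _ => Or.inr hp0.le))
      refine fun x hx => closure_minimal ?_ hcl hx
      rintro _ ⟨z, hz, rfl⟩
      have := h.treeNorm_add_rpow_le hp0 hT2 (u := u) (x := z)
        (fun i hi => hT1 (Finset.mem_image_of_mem _ (Finsupp.mem_support_iff.2 hi)))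
        fun i hi => by
          by_contra hne
          exact hz (Finsupp.mem_support_iff.2 hne) hi
      rwa [← hιn, ← hιn, ← hιn, map_add] at this
  · exact (hιn _).trans_le (h.treeNorm_extend_le ⟨(d, N), hN⟩ a)
  · refine le_trans (le_of_eq ?_) ((h.le_treeNorm ⟨(d, N), hN⟩ _).trans_eq (hιn _).symm)
    rw [h.ev_extend]
  · have hb : ∃ C : ℝ, ∀ u, ‖(T ∘ₗ h.ev ⟨(d, N), hN⟩) u‖ ≤ C * ‖ι u‖ := by
      refine ⟨max C 0, fun u => (hT _).trans ?_⟩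
      rw [hιn]
      exact mul_le_mul (le_max_left _ _) (h.le_treeNorm ⟨(d, N), hN⟩ u) (apply_nonneg _ _)
        (le_max_right _ _)
    refine ⟨(T ∘ₗ h.ev ⟨(d, N), hN⟩).extendOfNorm ι, fun a => ?_⟩
    refine (LinearMap.extendOfNorm_eq hι hb _).trans ?_
    exact congrArg T (h.ev_extend _ a)

end Universal

section Consequences

theorem surjective_of_dense_controlled {U Y : Type*} [NormedAddCommGroup U] [NormedSpace ℝ U]
    [CompleteSpace U] [NormedAddCommGroup Y] [NormedSpace ℝ Y] (Q : U →L[ℝ] Y)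
    (G : Submodule ℝ Y) (hG : Dense (G : Set Y)) {C : ℝ} (hC : 0 < C)
    (h : ∀ y ∈ G, ∃ u, Q u = y ∧ ‖u‖ ≤ C * ‖y‖) : Function.Surjective Q := by
  let f : NormedAddGroupHom U Y := (Q : U →+ Y).mkNormedAddGroupHom ‖Q‖ Q.le_opNorm
  have h1 : f.SurjectiveOnWith G.toAddSubgroup C := fun y hy => h y hy
  intro y
  obtain ⟨u, hu, -⟩ := controlled_closure_of_complete hC one_pos h1 y (hG y)
  exact ⟨u, hu⟩

theorem exists_extension_of_dense {U Y : Type*} [NormedAddCommGroup U] [NormedSpace ℝ U]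
    [CompleteSpace U] [NormedAddCommGroup Y] [NormedSpace ℝ Y]
    (G : Submodule ℝ Y) (hG : Dense (G : Set Y)) (J : G →ₗ[ℝ] U) {C c : ℝ}
    (hC : ∀ x, ‖J x‖ ≤ C * ‖x‖) (hc : ∀ x, c * ‖x‖ ≤ ‖J x‖) :
    ∃ Q : Y →L[ℝ] U, ∀ y, c * ‖y‖ ≤ ‖Q y‖ := by
  have hd : DenseRange G.subtype := by
    rw [DenseRange, Submodule.coe_subtype, Subtype.range_coe]
    exact hG
  refine ⟨J.extendOfNorm G.subtype, fun y => ?_⟩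
  refine hd.induction_on (p := fun y => c * ‖y‖ ≤ ‖J.extendOfNorm G.subtype y‖) y ?_ fun x => ?_
  · exact isClosed_le (continuous_const.mul continuous_norm)
      (J.extendOfNorm G.subtype).continuous.norm
  · rw [LinearMap.extendOfNorm_eq hd ⟨C, hC⟩]
    exact hc x

theorem exists_universal_space {p : ℝ} (hp : 1 < p) :
    ∃ (U : Type) (_ : NormedAddCommGroup U) (_ : NormedSpace ℝ U) (_ : CompleteSpace U),
      TopologicalSpace.SeparableSpace U ∧ Dense {y : U | SplitsAt p y} ∧
      ∀ (X : Type u) (_ : NormedAddCommGroup X) (_ : NormedSpace ℝ X) (_ : CompleteSpace X),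
        TopologicalSpace.SeparableSpace X → PAUSable p X →
          IsomToClosedSubspace X U ∧ IsQuotientOf X U := by
  obtain ⟨U, i1, i2, i3, hsep, hspl, hU⟩ := exists_universal.{u} hp
  refine ⟨U, i1, i2, i3, hsep, hspl, fun X _ _ _ _ hX => ?_⟩
  obtain ⟨Y, _, _, f, C, hC, hY⟩ := hX.exists_ausBound
  have hpq : p.HolderConjugate (p.conjExponent) := Real.HolderConjugate.conjExponent hp
  have : CompleteSpace Y := (completeSpace_congr (e := f.toEquiv) f.isUniformEmbedding).1 ‹_›
  have : TopologicalSpace.SeparableSpace Y :=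
    f.surjective.denseRange.separableSpace f.continuous
  obtain ⟨s⟩ := hY.exists_scheme hpq hC.le
  have hK : 0 ≤ (2 + 2 * C) ^ p.conjExponent := by positivity
  have hmem : ∀ y, y ∈ (⨆ n, s.G n : Submodule ℝ Y) ↔ ∃ n, y ∈ s.G n := fun y =>
    Submodule.mem_iSup_of_directed _ s.monoG.directed_le
  have hdense : Dense ((⨆ n, s.G n : Submodule ℝ Y) : Set Y) :=
    s.dense.mono (iUnion_subset fun n => le_iSup s.G n)
  constructor
  · obtain ⟨d, N, hN, J, hJ1, D, hJ2⟩ := s.exists_blockNorm_embedding hpq hK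
    obtain ⟨e, he1, he2, -⟩ := hU d N hN
    have hD : 0 < max D 1 := lt_max_of_lt_right one_pos
    obtain ⟨Q, hQ⟩ := exists_extension_of_dense _ hdense (e ∘ₗ J) (C := 2) (c := (max D 1)⁻¹)
      (fun x => (he1 _).trans (mul_le_mul_of_nonneg_left (hJ1 x) zero_le_two)) fun x => by
        rw [inv_mul_le_iff₀ hD]
        exact (hJ2 x).trans (mul_le_mul (le_max_left _ _) (he2 _) (apply_nonneg _ _) hD.le)
    obtain ⟨c, hc, hfc⟩ : ∃ c > 0, ∀ x, c * ‖x‖ ≤ ‖Q (f x)‖ := by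
      refine ⟨(max D 1)⁻¹ * (‖(f.symm : Y →L[ℝ] X)‖ + 1)⁻¹, by positivity, fun x => ?_⟩
      refine le_trans ?_ (hQ (f x))
      rw [mul_assoc]
      refine mul_le_mul_of_nonneg_left ?_ (inv_pos.2 hD).le
      rw [inv_mul_le_iff₀ (by positivity)]
      have h1 := (f.symm : Y →L[ℝ] X).le_opNorm (f x)
      rw [ContinuousLinearEquiv.coe_coe, f.symm_apply_apply] at h1
      nlinarith [norm_nonneg (f x)]
    refine ⟨Q ∘L (f : X →L[ℝ] Y), (injective_iff_map_eq_zero _).2 fun x hx => ?_, c, hc, hfc⟩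
    have h1 := hfc x
    rw [show Q (f x) = 0 from hx, norm_zero] at h1
    exact norm_le_zero_iff.1 (by nlinarith [norm_nonneg x])
  · obtain ⟨d, N, hN, T, ⟨D, hT1⟩, hT2⟩ := s.exists_blockNorm_quotient hpq hK
    obtain ⟨e, he1, -, he3⟩ := hU d N hN
    obtain ⟨Q, hQ⟩ := he3 Y _ _ inferInstance T D hT1
    have hsurj : Function.Surjective Q := by
      refine surjective_of_dense_controlled Q _ hdense four_pos fun y hy => ?_
      obtain ⟨n, hn⟩ := (hmem y).1 hy
      obtain ⟨a, ha1, ha2⟩ := hT2 n y hn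
      exact ⟨e a, (hQ a).trans ha1, by linarith [he1 a]⟩
    exact ⟨(f.symm : Y →L[ℝ] X) ∘L Q, f.symm.surjective.comp hsurj⟩

end Consequences

theorem summable_norm_rpow_pair_iff {W : Type*} [SeminormedAddCommGroup W] {q : ℝ} (F : ℕ → W) :
    (Summable fun k => ‖F k‖ ^ q) ↔ (∀ n, Summable fun m => ‖F (Nat.pair n m)‖ ^ q) ∧
      Summable fun n => ∑' m, ‖F (Nat.pair n m)‖ ^ q := by
  rw [← Nat.pairEquiv.summable_iff]
  exact summable_prod_of_nonneg fun i => Real.rpow_nonneg (norm_nonneg _) _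

theorem tsum_eq_tsum_tsum_pair {a : ℕ → ℝ} (ha : Summable a) :
    ∑' k, a k = ∑' n, ∑' m, a (Nat.pair n m) := by
  rw [← Nat.pairEquiv.tsum_eq a]
  exact ((Nat.pairEquiv.summable_iff (f := a)).2 ha).tsum_prod

section LpSums

open scoped ENNReal

variable {W : Type*} [NormedAddCommGroup W] [NormedSpace ℝ W]

theorem dense_lp_of_single {P : ℝ≥0∞} [Fact (1 ≤ P)] (hP : P ≠ ⊤) {D : Set W}
    (hD : Dense D) {S : Set (lp (fun _ : ℕ => W) P)}
    (hS : ∀ (s : Finset ℕ) (w : ℕ → W), (∀ i, w i ∈ D) → ∑ i ∈ s, lp.single P i (w i) ∈ S) :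
    Dense S := by
  intro y
  refine isClosed_closure.mem_of_tendsto (lp.hasSum_single hP y) (Eventually.of_forall fun s => ?_)
  have hc : Continuous fun w : ℕ → W => ∑ i ∈ s, lp.single (E := fun _ : ℕ => W) P i (w i) :=
    continuous_finsetSum _ fun i _ =>
      (lp.singleContinuousLinearMap ℝ (fun _ : ℕ => W) P i).continuous.comp (continuous_apply i)
  exact map_mem_closure (f := fun w : ℕ → W => ∑ i ∈ s, lp.single (E := fun _ : ℕ => W) P i (w i))
    hc (dense_pi (s := fun _ : ℕ => D) univ (fun _ _ => hD) fun i => y i)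
    fun w hw => hS s w fun i => hw i (mem_univ i)

theorem separableSpace_lp [TopologicalSpace.SeparableSpace W] {P : ℝ≥0∞} [Fact (1 ≤ P)]
    (hP : P ≠ ⊤) : TopologicalSpace.SeparableSpace (lp (fun _ : ℕ => W) P) := by
  have h1 : TopologicalSpace.IsSeparable
      (⋃ i, range (lp.single (E := fun _ : ℕ => W) P i)) := .iUnion fun i =>
    TopologicalSpace.isSeparable_range
      (lp.singleContinuousLinearMap ℝ (fun _ : ℕ => W) P i).continuous
  have h2 := (h1.span (R := ℝ)).closure
  have h3 : Dense (Submodule.span ℝ (⋃ i, range (lp.single (E := fun _ : ℕ => W) P i)) :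
      Set (lp (fun _ : ℕ => W) P)) :=
    dense_lp_of_single hP dense_univ fun s w _ =>
      Submodule.sum_mem _ fun i _ => Submodule.subset_span (mem_iUnion.2 ⟨i, w i, rfl⟩)
  rw [h3.closure_eq] at h2
  exact TopologicalSpace.isSeparable_univ_iff.1 h2

theorem dense_splitsAt_lp {P : ℝ≥0∞} [Fact (1 ≤ P)] (hP : P ≠ ⊤)
    (h : Dense {y : W | SplitsAt P.toReal y}) :
    Dense {y : lp (fun _ : ℕ => W) P | SplitsAt P.toReal y} := by
  have hP0 : 0 < P.toReal := ENNReal.toReal_pos (zero_lt_one.trans_le Fact.out).ne' hP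
  refine dense_lp_of_single hP h fun s w hw => ?_
  choose E hE1 hE2 hE3 using hw
  have : ∀ i, FiniteDimensional ℝ (W ⧸ E i) := hE2
  let L : lp (fun _ : ℕ => W) P →ₗ[ℝ] ((i : s) → W ⧸ E i) :=
    LinearMap.pi fun i => (E i).mkQ ∘ₗ (lp.evalCLM ℝ (fun _ : ℕ => W) P i : _ →ₗ[ℝ] W)
  have hL : ∀ x, x ∈ LinearMap.ker L ↔ ∀ i ∈ s, x i ∈ E i := by
    intro x
    rw [LinearMap.mem_ker, funext_iff, Subtype.forall]
    exact forall₂_congr fun i _ => Submodule.Quotient.mk_eq_zero _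
  refine ⟨LinearMap.ker L, ?_, Submodule.CoFG.ker L, fun x hx => ?_⟩
  · have : (LinearMap.ker L : Set (lp (fun _ : ℕ => W) P))
        = ⋂ i ∈ s, lp.evalCLM ℝ (fun _ : ℕ => W) P i ⁻¹' (E i) := by
      ext x
      rw [SetLike.mem_coe, hL]
      simp only [mem_iInter, mem_preimage, SetLike.mem_coe]
      rfl
    rw [this]
    exact isClosed_biInter fun i _ => (hE1 i).preimage (lp.evalCLM ℝ (fun _ : ℕ => W) P i).continuous
  · rw [hL] at hx
    set y := ∑ i ∈ s, lp.single (E := fun _ : ℕ => W) P i (w i) with hy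
    have hyi : ∀ j, y j = if j ∈ s then w j else 0 := by
      intro j
      have : y j = lp.evalCLM ℝ (fun _ : ℕ => W) P j y := rfl
      rw [this, hy, map_sum]
      have : ∀ i, lp.evalCLM ℝ (fun _ : ℕ => W) P j (lp.single P i (w i))
          = if i = j then w i else 0 := by
        intro i
        change lp.single (E := fun _ : ℕ => W) P i (w i) j = _
        rcases eq_or_ne i j with rfl | hij
        · rw [lp.single_apply_self, if_pos rfl]
        · rw [lp.single_apply_ne _ _ _ hij.symm, if_neg hij]
      simp only [this, Finset.sum_ite_eq']
    refine hasSum_le (fun i => ?_) (lp.hasSum_norm hP0 (y + x))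
      ((lp.hasSum_norm hP0 y).add (lp.hasSum_norm hP0 x))
    rw [lp.coeFn_add, Pi.add_apply, hyi]
    split_ifs with hi
    · exact hE3 i _ (hx i hi)
    · rw [zero_add, norm_zero, Real.zero_rpow hP0.ne', zero_add]

theorem pausable_of_dense_splitsAt {p : ℝ} (hp : 1 < p) (h : Dense {y : W | SplitsAt p y}) :
    PAUSable p W := by
  refine ⟨fun x => ‖x‖, ⟨⟨norm_nonneg, fun x => norm_eq_zero, fun a x => norm_smul a x,
    norm_add_le⟩, 1, one_pos, 1, one_pos, fun x => by simp⟩, 1, one_pos, fun τ hτ => ?_⟩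
  have hτp := Real.rpow_nonneg hτ p
  have hp0 : 0 < p := by linarith
  rw [one_mul]
  by_cases hfin : FiniteDimensional ℝ W
  · simpa [rhoN, hfin] using hτp
  simp only [rhoN, if_neg hfin]
  refine Real.sSup_le ?_ hτp
  rintro r ⟨y, hy, rfl⟩
  have hub : ∀ x : W, ‖x‖ ≤ 1 → ‖y + τ • x‖ - 1 ≤ τ := by
    intro x hx
    have h1 := norm_add_le y (τ • x)
    rw [norm_smul, Real.norm_of_nonneg hτ] at h1
    nlinarith
  refine le_of_forall_pos_le_add fun ε hε => ?_
  obtain ⟨z, ⟨E, hE1, hE2, hE3⟩, hz⟩ := h.exists_dist_lt y (half_pos hε)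
  rw [dist_eq_norm] at hz
  set I : Set ℝ := { s : ℝ | ∃ E : Submodule ℝ W, IsClosed (E : Set W) ∧
    FiniteDimensional ℝ (W ⧸ E) ∧
    s = sSup { t : ℝ | ∃ x ∈ E, ‖x‖ ≤ 1 ∧ t = ‖y + τ • x‖ - 1 } } with hI
  have hmem : sSup { t : ℝ | ∃ x ∈ E, ‖x‖ ≤ 1 ∧ t = ‖y + τ • x‖ - 1 } ∈ I :=
    ⟨E, hE1, hE2, rfl⟩
  have hbdd : BddBelow I := by
    refine ⟨-1, ?_⟩
    rintro s ⟨F, -, -, rfl⟩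
    refine le_csSup_of_le (b := ‖y + τ • (0 : W)‖ - 1) ⟨τ, ?_⟩
      ⟨0, F.zero_mem, by simp, rfl⟩ (by linarith [norm_nonneg (y + τ • (0 : W))])
    rintro t ⟨x, -, hx, rfl⟩
    exact hub x hx
  refine (csInf_le hbdd hmem).trans (Real.sSup_le ?_ (by positivity))
  · rintro t ⟨x, hx, hx1, rfl⟩
    have h1 : ‖y + τ • x‖ ≤ ‖y - z‖ + ‖z + τ • x‖ := by
      refine le_trans (le_of_eq ?_) (norm_add_le _ _)
      congr 1
      abel
    have h2 : ‖z‖ ≤ 1 + ε / 2 := by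
      have := norm_sub_norm_le z y
      rw [norm_sub_rev] at this
      linarith
    have h3 : ‖τ • x‖ ≤ τ := by
      rw [norm_smul, Real.norm_of_nonneg hτ]
      exact mul_le_of_le_one_right hτ hx1
    have h4 : ‖z + τ • x‖ ^ p ≤ (1 + ε / 2 + τ ^ p) ^ p := by
      refine (hE3 _ (E.smul_mem τ hx)).trans ?_
      set a := 1 + ε / 2 with ha
      have ha1 : 1 ≤ a := by linarith
      have ha0 : 0 < a := by linarith
      have h5 := one_add_mul_self_le_rpow_one_add (s := τ ^ p / a)
        (by linarith [div_nonneg hτp ha0.le]) hp.le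
      have h6 : (a + τ ^ p) ^ p = a ^ p * (1 + τ ^ p / a) ^ p := by
        rw [← Real.mul_rpow ha0.le (by positivity), mul_add, mul_one, mul_div_cancel₀ _ ha0.ne']
      have h7 : a ≤ a ^ p := by
        simpa using Real.rpow_le_rpow_of_exponent_le ha1 hp.le
      have h8 : τ ^ p ≤ a ^ p * (p * (τ ^ p / a)) := by
        have : a * (τ ^ p / a) = τ ^ p := mul_div_cancel₀ _ ha0.ne'
        have h9 : 0 ≤ τ ^ p / a := by positivity
        calc τ ^ p = a * (τ ^ p / a) := this.symm
          _ ≤ a ^ p * (p * (τ ^ p / a)) := by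
            refine mul_le_mul h7 ?_ h9 (by positivity)
            nlinarith
      have h10 : a ^ p * (1 + p * (τ ^ p / a)) ≤ (a + τ ^ p) ^ p := by
        rw [h6]
        exact mul_le_mul_of_nonneg_left h5 (by positivity)
      have h11 := Real.rpow_le_rpow (norm_nonneg z) h2 hp0.le
      have h12 := Real.rpow_le_rpow (norm_nonneg (τ • x)) h3 hp0.le
      linarith
    have h5 := (Real.rpow_le_rpow_iff (norm_nonneg _) (by positivity) hp0).1 h4
    linarith

theorem exists_lp_rows {P : ℝ≥0∞} [Fact (1 ≤ P)] (hP0 : 0 < P.toReal) :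
    ∃ Φ : lp (fun _ : ℕ => W) P →ₗ[ℝ] lp (fun _ : ℕ => lp (fun _ : ℕ => W) P) P,
      ∀ f n m, Φ f n m = f (Nat.pair n m) := by
  have hf := fun f : lp (fun _ : ℕ => W) P =>
    (summable_norm_rpow_pair_iff f).1 ((lp.memℓp f).summable hP0)
  let row : lp (fun _ : ℕ => W) P → ℕ → lp (fun _ : ℕ => W) P := fun f n =>
    ⟨fun m => f (Nat.pair n m), memℓp_gen ((hf f).1 n)⟩
  have hrow : ∀ f n, ‖row f n‖ ^ P.toReal = ∑' m, ‖f (Nat.pair n m)‖ ^ P.toReal := fun f n =>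
    lp.norm_rpow_eq_tsum hP0 (row f n)
  have hmem : ∀ f, Memℓp (row f) P := fun f => memℓp_gen (by simpa only [hrow] using (hf f).2)
  exact ⟨{ toFun := fun f => ⟨row f, hmem f⟩
           map_add' := fun f g => rfl
           map_smul' := fun c f => rfl }, fun f n m => rfl⟩

/-- The `ℓ_p`-sum of countably many copies of `ℓ_p(W)` is `ℓ_p(W)`. -/
theorem exists_lp_equiv_lp_lp {P : ℝ≥0∞} [Fact (1 ≤ P)] (hP : P ≠ ⊤) :
    Nonempty (lp (fun _ : ℕ => W) P ≃L[ℝ] lp (fun _ : ℕ => lp (fun _ : ℕ => W) P) P) := by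
  have hP0 : 0 < P.toReal := ENNReal.toReal_pos (zero_lt_one.trans_le Fact.out).ne' hP
  obtain ⟨Φ, hΦ⟩ := exists_lp_rows (W := W) hP0
  have hnorm : ∀ f, ‖Φ f‖ = ‖f‖ := by
    intro f
    have h1 : ‖Φ f‖ ^ P.toReal = ∑' n, ∑' m, ‖f (Nat.pair n m)‖ ^ P.toReal := by
      rw [lp.norm_rpow_eq_tsum hP0 (Φ f)]
      refine tsum_congr fun n => ?_
      rw [lp.norm_rpow_eq_tsum hP0 (Φ f n)]
      exact tsum_congr fun m => by rw [hΦ]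
    have h2 : ‖f‖ ^ P.toReal = ∑' n, ∑' m, ‖f (Nat.pair n m)‖ ^ P.toReal := by
      rw [lp.norm_rpow_eq_tsum hP0 f]
      exact tsum_eq_tsum_tsum_pair ((lp.memℓp f).summable hP0)
    exact (Real.rpow_left_inj (norm_nonneg _) (norm_nonneg _) hP0.ne').1 (h1.trans h2.symm)
  have hsurj : Function.Surjective Φ := by
    intro g
    set F : ℕ → W := fun k => g k.unpair.1 k.unpair.2 with hFdef
    have hF : ∀ n m, F (Nat.pair n m) = g n m := fun n m => by simp [hFdef]
    have hFs : Summable fun k => ‖F k‖ ^ P.toReal := by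
      rw [summable_norm_rpow_pair_iff]
      simp only [hF]
      refine ⟨fun n => (lp.memℓp (g n)).summable hP0, ?_⟩
      simpa only [lp.norm_rpow_eq_tsum hP0] using (lp.memℓp g).summable hP0
    refine ⟨⟨F, memℓp_gen hFs⟩, ?_⟩
    refine lp.ext (funext fun n => lp.ext (funext fun m => ?_))
    rw [hΦ]
    exact hF n m
  exact ⟨(LinearIsometryEquiv.ofSurjective ⟨Φ, hnorm⟩ hsurj).toContinuousLinearEquiv⟩

end LpSums

/-- For every `p ∈ (1,∞)` there exists a separable Banach space `U` admitting an equivalent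
`p`-AUS norm, injectively and surjectively universal for separable `p`-AUS-able spaces, and
isomorphic to the `ℓ_p`-sum of countably many copies of itself. -/
theorem universal_space_for_pAUS_isomorphic_lp_sum (p : ℝ) (hp : 1 < p) :
    ∃ (U : Type) (_ : NormedAddCommGroup U) (_ : NormedSpace ℝ U) (_ : CompleteSpace U),
      TopologicalSpace.SeparableSpace U ∧ PAUSable p U ∧
      (∀ (X : Type u) (_ : NormedAddCommGroup X) (_ : NormedSpace ℝ X) (_ : CompleteSpace X),
        TopologicalSpace.SeparableSpace X → PAUSable p X →
          IsomToClosedSubspace X U ∧ IsQuotientOf X U) ∧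
      (letI : Fact (1 ≤ ENNReal.ofReal p) := ⟨ENNReal.one_le_ofReal.2 hp.le⟩;
        Nonempty (U ≃L[ℝ] lp (fun _ : ℕ => U) (ENNReal.ofReal p))) := by
  obtain ⟨W, _, _, _, hsep, hspl, hW⟩ := exists_universal_space.{u} hp
  have : Fact (1 ≤ ENNReal.ofReal p) := ⟨ENNReal.one_le_ofReal.2 hp.le⟩
  have hP : ENNReal.ofReal p ≠ ⊤ := ENNReal.ofReal_ne_top
  have hPp : (ENNReal.ofReal p).toReal = p := ENNReal.toReal_ofReal (by linarith)
  refine ⟨lp (fun _ : ℕ => W) (ENNReal.ofReal p), inferInstance, inferInstance, inferInstance,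
    separableSpace_lp hP, ?_, fun X _ _ _ hX hX' => ?_, exists_lp_equiv_lp_lp hP⟩
  · have := dense_splitsAt_lp (W := W) hP (by rwa [hPp])
    rw [hPp] at this
    exact pausable_of_dense_splitsAt hp this
  · obtain ⟨⟨T, hT, c, hc, hTc⟩, Q, hQ⟩ := hW X _ _ inferInstance hX hX'
    have hp0 : 0 < ENNReal.ofReal p := zero_lt_one.trans_le Fact.out
    constructor
    · refine ⟨lp.singleContinuousLinearMap ℝ (fun _ : ℕ => W) _ 0 ∘L T,
        (lp.isometry_single (E := fun _ : ℕ => W) 0).injective.comp hT, c, hc, fun y => ?_⟩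
      exact (hTc y).trans_eq (lp.norm_single (E := fun _ : ℕ => W) hp0 0 (T y)).symm
    · exact ⟨Q ∘L lp.evalCLM ℝ (fun _ : ℕ => W) _ 0, hQ.comp fun w =>
        ⟨lp.single _ 0 w, show lp.single (E := fun _ : ℕ => W) (ENNReal.ofReal p) 0 w 0 = w from
          lp.single_apply_self _ _ _⟩⟩
end

section
/- Let p ∈ (1,∞), let X be a Banach space admitting an equivalent p-AUS norm, and let Y be a Banach space for which there exists a surjective bounded linear map Q : X → Y. Then Y admits an equivalent p-AUS norm. (The class of p-AUS-able spaces is stable under quotients.) -/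
open Metric Set Topology Filter

universe u v

section AsymptoticLifting

variable {X Y V : Type*} [NormedAddCommGroup X] [NormedSpace ℝ X] [CompleteSpace X]
  [NormedAddCommGroup Y] [NormedSpace ℝ Y] [CompleteSpace Y]
  [NormedAddCommGroup V] [NormedSpace ℝ V]

/-- A point far from the image under `π` of the kernel of `Q` is avoided, in a neighbourhood, by
the vectors of the unit ball which `Q` maps into a suitable closed hyperplane. -/
lemma exists_finite_codim_avoiding_nhds (Q : X →L[ℝ] Y) (hQ : Function.Surjective Q)
    (π : X →L[ℝ] V) {ε : ℝ} (hε : 0 < ε) (v : V)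
    (hv : ∀ z : X, Q z = 0 → ‖z‖ ≤ 2 → ε ≤ ‖v - π z‖) :
    ∃ U : Set V, IsOpen U ∧ v ∈ U ∧ ∃ F : Submodule ℝ Y, IsClosed (F : Set Y) ∧ F.CoFG ∧
      ∀ x : X, ‖x‖ ≤ 1 → Q x ∈ F → π x ∉ U := by
  obtain ⟨C, hC, hlift⟩ := Q.exists_preimage_norm_le hQ
  have hnot : ((0 : Y), v) ∉ closure ((Q.prod π) '' closedBall 0 1) := by
    intro hmem
    set δ : ℝ := min (1 / C) (ε / (2 * (1 + ‖π‖ * C))) with hδ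
    have hden : 0 < 2 * (1 + ‖π‖ * C) := by positivity
    have hδ0 : 0 < δ := lt_min (by positivity) (by positivity)
    obtain ⟨_, ⟨x, hx, rfl⟩, hdist⟩ := Metric.mem_closure_iff.1 hmem δ hδ0
    rw [mem_closedBall_zero_iff] at hx
    rw [ContinuousLinearMap.prod_apply, Prod.dist_eq, max_lt_iff] at hdist
    obtain ⟨h1, h2⟩ := hdist
    simp only [dist_zero_left] at h1
    rw [dist_eq_norm] at h2
    obtain ⟨w, hw, hwn⟩ := hlift (Q x)
    have hwδ : ‖w‖ ≤ C * δ := hwn.trans (by gcongr)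
    have hC1 : C * δ ≤ 1 := by
      calc C * δ ≤ C * (1 / C) := by gcongr; exact min_le_left _ _
        _ = 1 := by field_simp
    have hδε : δ * (2 * (1 + ‖π‖ * C)) ≤ ε := (le_div_iff₀ hden).1 (min_le_right _ _)
    have h3 := hv (x - w) (by rw [map_sub, hw, sub_self])
      ((norm_sub_le _ _).trans (by linarith))
    have h4 : ‖v - π (x - w)‖ ≤ ‖v - π x‖ + ‖π w‖ := by
      rw [map_sub, show v - (π x - π w) = (v - π x) + π w by abel]
      exact norm_add_le _ _
    have h5 : ‖π w‖ ≤ ‖π‖ * (C * δ) := (π.le_opNorm w).trans (by gcongr)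
    nlinarith
  obtain ⟨f, s, hf, hs⟩ := geometric_hahn_banach_closed_point
    ((convex_closedBall (0 : X) 1).is_linear_image
      (Q.prod π).isBoundedLinearMap.toIsLinearMap).closure isClosed_closure hnot
  let g : Y →L[ℝ] ℝ := f.comp (ContinuousLinearMap.inl ℝ Y V)
  let h : V →L[ℝ] ℝ := f.comp (ContinuousLinearMap.inr ℝ Y V)
  refine ⟨{v' | s < h v'}, isOpen_lt continuous_const h.continuous, hs,
    LinearMap.ker (g : Y →ₗ[ℝ] ℝ), g.isClosed_ker, Submodule.CoFG.ker _, fun x hx hxF hxU ↦ ?_⟩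
  have h1 := hf _ (subset_closure ⟨x, mem_closedBall_zero_iff.2 hx, rfl⟩)
  have h2 : f (Q.prod π x) = g (Q x) + h (π x) := by
    simp only [g, h, ContinuousLinearMap.comp_apply, ← map_add]
    simp
  have h3 : g (Q x) = 0 := hxF
  have h4 : s < h (π x) := hxU
  linarith

/-- Given a finite rank operator `π` on `X` and a quotient map `Q`, the vectors whose image under
`Q` lies in a suitable subspace of finite codimension look, from the point of view of `π`, like
elements of the kernel of `Q`. -/
lemma exists_finite_codim_kernel_approx [FiniteDimensional ℝ V] (Q : X →L[ℝ] Y)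
    (hQ : Function.Surjective Q) (π : X →L[ℝ] V) {ε : ℝ} (hε : 0 < ε) :
    ∃ F : Submodule ℝ Y, IsClosed (F : Set Y) ∧ F.CoFG ∧
      ∀ x : X, Q x ∈ F → ∃ z : X, Q z = 0 ∧ ‖z‖ ≤ 2 * ‖x‖ ∧ ‖π x - π z‖ ≤ ε * ‖x‖ := by
  have : ProperSpace V := FiniteDimensional.proper ℝ V
  let A : Set V := ⋂ z : {z : X // Q z = 0 ∧ ‖z‖ ≤ 2}, {v | ε ≤ ‖v - π z‖}
  have hA : IsClosed A := isClosed_iInter fun z ↦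
    isClosed_le continuous_const (by fun_prop)
  have hK : IsCompact (closedBall (0 : V) ‖π‖ ∩ A) :=
    (isCompact_closedBall _ _).inter_right hA
  obtain ⟨F, hFc, hF, hFK⟩ : ∃ F : Submodule ℝ Y, IsClosed (F : Set Y) ∧ F.CoFG ∧
      ∀ x : X, ‖x‖ ≤ 1 → Q x ∈ F → π x ∉ closedBall (0 : V) ‖π‖ ∩ A := by
    refine hK.induction_on (p := fun s ↦ ∃ F : Submodule ℝ Y, IsClosed (F : Set Y) ∧ F.CoFG ∧
      ∀ x : X, ‖x‖ ≤ 1 → Q x ∈ F → π x ∉ s) ?_ ?_ ?_ ?_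
    · exact ⟨⊤, isClosed_univ, Submodule.CoFG.top, fun _ _ _ ↦ notMem_empty _⟩
    · rintro s t hst ⟨F, hFc, hF, hFt⟩
      exact ⟨F, hFc, hF, fun x hx hxF hxs ↦ hFt x hx hxF (hst hxs)⟩
    · rintro s t ⟨F, hFc, hF, hFs⟩ ⟨G, hGc, hG, hGt⟩
      exact ⟨F ⊓ G, hFc.inter hGc, hF.inf hG, fun x hx hxF hxst ↦
        hxst.elim (hFs x hx hxF.1) (hGt x hx hxF.2)⟩
    · rintro v ⟨-, hv⟩
      obtain ⟨U, hU, hvU, hF⟩ := exists_finite_codim_avoiding_nhds Q hQ π hε v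
        fun z hz hz2 ↦ mem_iInter.1 hv ⟨z, hz, hz2⟩
      exact ⟨U, mem_nhdsWithin_of_mem_nhds (hU.mem_nhds hvU), hF⟩
  refine ⟨F, hFc, hF, fun x hx ↦ ?_⟩
  rcases eq_or_ne x 0 with rfl | hx0
  · exact ⟨0, by simp⟩
  have hxn : 0 < ‖x‖ := norm_pos_iff.2 hx0
  have hunit : ‖‖x‖⁻¹ • x‖ = 1 := by
    rw [norm_smul, norm_inv, norm_norm, inv_mul_cancel₀ hxn.ne']
  have hmem : π (‖x‖⁻¹ • x) ∉ A := fun h ↦ hFK (‖x‖⁻¹ • x) hunit.le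
    (by rw [map_smul]; exact F.smul_mem _ hx)
    ⟨mem_closedBall_zero_iff.2 ((π.le_opNorm _).trans (by rw [hunit, mul_one])), h⟩
  simp only [A, mem_iInter, mem_ofPred_eq, not_forall, not_le, Subtype.exists] at hmem
  obtain ⟨z, ⟨hz0, hz2⟩, hz⟩ := hmem
  refine ⟨‖x‖ • z, by rw [map_smul, hz0, smul_zero], ?_, ?_⟩
  · rw [norm_smul, norm_norm]
    nlinarith
  · have : π x - π (‖x‖ • z) = ‖x‖ • (π (‖x‖⁻¹ • x) - π z) := by
      rw [smul_sub, map_smul, map_smul, smul_smul, mul_inv_cancel₀ hxn.ne', one_smul]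
    rw [this, norm_smul, norm_norm]
    nlinarith

/-- The vectors of a suitable subspace of finite codimension of a quotient lift, up to a small
error and with uniform control of the norm, into a prescribed subspace of finite codimension. -/
lemma exists_uniform_approx_lift (Q : X →L[ℝ] Y) (hQ : Function.Surjective Q) :
    ∃ M > 0, ∀ E : Submodule ℝ X, IsClosed (E : Set X) → E.CoFG → ∀ ε > 0,
      ∃ F : Submodule ℝ Y, IsClosed (F : Set Y) ∧ F.CoFG ∧
        ∀ w ∈ F, ∃ z ∈ E, ‖z‖ ≤ M * ‖w‖ ∧ ‖Q z - w‖ ≤ ε * ‖w‖ := by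
  obtain ⟨C, hC, hlift⟩ := Q.exists_preimage_norm_le hQ
  refine ⟨4 * C, by positivity, fun E hEc hE ε hε ↦ ?_⟩
  have : FiniteDimensional ℝ (X ⧸ E) := hE
  set δ : ℝ := min (1 / 2) (ε / (2 * ((‖Q‖ + 1) * C))) with hδ
  have hden : 0 < 2 * ((‖Q‖ + 1) * C) := by positivity
  have hδ0 : 0 < δ := lt_min (by norm_num) (by positivity)
  have hδ1 : δ ≤ 1 / 2 := min_le_left _ _
  have hδε : δ * (2 * ((‖Q‖ + 1) * C)) ≤ ε := (le_div_iff₀ hden).1 (min_le_right _ _)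
  obtain ⟨F, hFc, hF, hFE⟩ := exists_finite_codim_kernel_approx Q hQ E.mkQL hδ0
  refine ⟨F, hFc, hF, fun w hw ↦ ?_⟩
  obtain ⟨x, rfl, hxn⟩ := hlift w
  rcases eq_or_ne x 0 with rfl | hx0
  · exact ⟨0, E.zero_mem, by simp⟩
  have hx : 0 < ‖x‖ := norm_pos_iff.2 hx0
  obtain ⟨z, hz0, hz2, hz⟩ := hFE x hw
  obtain ⟨t, ht, htn⟩ := Submodule.Quotient.norm_mk_lt (E.mkQL x - E.mkQL z)
    (mul_pos hδ0 hx)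
  have htn' : ‖t‖ ≤ 2 * δ * ‖x‖ := by linarith
  refine ⟨x - z - t, ?_, ?_, ?_⟩
  · rw [← Submodule.Quotient.mk_eq_zero, Submodule.Quotient.mk_sub, ht]
    simp
  · have h1 := norm_sub_le (x - z) t
    have h2 := norm_sub_le x z
    nlinarith
  · have h1 : Q (x - z - t) - Q x = -Q t := by rw [map_sub, map_sub, hz0]; abel
    rw [h1, norm_neg]
    calc ‖Q t‖ ≤ (‖Q‖ + 1) * (2 * δ * (C * ‖Q x‖)) :=
          (Q.le_opNorm t).trans <| mul_le_mul (by linarith) (htn'.trans (by gcongr))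
            (norm_nonneg t) (by positivity)
      _ = δ * (2 * ((‖Q‖ + 1) * C)) * ‖Q x‖ := by ring
      _ ≤ ε * ‖Q x‖ := by gcongr

end AsymptoticLifting

section Modulus

variable {X : Type*} [NormedAddCommGroup X] [NormedSpace ℝ X] {N : X → ℝ}

lemma IsNormFn.map_zero (hN : IsNormFn X N) : N 0 = 0 := (hN.2.1 0).2 rfl

lemma IsNormFn.apply_add_smul_le (hN : IsNormFn X N) {τ : ℝ} (hτ : 0 ≤ τ) {x y : X}
    (hy : N y ≤ 1) (hx : N x ≤ 1) : N (y + τ • x) ≤ 1 + τ := by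
  have h := hN.2.2.2 y (τ • x)
  rw [hN.2.2.1, abs_of_nonneg hτ] at h
  nlinarith

lemma IsNormFn.bddAbove_sphere_values (hN : IsNormFn X N) {τ : ℝ} (hτ : 0 ≤ τ) {y : X}
    (hy : N y ≤ 1) (E : Submodule ℝ X) :
    BddAbove {t : ℝ | ∃ x ∈ E, N x ≤ 1 ∧ t = N (y + τ • x) - 1} := by
  refine ⟨τ, ?_⟩
  rintro _ ⟨x, -, hx, rfl⟩
  linarith [hN.apply_add_smul_le hτ hy hx]

lemma IsNormFn.bddBelow_codim_values (hN : IsNormFn X N) {τ : ℝ} (hτ : 0 ≤ τ) {y : X}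
    (hy : N y ≤ 1) :
    BddBelow {s : ℝ | ∃ E : Submodule ℝ X, IsClosed (E : Set X) ∧ FiniteDimensional ℝ (X ⧸ E) ∧
      s = sSup {t : ℝ | ∃ x ∈ E, N x ≤ 1 ∧ t = N (y + τ • x) - 1}} := by
  refine ⟨-1, ?_⟩
  rintro _ ⟨E, -, -, rfl⟩
  refine le_csSup_of_le (hN.bddAbove_sphere_values hτ hy E)
    ⟨0, E.zero_mem, hN.map_zero.trans_le zero_le_one, rfl⟩ ?_
  linarith [hN.1 (y + τ • 0)]

/-- In infinite dimension, the modulus of asymptotic uniform smoothness is at most `c` exactly when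
every point of the ball admits subspaces of finite codimension along which the norm grows by at
most `c`, up to an arbitrarily small error. -/
lemma IsNormFn.rhoN_le_iff (hN : IsNormFn X N) (hX : ¬ FiniteDimensional ℝ X) {τ c : ℝ}
    (hτ : 0 ≤ τ) :
    rhoN X N τ ≤ c ↔ ∀ y : X, N y ≤ 1 → ∀ ε > 0, ∃ E : Submodule ℝ X, IsClosed (E : Set X) ∧
      E.CoFG ∧ ∀ x ∈ E, N x ≤ 1 → N (y + τ • x) ≤ 1 + c + ε := by
  rw [rhoN, if_neg hX]
  constructor
  · intro h y hy ε hε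
    have h1 : sInf {s : ℝ | ∃ E : Submodule ℝ X, IsClosed (E : Set X) ∧
        FiniteDimensional ℝ (X ⧸ E) ∧
        s = sSup {t : ℝ | ∃ x ∈ E, N x ≤ 1 ∧ t = N (y + τ • x) - 1}} ≤ c := by
      refine h.trans' (le_csSup ⟨τ, ?_⟩ ⟨y, hy, rfl⟩)
      rintro _ ⟨y, hy, rfl⟩
      refine (csInf_le (hN.bddBelow_codim_values hτ hy)
        ⟨⊤, isClosed_univ, Submodule.CoFG.top, rfl⟩).trans ?_
      refine csSup_le ⟨_, 0, Submodule.zero_mem _, hN.map_zero.trans_le zero_le_one, rfl⟩ ?_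
      rintro _ ⟨x, -, hx, rfl⟩
      linarith [hN.apply_add_smul_le hτ hy hx]
    obtain ⟨_, ⟨E, hEc, hE, rfl⟩, hlt⟩ := exists_lt_of_csInf_lt
      (by exact ⟨_, ⊤, isClosed_univ, Submodule.CoFG.top, rfl⟩)
      (h1.trans_lt (lt_add_of_pos_right c hε))
    refine ⟨E, hEc, hE, fun x hx hx1 ↦ ?_⟩
    have := (le_csSup (hN.bddAbove_sphere_values hτ hy E) ⟨x, hx, hx1, rfl⟩).trans_lt hlt
    linarith
  · intro h
    refine csSup_le ⟨_, 0, hN.map_zero.trans_le zero_le_one, rfl⟩ ?_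
    rintro _ ⟨y, hy, rfl⟩
    refine le_of_forall_pos_le_add fun ε hε ↦ ?_
    obtain ⟨E, hEc, hE, hle⟩ := h y hy ε hε
    refine (csInf_le (hN.bddBelow_codim_values hτ hy) ⟨E, hEc, hE, rfl⟩).trans ?_
    refine csSup_le ⟨_, 0, E.zero_mem, hN.map_zero.trans_le zero_le_one, rfl⟩ ?_
    rintro _ ⟨x, hx, hx1, rfl⟩
    linarith [hle x hx hx1]

end Modulus

section QuotientNorm

variable {X Y : Type*} [NormedAddCommGroup X] [NormedSpace ℝ X]
  [NormedAddCommGroup Y] [NormedSpace ℝ Y] {N : X → ℝ} {Q : X →L[ℝ] Y}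

/-- The quotient norm induced on `Y` by the norm `N` on `X` and the quotient map `Q`. -/
noncomputable def quotientNormFn (N : X → ℝ) (Q : X →L[ℝ] Y) (y : Y) : ℝ :=
  sInf (N '' {x | Q x = y})

lemma quotientNormFn_nonneg (hN : IsNormFn X N) (y : Y) : 0 ≤ quotientNormFn N Q y := by
  refine Real.sInf_nonneg ?_
  rintro _ ⟨x, -, rfl⟩
  exact hN.1 x

lemma quotientNormFn_apply_le (hN : IsNormFn X N) (x : X) : quotientNormFn N Q (Q x) ≤ N x := by
  refine csInf_le ⟨0, ?_⟩ ⟨x, rfl, rfl⟩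
  rintro _ ⟨x, -, rfl⟩
  exact hN.1 x

lemma exists_lift_lt_quotientNormFn_add (hQ : Function.Surjective Q) (y : Y) {η : ℝ}
    (hη : 0 < η) : ∃ x, Q x = y ∧ N x < quotientNormFn N Q y + η := by
  obtain ⟨x₀, hx₀⟩ := hQ y
  obtain ⟨_, ⟨x, hx, rfl⟩, hlt⟩ := exists_lt_of_csInf_lt (s := N '' {x | Q x = y})
    ⟨_, x₀, hx₀, rfl⟩ (lt_add_of_pos_right _ hη)
  exact ⟨x, hx, hlt⟩

lemma quotientNormFn_smul_le (hN : IsNormFn X N) (hQ : Function.Surjective Q) (a : ℝ) (y : Y) :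
    quotientNormFn N Q (a • y) ≤ |a| * quotientNormFn N Q y := by
  refine le_of_forall_pos_le_add fun ε hε ↦ ?_
  obtain ⟨x, rfl, hx⟩ := exists_lift_lt_quotientNormFn_add (N := N) hQ y
    (div_pos hε (by positivity : 0 < |a| + 1))
  rw [← map_smul]
  refine (quotientNormFn_apply_le hN _).trans ?_
  rw [hN.2.2.1]
  have h : |a| * (ε / (|a| + 1)) ≤ ε := by
    rw [mul_div_assoc', div_le_iff₀ (by positivity)]
    nlinarith
  nlinarith [abs_nonneg a]

lemma isNormFn_quotientNormFn (hN : IsNormFn X N) (hQ : Function.Surjective Q)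
    (hdef : ∀ y : Y, quotientNormFn N Q y = 0 → y = 0) :
    IsNormFn Y (quotientNormFn N Q) := by
  refine ⟨quotientNormFn_nonneg hN, fun y ↦ ⟨hdef y, ?_⟩, fun a y ↦ ?_, fun y y' ↦ ?_⟩
  · rintro rfl
    refine le_antisymm ?_ (quotientNormFn_nonneg hN _)
    simpa [hN.map_zero] using quotientNormFn_apply_le (Q := Q) hN 0
  · refine le_antisymm (quotientNormFn_smul_le hN hQ a y) ?_
    rcases eq_or_ne a 0 with rfl | ha
    · simpa using quotientNormFn_nonneg hN _
    have h := quotientNormFn_smul_le hN hQ a⁻¹ (a • y)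
    rw [inv_smul_smul₀ ha, abs_inv] at h
    rwa [le_inv_mul_iff₀ (abs_pos.2 ha)] at h
  · refine le_of_forall_pos_le_add fun ε hε ↦ ?_
    obtain ⟨x, rfl, hx⟩ := exists_lift_lt_quotientNormFn_add (N := N) hQ y (half_pos hε)
    obtain ⟨x', rfl, hx'⟩ := exists_lift_lt_quotientNormFn_add (N := N) hQ y' (half_pos hε)
    rw [← map_add]
    linarith [quotientNormFn_apply_le (Q := Q) hN (x + x'), hN.2.2.2 x x']

lemma isEquivNorm_quotientNormFn [CompleteSpace X] [CompleteSpace Y] (hN : IsEquivNorm X N)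
    (hQ : Function.Surjective Q) : IsEquivNorm Y (quotientNormFn N Q) := by
  obtain ⟨hN, a, ha, b, hb, hab⟩ := hN
  obtain ⟨C, hC, hlift⟩ := Q.exists_preimage_norm_le hQ
  have hpos : 0 < ‖Q‖ + 1 := by positivity
  have hlow (y : Y) : a / (‖Q‖ + 1) * ‖y‖ ≤ quotientNormFn N Q y := by
    obtain ⟨x₀, hx₀⟩ := hQ y
    refine le_csInf ⟨_, x₀, hx₀, rfl⟩ ?_
    rintro _ ⟨x, rfl, rfl⟩
    refine le_trans ?_ (hab x).1
    rw [div_mul_eq_mul_div, div_le_iff₀ hpos]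
    nlinarith [Q.le_opNorm x, norm_nonneg x]
  refine ⟨isNormFn_quotientNormFn hN hQ fun y hy ↦ ?_, a / (‖Q‖ + 1), by positivity, b * C,
    by positivity, fun y ↦ ⟨hlow y, ?_⟩⟩
  · have h := hlow y
    rw [hy] at h
    exact norm_le_zero_iff.1 (nonpos_of_mul_nonpos_right h (by positivity))
  · obtain ⟨x, rfl, hx⟩ := hlift y
    refine (quotientNormFn_apply_le hN x).trans ((hab x).2.trans ?_)
    rw [mul_assoc]
    gcongr

lemma isPAUSNorm_quotientNormFn [CompleteSpace X] [CompleteSpace Y] {p : ℝ}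
    (hN : IsEquivNorm X N) (hp : IsPAUSNorm X N p) (hQ : Function.Surjective Q) :
    IsPAUSNorm Y (quotientNormFn N Q) p := by
  by_cases hY : FiniteDimensional ℝ Y
  · refine ⟨1, one_pos, fun τ hτ ↦ ?_⟩
    rw [rhoN, if_pos hY]
    positivity
  have hX : ¬ FiniteDimensional ℝ X := fun h ↦
    hY (Module.Finite.of_surjective (Q : X →ₗ[ℝ] Y) hQ)
  obtain ⟨hNY, a', ha', b', hb', hab'⟩ := isEquivNorm_quotientNormFn hN hQ
  obtain ⟨hN, a, ha, b, hb, hab⟩ := hN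
  obtain ⟨C, hC, hρ⟩ := hp
  obtain ⟨M, hM, hlift⟩ := exists_uniform_approx_lift Q hQ
  set K : ℝ := b * (M * (1 / a')) with hK
  have hK0 : 0 < K := by positivity
  refine ⟨C * K ^ p, by positivity, fun τ hτ ↦ (hNY.rhoN_le_iff hY hτ).2 fun y hy ε hε ↦ ?_⟩
  obtain ⟨x, rfl, hx⟩ := exists_lift_lt_quotientNormFn_add (N := N) hQ y
    (by positivity : 0 < ε / 3)
  set c : ℝ := 1 + ε / 3 with hc
  have hc0 : 0 < c := by positivity
  have hxc : N x ≤ c := by linarith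
  have hx1 : N (c⁻¹ • x) ≤ 1 := by
    rw [hN.2.2.1, abs_of_pos (by positivity), inv_mul_le_iff₀ hc0, mul_one]
    exact hxc
  have hxd : N (x - c⁻¹ • x) ≤ ε / 3 := by
    have h1 : x - c⁻¹ • x = (1 - c⁻¹) • x := by rw [sub_smul, one_smul]
    have h2 : 1 - c⁻¹ = ε / 3 / c := by
      rw [eq_div_iff hc0.ne', sub_mul, inv_mul_cancel₀ hc0.ne']
      linarith
    rw [h1, h2, hN.2.2.1, abs_of_pos (by positivity), div_mul_eq_mul_div, div_le_iff₀ hc0]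
    gcongr
  have hτK : 0 ≤ τ * K := by positivity
  obtain ⟨E, hEc, hE, hEN⟩ := (hN.rhoN_le_iff hX hτK).1 (hρ _ hτK) _ hx1 (ε / 6) (by positivity)
  set δ : ℝ := ε / 6 / (b' * (1 / a') * (τ + 1)) with hδ
  have hδ0 : 0 < δ := by positivity
  obtain ⟨F, hFc, hF, hFE⟩ := hlift E hEc hE δ hδ0
  refine ⟨F, hFc, hF, fun w hw hw1 ↦ ?_⟩
  have hwn : ‖w‖ ≤ 1 / a' := by
    rw [le_div_iff₀ ha']
    linarith [(hab' w).1]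
  obtain ⟨z, hzE, hzn, hzw⟩ := hFE w hw
  have hzK : N (K⁻¹ • z) ≤ 1 := by
    rw [hN.2.2.1, abs_of_pos (by positivity), inv_mul_le_iff₀ hK0, mul_one]
    exact (hab z).2.trans (by rw [hK]; gcongr; exact hzn.trans (by gcongr))
  have h1 := hEN _ (E.smul_mem K⁻¹ hzE) hzK
  rw [smul_smul, mul_assoc, mul_inv_cancel₀ hK0.ne', mul_one, Real.mul_rpow hτ hK0.le] at h1
  have h2 : quotientNormFn N Q (τ • (w - Q z)) ≤ ε / 6 := by
    rw [hNY.2.2.1, abs_of_nonneg hτ]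
    have h3 : quotientNormFn N Q (w - Q z) ≤ b' * (δ * (1 / a')) := by
      refine (hab' _).2.trans ?_
      rw [norm_sub_rev]
      gcongr
      exact hzw.trans (by gcongr)
    calc τ * quotientNormFn N Q (w - Q z) ≤ (τ + 1) * (b' * (δ * (1 / a'))) := by
          gcongr
          · exact quotientNormFn_nonneg hN _
          · linarith
      _ = ε / 6 := by rw [hδ]; field_simp
  have h3 : Q x + τ • w = Q (x - c⁻¹ • x) + (Q (c⁻¹ • x + τ • z) + τ • (w - Q z)) := by
    simp only [map_add, map_sub, map_smul, smul_sub]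
    abel
  rw [h3]
  have h4 := hNY.2.2.2 (Q (x - c⁻¹ • x)) (Q (c⁻¹ • x + τ • z) + τ • (w - Q z))
  have h5 := hNY.2.2.2 (Q (c⁻¹ • x + τ • z)) (τ • (w - Q z))
  have h6 := quotientNormFn_apply_le (Q := Q) hN (x - c⁻¹ • x)
  have h7 := quotientNormFn_apply_le (Q := Q) hN (c⁻¹ • x + τ • z)
  linarith

end QuotientNorm

/-- For `p ∈ (1,∞)`, the class of `p`-AUS-able Banach spaces is stable under quotients: if `X`
admits an equivalent `p`-AUS norm and `Q : X → Y` is a surjective bounded linear map onto a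
Banach space `Y`, then `Y` admits an equivalent `p`-AUS norm. -/
theorem pAUSable_of_quotient (p : ℝ) (hp : 1 < p)
    (X : Type u) [NormedAddCommGroup X] [NormedSpace ℝ X] [CompleteSpace X]
    (Y : Type v) [NormedAddCommGroup Y] [NormedSpace ℝ Y] [CompleteSpace Y]
    (hX : PAUSable p X) (Q : X →L[ℝ] Y) (hQ : Function.Surjective Q) :
    PAUSable p Y := by
  obtain ⟨N, hN, hNp⟩ := hX
  exact ⟨quotientNormFn N Q, isEquivNorm_quotientNormFn hN hQ,
    isPAUSNorm_quotientNormFn hN hNp hQ⟩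
end

section
/- Let p ∈ (1,∞) and let (F_n)_{n∈ℕ} be a sequence of finite-dimensional normed spaces. Let E = (Σ_n F_n)_{ℓ_p} be their ℓ_p-sum. Then the modulus of asymptotic uniform smoothness of E satisfies ρ̄_E(τ) ≤ (1 + τ^p)^{1/p} − 1 for all τ ≥ 0. In particular, the canonical norm of E is p-AUS (since (1+τ^p)^{1/p} − 1 ≤ τ^p/p). -/
open Metric Set Topology Filter

universe u

/-- To bound the modulus of asymptotic uniform smoothness by `B`, it suffices to find, for each `y`
in the unit ball and each `ε > 0`, a closed finite-codimensional subspace `E` such that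
`‖y + τ • x‖ - 1 ≤ B + ε` for all `x` in the unit ball of `E`. -/
theorem rho_le_of_forall_exists_submodule {X : Type*} [NormedAddCommGroup X] [NormedSpace ℝ X]
    {τ B : ℝ} (hτ : 0 ≤ τ) (hB : 0 ≤ B)
    (h : ∀ y : X, ‖y‖ ≤ 1 → ∀ ε > 0, ∃ E : Submodule ℝ X, IsClosed (E : Set X) ∧
      FiniteDimensional ℝ (X ⧸ E) ∧ ∀ x ∈ E, ‖x‖ ≤ 1 → ‖y + τ • x‖ - 1 ≤ B + ε) :
    rho X τ ≤ B := by
  unfold rho rhoN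
  split_ifs with hX
  · exact hB
  refine Real.sSup_le ?_ hB
  rintro r ⟨y, hy, rfl⟩
  refine le_of_forall_pos_le_add fun ε hε => ?_
  obtain ⟨E, hEc, hEf, hE⟩ := h y hy ε hε
  have hbdd : BddBelow { s : ℝ | ∃ E : Submodule ℝ X, IsClosed (E : Set X) ∧
      FiniteDimensional ℝ (X ⧸ E) ∧
      s = sSup { t : ℝ | ∃ x ∈ E, ‖x‖ ≤ 1 ∧ t = ‖y + τ • x‖ - 1 } } := by
    refine ⟨-1, ?_⟩
    rintro s ⟨G, -, -, rfl⟩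
    have hmem : ‖y‖ - 1 ∈ { t : ℝ | ∃ x ∈ G, ‖x‖ ≤ 1 ∧ t = ‖y + τ • x‖ - 1 } :=
      ⟨0, G.zero_mem, by simp, by simp⟩
    refine le_trans (by linarith [norm_nonneg y]) (le_csSup ⟨τ, ?_⟩ hmem)
    rintro t ⟨x, -, hx, rfl⟩
    have h1 : ‖y + τ • x‖ ≤ ‖y‖ + τ * ‖x‖ := by
      simpa [norm_smul, abs_of_nonneg hτ] using norm_add_le y (τ • x)
    nlinarith
  refine (csInf_le hbdd ⟨E, hEc, hEf, rfl⟩).trans (Real.sSup_le ?_ (by positivity))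
  rintro t ⟨x, hxE, hx, rfl⟩
  exact hE x hxE hx

section LpSum

variable {ι : Type*} {F : ι → Type*} [∀ i, NormedAddCommGroup (F i)] [∀ i, NormedSpace ℝ (F i)]
  {q : ENNReal}

/-- The subspace of an `ℓ_q`-sum consisting of the elements vanishing on a finite set of indices. -/
def lpVanishing [Fact (1 ≤ q)] (s : Finset ι) : Submodule ℝ (lp F q) where
  carrier := {x | ∀ i ∈ s, x i = 0}
  add_mem' {x y} hx hy i hi := by simp [hx i hi, hy i hi]
  zero_mem' i _ := by simp
  smul_mem' c x hx i hi := by simp [hx i hi]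

theorem mem_lpVanishing [Fact (1 ≤ q)] {s : Finset ι} {x : lp F q} :
    x ∈ lpVanishing s ↔ ∀ i ∈ s, x i = 0 :=
  Iff.rfl

theorem isClosed_lpVanishing [Fact (1 ≤ q)] (s : Finset ι) :
    IsClosed ((lpVanishing s : Submodule ℝ (lp F q)) : Set (lp F q)) := by
  have : ((lpVanishing s : Submodule ℝ (lp F q)) : Set (lp F q)) = ⋂ i ∈ s, {x | x i = 0} := by
    ext x
    simp [mem_lpVanishing]
  rw [this]
  exact isClosed_biInter fun i _ =>
    isClosed_eq (lp.lipschitzWith_one_eval q i).continuous continuous_const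

theorem finiteDimensional_quotient_lpVanishing [Fact (1 ≤ q)] [∀ i, FiniteDimensional ℝ (F i)]
    (s : Finset ι) : FiniteDimensional ℝ (lp F q ⧸ (lpVanishing s : Submodule ℝ (lp F q))) := by
  let T : lp F q →ₗ[ℝ] ∀ i : s, F i :=
    { toFun := fun x i => x i
      map_add' := fun x y => by ext i; simp
      map_smul' := fun c x => by ext i; simp }
  have hker : (lpVanishing s : Submodule ℝ (lp F q)) = LinearMap.ker T := by
    ext x
    simp [mem_lpVanishing, T, funext_iff]
  rw [hker]
  exact T.quotKerEquivRange.symm.finiteDimensional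

/-- The `ℓ_q`-norm is `q`-additive on a finite truncation and a vector vanishing there. -/
theorem norm_sum_single_add_rpow [DecidableEq ι] [Fact (1 ≤ q)] (hq : 0 < q.toReal) (y : lp F q)
    {s : Finset ι} {x : lp F q} (hx : x ∈ lpVanishing s) :
    ‖∑ i ∈ s, lp.single q i (y i) + x‖ ^ q.toReal =
      ∑ i ∈ s, ‖y i‖ ^ q.toReal + ‖x‖ ^ q.toReal := by
  set f := ∑ i ∈ s, lp.single q i (y i) + x with hf
  have hfi : ∀ i ∈ s, f i = y i := fun i hi => by
    simp only [hf, lp.coeFn_add, lp.coeFn_sum, lp.coeFn_single, Pi.add_apply, Finset.sum_apply,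
      Finset.sum_pi_single, if_pos hi, mem_lpVanishing.1 hx i hi, add_zero]
  have h := lp.norm_compl_sum_single hq f s
  have hsub : f - ∑ i ∈ s, lp.single q i (f i) = x := by
    rw [Finset.sum_congr rfl fun i hi => congrArg (lp.single q i) (hfi i hi), hf,
      add_sub_cancel_left]
  have hnorm : ∑ i ∈ s, ‖f i‖ ^ q.toReal = ∑ i ∈ s, ‖y i‖ ^ q.toReal :=
    Finset.sum_congr rfl fun i hi => by rw [hfi i hi]
  rw [hsub, hnorm] at h
  linarith

theorem rho_lp_le [Fact (1 ≤ q)] (hq : q ≠ ⊤) [∀ i, FiniteDimensional ℝ (F i)] {τ : ℝ}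
    (hτ : 0 ≤ τ) : rho (lp F q) τ ≤ (1 + τ ^ q.toReal) ^ (1 / q.toReal) - 1 := by
  classical
  have hq0 : 0 < q.toReal := ENNReal.toReal_pos (zero_lt_one.trans_le Fact.out).ne' hq
  have hτq : 0 ≤ τ ^ q.toReal := Real.rpow_nonneg hτ _
  refine rho_le_of_forall_exists_submodule hτ
    (sub_nonneg.2 (Real.one_le_rpow (by linarith) (by positivity))) fun y hy ε hε => ?_
  obtain ⟨s, hs⟩ := ((lp.hasSum_single hq y).eventually (Metric.ball_mem_nhds y hε)).exists
  refine ⟨lpVanishing s, isClosed_lpVanishing s, finiteDimensional_quotient_lpVanishing s,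
    fun x hx hx1 => ?_⟩
  set z := ∑ i ∈ s, lp.single q i (y i) with hz
  have htail : ‖y - z‖ < ε := by rwa [← dist_eq_norm, dist_comm]
  have hpow : ‖z + τ • x‖ ^ q.toReal ≤ 1 + τ ^ q.toReal := by
    rw [hz, norm_sum_single_add_rpow hq0 y (Submodule.smul_mem _ τ hx), norm_smul, Real.norm_eq_abs,
      abs_of_nonneg hτ, Real.mul_rpow hτ (norm_nonneg x)]
    exact add_le_add
      ((lp.sum_rpow_le_norm_rpow hq0 y s).trans
        (Real.rpow_le_one (norm_nonneg y) hy hq0.le))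
      (mul_le_of_le_one_right hτq (Real.rpow_le_one (norm_nonneg x) hx1 hq0.le))
  have hhead : ‖z + τ • x‖ ≤ (1 + τ ^ q.toReal) ^ (1 / q.toReal) := by
    rw [one_div]
    exact (Real.le_rpow_inv_iff_of_pos (norm_nonneg _) (by positivity) hq0).2 hpow
  have htri : ‖y + τ • x‖ ≤ ‖y - z‖ + ‖z + τ • x‖ := by
    simpa only [sub_add_add_cancel, sub_add_cancel, ← add_assoc] using
      norm_add_le (y - z) (z + τ • x)
  linarith

end LpSum

/-- For `p ∈ (1,∞)` and a sequence of finite-dimensional normed spaces `F n`, the modulus of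
asymptotic uniform smoothness of the `ℓ_p`-sum `E = (Σ_n F_n)_{ℓ_p}` satisfies
`ρ̄_E(τ) ≤ (1 + τ^p)^(1/p) - 1` for all `τ ≥ 0`; in particular the canonical norm of `E` is
`p`-AUS. -/
theorem rho_lp_sum_of_finiteDimensional (p : ℝ) (hp : 1 < p)
    (F : ℕ → Type u) (_i : ∀ n, NormedAddCommGroup (F n)) (_j : ∀ n, NormedSpace ℝ (F n))
    (_k : ∀ n, FiniteDimensional ℝ (F n)) :
    letI : Fact (1 ≤ ENNReal.ofReal p) := ⟨ENNReal.one_le_ofReal.2 hp.le⟩;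
    (∀ τ : ℝ, 0 ≤ τ → rho (lp F (ENNReal.ofReal p)) τ ≤ (1 + τ ^ p) ^ (1 / p) - 1) ∧
      ∃ C > 0, ∀ τ : ℝ, 0 ≤ τ → rho (lp F (ENNReal.ofReal p)) τ ≤ C * τ ^ p := by
  let : Fact (1 ≤ ENNReal.ofReal p) := ⟨ENNReal.one_le_ofReal.2 hp.le⟩
  have hp0 : 0 < p := zero_lt_one.trans hp
  have hmain : ∀ τ : ℝ, 0 ≤ τ →
      rho (lp F (ENNReal.ofReal p)) τ ≤ (1 + τ ^ p) ^ (1 / p) - 1 := fun τ hτ => by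
    simpa only [ENNReal.toReal_ofReal hp0.le] using
      rho_lp_le (F := F) (q := ENNReal.ofReal p) ENNReal.ofReal_ne_top hτ
  refine ⟨hmain, 1 / p, by positivity, fun τ hτ => (hmain τ hτ).trans ?_⟩
  have hτp : 0 ≤ τ ^ p := Real.rpow_nonneg hτ p
  have hbern := rpow_one_add_le_one_add_mul_self (s := τ ^ p) (by linarith) (p := 1 / p)
    (by positivity) ((div_le_one hp0).2 hp.le)
  linarith
end

section
/- Let X be a Banach space such that for every q ∈ [2,∞) there is a closed subspace of X isomorphic to ℓ_q. Then X admits no equivalent uniformly smooth norm. In particular, there is no Banach space with an equivalent uniformly smooth (or 2-uniformly smooth) norm that contains isomorphic copies of all separable Banach spaces with a 2-uniformly smooth norm. -/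
open Metric Set Topology Filter

/-- The modulus of uniform smoothness of a norm `N`. -/
noncomputable def usModN (X : Type*) [NormedAddCommGroup X] [NormedSpace ℝ X]
    (N : X → ℝ) (t : ℝ) : ℝ :=
  sSup { r : ℝ | ∃ x y : X, N x = 1 ∧ N y = 1 ∧ r = (N (x + t • y) + N (x - t • y)) / 2 - 1 }

def IsUniformlySmoothNorm (X : Type*) [NormedAddCommGroup X] [NormedSpace ℝ X]
    (N : X → ℝ) : Prop :=
  Filter.Tendsto (fun t => usModN X N t / t) (nhdsWithin 0 (Set.Ioi 0)) (nhds 0)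

def IsTwoUniformlySmoothNorm (X : Type*) [NormedAddCommGroup X] [NormedSpace ℝ X]
    (N : X → ℝ) : Prop :=
  ∃ C > 0, ∀ t : ℝ, 0 < t → usModN X N t ≤ C * t ^ (2 : ℕ)

universe u

section UniformNonsquareness

variable {X : Type*} [NormedAddCommGroup X] [NormedSpace ℝ X] {N : X → ℝ}

theorem IsNormFn.map_neg (hN : IsNormFn X N) (x : X) : N (-x) = N x := by
  have h := hN.2.2.1 (-1) x
  simpa using h

theorem IsNormFn.le_add_sub (hN : IsNormFn X N) (x y : X) : N x - N y ≤ N (x + y) := by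
  have h := hN.2.2.2 (x + y) (-y)
  rw [hN.map_neg, add_neg_cancel_right] at h
  linarith

theorem IsNormFn.le_usModN (hN : IsNormFn X N) {t : ℝ} (ht : 0 ≤ t) {x y : X}
    (hx : N x = 1) (hy : N y = 1) :
    (N (x + t • y) + N (x - t • y)) / 2 - 1 ≤ usModN X N t := by
  refine le_csSup ⟨t, ?_⟩ ⟨x, y, hx, hy, rfl⟩
  rintro r ⟨u, v, hu, hv, rfl⟩
  have h₁ := hN.2.2.2 u (t • v)
  have h₂ := hN.2.2.2 u (-(t • v))
  rw [hN.map_neg, ← sub_eq_add_neg] at h₂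
  rw [hN.2.2.1, abs_of_nonneg ht, hu, hv] at h₁ h₂
  linarith

/-- If `u` and `v` nearly span a square, the normalized vectors have a norm of their sum
close to `2`. -/
theorem IsNormFn.normalized_add_ge (hN : IsNormFn X N) {s : ℝ} {u v : X}
    (hu : 0 < N u) (hv : 0 < N v) (hus : N u ≤ s) (hvs : N v ≤ s)
    (h : 2 ≤ N u + N v) (huv : 2 ≤ N (u + v)) :
    4 / s - 2 ≤ N ((N u)⁻¹ • u + (N v)⁻¹ • v) := by
  have hs : 0 < s := hu.trans_le hus
  have key := hN.le_add_sub (s⁻¹ • (u + v))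
    (((N u)⁻¹ - s⁻¹) • u + ((N v)⁻¹ - s⁻¹) • v)
  have e : s⁻¹ • (u + v) + (((N u)⁻¹ - s⁻¹) • u + ((N v)⁻¹ - s⁻¹) • v)
      = (N u)⁻¹ • u + (N v)⁻¹ • v := by module
  have h₁ := hN.2.2.2 (((N u)⁻¹ - s⁻¹) • u) (((N v)⁻¹ - s⁻¹) • v)
  have hu' : s⁻¹ ≤ (N u)⁻¹ := inv_anti₀ hu hus
  have hv' : s⁻¹ ≤ (N v)⁻¹ := inv_anti₀ hv hvs
  rw [hN.2.2.1, hN.2.2.1, abs_of_nonneg (sub_nonneg.2 hu'), abs_of_nonneg (sub_nonneg.2 hv'),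
    sub_mul, sub_mul, inv_mul_cancel₀ hu.ne', inv_mul_cancel₀ hv.ne'] at h₁
  rw [e, hN.2.2.1, abs_of_pos (inv_pos.2 hs)] at key
  have h₂ : s⁻¹ * 2 ≤ s⁻¹ * N (u + v) := by gcongr
  have h₃ : s⁻¹ * 2 ≤ s⁻¹ * (N u + N v) := by gcongr
  rw [div_eq_inv_mul]
  linarith

/-- A uniformly smooth norm is uniformly non-square. -/
theorem IsUniformlySmoothNorm.exists_nonsquare (hN : IsNormFn X N)
    (hs : IsUniformlySmoothNorm X N) :
    ∃ s > 1, ∀ m > 0, ∀ x y : X, m ≤ N x → m ≤ N y → s * m ≤ N (x + y) ∨ s * m ≤ N (x - y) := by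
  have h₁ : ∀ᶠ t in 𝓝[>] (0 : ℝ), usModN X N t / t < 1 / 2 :=
    hs.eventually (gt_mem_nhds (by norm_num))
  have h₂ : ∀ᶠ t in 𝓝[>] (0 : ℝ), t < 1 :=
    mem_nhdsWithin_of_mem_nhds (gt_mem_nhds one_pos)
  obtain ⟨t, ⟨ht, ht1⟩, ht0 : 0 < t⟩ := ((h₁.and h₂).and self_mem_nhdsWithin).exists
  rw [div_lt_iff₀ ht0] at ht
  have unit : ∀ x y : X, 1 ≤ N x → 1 ≤ N y →
      1 + t / 8 ≤ N (x + y) ∨ 1 + t / 8 ≤ N (x - y) := by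
    intro x y hx hy
    by_contra! hc
    obtain ⟨hu, hv⟩ := hc
    set s : ℝ := 1 + t / 8 with hsdef
    set u := x + y with hudef
    set v := x - y with hvdef
    have e₁ : u + v = (2 : ℝ) • x := by rw [hudef, hvdef]; module
    have e₂ : u + -v = (2 : ℝ) • y := by rw [hudef, hvdef]; module
    have huv : 2 ≤ N (u + v) := by
      rw [e₁, hN.2.2.1, abs_of_pos two_pos]; linarith
    have huv' : 2 ≤ N (u + -v) := by
      rw [e₂, hN.2.2.1, abs_of_pos two_pos]; linarith
    have hsum : 2 ≤ N u + N v := huv.trans (hN.2.2.2 u v)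
    have hu0 : 0 < N u := by linarith
    have hv0 : 0 < N v := by linarith
    have k₁ := hN.normalized_add_ge hu0 hv0 hu.le hv.le hsum huv
    have k₂ := hN.normalized_add_ge (v := -v) hu0 (by rwa [hN.map_neg]) hu.le
      (by rw [hN.map_neg]; exact hv.le) (by rwa [hN.map_neg]) huv'
    rw [hN.map_neg] at k₂
    set u' := (N u)⁻¹ • u
    set v' := (N v)⁻¹ • v with hv'def
    have nu : N u' = 1 := by
      rw [hN.2.2.1, abs_of_pos (inv_pos.2 hu0), inv_mul_cancel₀ hu0.ne']
    have nv : N v' = 1 := by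
      rw [hN.2.2.1, abs_of_pos (inv_pos.2 hv0), inv_mul_cancel₀ hv0.ne']
    have m₁ := hN.le_add_sub (u' + v') ((t - 1) • v')
    have m₂ := hN.le_add_sub (u' + (N v)⁻¹ • -v) ((1 - t) • v')
    rw [hN.2.2.1, nv, abs_of_nonpos (by linarith),
      show u' + v' + (t - 1) • v' = u' + t • v' by module] at m₁
    rw [hN.2.2.1, nv, abs_of_nonneg (by linarith),
      show u' + (N v)⁻¹ • -v + (1 - t) • v' = u' - t • v' by rw [hv'def]; module] at m₂
    have m₃ := hN.le_usModN ht0.le nu nv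
    have hs0 : 0 < s := by positivity
    have hs4 : 4 - t / 2 ≤ 4 / s := by
      rw [le_div_iff₀ hs0, hsdef]
      nlinarith
    linarith
  refine ⟨1 + t / 8, by linarith, fun m hm x y hx hy => ?_⟩
  have hm' : |m⁻¹| = m⁻¹ := abs_of_pos (inv_pos.2 hm)
  have scale : ∀ (c : ℝ) (z : X), c ≤ N (m⁻¹ • z) ↔ c * m ≤ N z := by
    intro c z
    rw [hN.2.2.1, hm', ← div_eq_inv_mul, le_div_iff₀ hm]
  have h := unit (m⁻¹ • x) (m⁻¹ • y) ((scale _ _).2 (by simpa using hx))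
    ((scale _ _).2 (by simpa using hy))
  rwa [← smul_add, ← smul_sub, scale, scale] at h

/-- In a uniformly non-square norm, `2 ^ k` vectors bounded below have a signed sum growing
geometrically in `k`. -/
theorem exists_signs_le_of_nonsquare {s c : ℝ} (hs : 1 < s) (hc : 0 < c)
    (h : ∀ m > 0, ∀ x y : X, m ≤ N x → m ≤ N y → s * m ≤ N (x + y) ∨ s * m ≤ N (x - y))
    {x : ℕ → X} (hx : ∀ i, c ≤ N (x i)) (k : ℕ) : ∀ m : ℕ, ∃ ε : ℕ → ℝ, (∀ i, |ε i| = 1) ∧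
      s ^ k * c ≤ N (∑ i ∈ Finset.Ico (m * 2 ^ k) ((m + 1) * 2 ^ k), ε i • x i) := by
  induction k with
  | zero => exact fun m => ⟨fun _ => 1, by simp, by simpa using hx m⟩
  | succ k ih =>
    intro m
    obtain ⟨ε, hε, hεN⟩ := ih (2 * m)
    obtain ⟨η, hη, hηN⟩ := ih (2 * m + 1)
    have merge : ∀ a : ℝ, |a| = 1 → ∃ δ : ℕ → ℝ, (∀ i, |δ i| = 1) ∧
        ∑ i ∈ Finset.Ico (m * 2 ^ (k + 1)) ((m + 1) * 2 ^ (k + 1)), δ i • x i =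
          (∑ i ∈ Finset.Ico (2 * m * 2 ^ k) ((2 * m + 1) * 2 ^ k), ε i • x i) +
          a • ∑ i ∈ Finset.Ico ((2 * m + 1) * 2 ^ k) ((2 * m + 1 + 1) * 2 ^ k), η i • x i := by
      intro a ha
      refine ⟨fun i => if i < (2 * m + 1) * 2 ^ k then ε i else a * η i, fun i => ?_, ?_⟩
      · dsimp only
        split_ifs
        · exact hε i
        · rw [abs_mul, ha, hη, one_mul]
      · rw [show m * 2 ^ (k + 1) = 2 * m * 2 ^ k by ring,
          show (m + 1) * 2 ^ (k + 1) = (2 * m + 1 + 1) * 2 ^ k by ring,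
          ← Finset.sum_Ico_consecutive _ (n := (2 * m + 1) * 2 ^ k) (by gcongr; omega)
            (by gcongr; omega), Finset.smul_sum]
        congr 1
        · refine Finset.sum_congr rfl fun i hi => ?_
          simp only [if_pos (Finset.mem_Ico.1 hi).2]
        · refine Finset.sum_congr rfl fun i hi => ?_
          simp only [if_neg (Finset.mem_Ico.1 hi).1.not_gt, mul_smul]
    rw [pow_succ', mul_assoc]
    rcases h (s ^ k * c) (by positivity) _ _ hεN hηN with h' | h'
    · obtain ⟨δ, hδ, e⟩ := merge 1 (by simp)
      exact ⟨δ, hδ, by rwa [e, one_smul]⟩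
    · obtain ⟨δ, hδ, e⟩ := merge (-1) (by simp)
      exact ⟨δ, hδ, by rwa [e, neg_one_smul, ← sub_eq_add_neg]⟩

theorem IsEquivNorm.pow_le_two_of_isom_lp (hN : IsEquivNorm X N) {s : ℝ} (hs : 1 < s)
    (h : ∀ m > 0, ∀ x y : X, m ≤ N x → m ≤ N y → s * m ≤ N (x + y) ∨ s * m ≤ N (x - y))
    {n : ℕ} (hn : n ≠ 0) [Fact (1 ≤ ENNReal.ofReal n)]
    (hX : IsomToClosedSubspace (lp (fun _ : ℕ => ℝ) (ENNReal.ofReal n)) X) :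
    s ^ n ≤ 2 := by
  obtain ⟨hN, a, ha, b, hb, hab⟩ := hN
  obtain ⟨T, -, c, hc, hT⟩ := hX
  have hp : (ENNReal.ofReal (n : ℝ)).toReal = n := ENNReal.toReal_ofReal n.cast_nonneg
  have hp0 : 0 < ENNReal.ofReal (n : ℝ) := zero_lt_one.trans_le Fact.out
  have hbound : ∀ k : ℕ, s ^ k * (a * c) ≤ b * ‖T‖ * ((2 : ℝ) ^ k) ^ ((n : ℝ)⁻¹) := by
    intro k
    obtain ⟨ε, hε, hεN⟩ := exists_signs_le_of_nonsquare hs (mul_pos ha hc) h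
      (x := fun i => T (lp.single (ENNReal.ofReal (n : ℝ)) i (1 : ℝ))) (fun i => by
        refine le_trans ?_ (hab _).1
        have := hT (lp.single (ENNReal.ofReal (n : ℝ)) i (1 : ℝ))
        rw [lp.norm_single hp0, norm_one, mul_one] at this
        gcongr) k 0
    refine hεN.trans ((hab _).2.trans ?_)
    rw [mul_assoc]
    gcongr
    simp only [← map_smul, ← map_sum, ← lp.single_smul, smul_eq_mul, mul_one]
    refine (T.le_opNorm _).trans ?_
    gcongr
    have hnorm := lp.norm_sum_single (p := ENNReal.ofReal (n : ℝ)) (E := fun _ : ℕ => ℝ)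
      (by rw [hp]; positivity) ε (Finset.Ico (0 * 2 ^ k) ((0 + 1) * 2 ^ k))
    simp only [Real.norm_eq_abs (ε _), hε, Real.one_rpow, Finset.sum_const, Nat.card_Ico, hp] at hnorm
    rw [Real.le_rpow_inv_iff_of_pos (norm_nonneg _) (by positivity) (by positivity), hnorm]
    simp
  by_contra! hlt
  have hr : 1 < s ^ n / 2 := by rwa [one_lt_div two_pos]
  obtain ⟨k, hk⟩ := pow_unbounded_of_one_lt ((b * ‖T‖ / (a * c)) ^ n) hr
  refine hk.not_ge ?_
  have h₁ := pow_le_pow_left₀ (by positivity) (hbound k) n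
  rw [mul_pow (s ^ k), mul_pow (b * ‖T‖), Real.rpow_inv_natCast_pow (by positivity) hn] at h₁
  rw [div_pow, div_pow, div_le_div_iff₀ (by positivity) (by positivity), ← pow_mul, mul_comm n k,
    pow_mul]
  exact h₁

theorem IsEquivNorm.not_isom_lp (hN : IsEquivNorm X N) (hs : IsUniformlySmoothNorm X N)
    (hX : ∀ k : ℕ, ∀ _ : Fact (1 ≤ ENNReal.ofReal ((2 ^ (k + 1) : ℕ) : ℝ)),
      IsomToClosedSubspace (lp (fun _ : ℕ => ℝ) (ENNReal.ofReal ((2 ^ (k + 1) : ℕ) : ℝ))) X) :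
    False := by
  obtain ⟨s, hs1, h⟩ := hs.exists_nonsquare hN.1
  obtain ⟨k, hk⟩ := pow_unbounded_of_one_lt 2 hs1
  have hF : Fact (1 ≤ ENNReal.ofReal ((2 ^ (k + 1) : ℕ) : ℝ)) :=
    ⟨ENNReal.one_le_ofReal.2 (mod_cast Nat.one_le_two_pow)⟩
  have h₂ := hN.pow_le_two_of_isom_lp hs1 h (by positivity) (hX k hF)
  have h₃ : s ^ k ≤ s ^ 2 ^ (k + 1) :=
    pow_le_pow_right₀ hs1.le ((Nat.le_succ k).trans Nat.lt_two_pow_self.le)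
  linarith

end UniformNonsquareness

section SmoothnessOfLp

/-- The two-point inequality for the exponents `2 ^ (k + 1)`. -/
theorem add_pow_add_sub_pow_le (k : ℕ) : ∀ a b : ℝ,
    (a + b) ^ 2 ^ (k + 1) + (a - b) ^ 2 ^ (k + 1) ≤
      2 * (a ^ 2 + (2 ^ (k + 1) - 1) * b ^ 2) ^ 2 ^ k := by
  induction k with
  | zero => intro a b; norm_num; nlinarith
  | succ k ih =>
    intro a b
    have hC : (0 : ℝ) ≤ 2 ^ (k + 1) - 1 := sub_nonneg.2 (one_le_pow₀ one_le_two)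
    have h := ih (a ^ 2 + b ^ 2) (2 * a * b)
    rw [show a ^ 2 + b ^ 2 + 2 * a * b = (a + b) ^ 2 by ring,
      show a ^ 2 + b ^ 2 - 2 * a * b = (a - b) ^ 2 by ring, ← pow_mul, ← pow_mul,
      ← pow_succ'] at h
    refine h.trans ?_
    rw [show (2 : ℕ) ^ (k + 1) = 2 * 2 ^ k from pow_succ' 2 k, pow_mul _ 2 (2 ^ k)]
    gcongr
    rw [pow_succ' (2 : ℝ) (k + 1)]
    generalize (2 : ℝ) ^ (k + 1) = C at hC ⊢
    have : 0 ≤ C * (C - 1) * b ^ 4 := by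
      have : 0 ≤ C := by linarith
      positivity
    nlinarith

variable {n : ℕ} [Fact (1 ≤ ENNReal.ofReal (n : ℝ))]

theorem hasSum_abs_pow_lp (f : lp (fun _ : ℕ => ℝ) (ENNReal.ofReal (n : ℝ))) :
    HasSum (fun i => |f i| ^ n) (‖f‖ ^ n) := by
  have hp : (ENNReal.ofReal (n : ℝ)).toReal = n := ENNReal.toReal_ofReal n.cast_nonneg
  have h1 : (1 : ℝ) ≤ n := ENNReal.one_le_ofReal.1 Fact.out
  have h := lp.hasSum_norm (by rw [hp]; linarith) f
  simpa only [hp, Real.rpow_natCast, Real.norm_eq_abs (f _)] using h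

theorem separableSpace_lp_s14 :
    TopologicalSpace.SeparableSpace (lp (fun _ : ℕ => ℝ) (ENNReal.ofReal (n : ℝ))) := by
  rw [← TopologicalSpace.isSeparable_univ_iff]
  refine ((Set.countable_range fun i : ℕ =>
    lp.single (E := fun _ => ℝ) (ENNReal.ofReal (n : ℝ)) i 1).isSeparable.span
      (R := ℝ)).closure.mono fun f _ => ?_
  refine mem_closure_of_tendsto (lp.hasSum_single ENNReal.ofReal_ne_top f)
    (Eventually.of_forall fun s => Submodule.sum_mem _ fun i _ => ?_)
  have : lp.single (ENNReal.ofReal (n : ℝ)) i (f i) =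
      f i • lp.single (E := fun _ => ℝ) (ENNReal.ofReal (n : ℝ)) i 1 := by
    rw [← lp.single_smul, smul_eq_mul, mul_one]
  rw [this]
  exact Submodule.smul_mem _ _ (Submodule.subset_span ⟨i, rfl⟩)

theorem lp_norm_add_sub_le {k : ℕ} [Fact (1 ≤ ENNReal.ofReal ((2 ^ (k + 1) : ℕ) : ℝ))]
    (x y : lp (fun _ : ℕ => ℝ) (ENNReal.ofReal ((2 ^ (k + 1) : ℕ) : ℝ)))
    (hx : ‖x‖ = 1) (hy : ‖y‖ = 1) (t : ℝ) :
    (‖x + t • y‖ + ‖x - t • y‖) / 2 ≤ 1 + (2 ^ (k + 1) - 1) * t ^ 2 := by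
  have hC : (0 : ℝ) ≤ 2 ^ (k + 1) - 1 := sub_nonneg.2 (one_le_pow₀ one_le_two)
  set C : ℝ := 2 ^ (k + 1) - 1 with hCdef
  have hev : Even (2 ^ (k + 1)) := (Nat.even_pow' (by simp)).2 even_two
  have hpow : ∀ z : ℝ, |z| ^ 2 ^ (k + 1) = (z ^ 2) ^ 2 ^ k := by
    intro z; rw [hev.pow_abs, ← pow_mul, ← pow_succ']
  have sx := hasSum_abs_pow_lp x
  have sy := (hasSum_abs_pow_lp y).mul_left ((C * t ^ 2) ^ 2 ^ k)
  have s₁ := hasSum_abs_pow_lp (x + t • y)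
  have s₂ := hasSum_abs_pow_lp (x - t • y)
  simp only [hpow, hx, hy, one_pow, mul_one, ← mul_pow] at sx sy
  obtain ⟨D, hD0, hD, sD⟩ := Real.Lp_add_le_hasSum_of_nonneg (p := ((2 ^ k : ℕ) : ℝ))
    (f := fun i => x i ^ 2) (g := fun i => C * t ^ 2 * y i ^ 2)
    (A := 1) (B := C * t ^ 2)
    (mod_cast Nat.one_le_two_pow) (fun i => by positivity) (fun i => by positivity)
    zero_le_one (by positivity) (by simpa only [Real.rpow_natCast, one_pow] using sx)
    (by simpa only [Real.rpow_natCast] using sy)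
  simp only [Real.rpow_natCast] at sD
  have hle : ‖x + t • y‖ ^ 2 ^ (k + 1) + ‖x - t • y‖ ^ 2 ^ (k + 1) ≤ 2 * D ^ 2 ^ k := by
    refine hasSum_le (fun i => ?_) (s₁.add s₂) (sD.mul_left 2)
    have h := add_pow_add_sub_pow_le k (x i) (t * y i)
    simp only [hev.pow_abs]
    rw [← hCdef, show C * (t * y i) ^ 2 = C * t ^ 2 * y i ^ 2 by ring] at h
    exact h
  have hM : 1 ≤ 1 + C * t ^ 2 := by
    have : 0 ≤ C * t ^ 2 := by positivity
    linarith
  have hmean := (convexOn_pow (𝕜 := ℝ) (2 ^ (k + 1))).2 (norm_nonneg (x + t • y))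
    (norm_nonneg (x - t • y)) (by norm_num : (0 : ℝ) ≤ 1 / 2) (by norm_num : (0 : ℝ) ≤ 1 / 2)
    (by norm_num)
  simp only [smul_eq_mul] at hmean
  refine le_of_pow_le_pow_left₀ (n := 2 ^ (k + 1)) (by positivity) (by linarith) ?_
  calc ((‖x + t • y‖ + ‖x - t • y‖) / 2) ^ 2 ^ (k + 1)
      = (1 / 2 * ‖x + t • y‖ + 1 / 2 * ‖x - t • y‖) ^ 2 ^ (k + 1) := by ring_nf
    _ ≤ D ^ 2 ^ k := by linarith
    _ ≤ (1 + C * t ^ 2) ^ 2 ^ k := by gcongr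
    _ ≤ (1 + C * t ^ 2) ^ 2 ^ (k + 1) := by
      gcongr
      · norm_num
      · omega

theorem isTwoUniformlySmoothNorm_ulift_lp (k : ℕ)
    [Fact (1 ≤ ENNReal.ofReal ((2 ^ (k + 1) : ℕ) : ℝ))] :
    IsTwoUniformlySmoothNorm
      (ULift.{u} (lp (fun _ : ℕ => ℝ) (ENNReal.ofReal ((2 ^ (k + 1) : ℕ) : ℝ))))
      (fun z => ‖z‖) := by
  have hC : (0 : ℝ) < 2 ^ (k + 1) - 1 := sub_pos.2 (one_lt_pow₀ one_lt_two (by simp))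
  refine ⟨2 ^ (k + 1) - 1, hC, fun t _ => Real.sSup_le ?_ (by positivity)⟩
  rintro r ⟨x, y, hx, hy, rfl⟩
  have h := lp_norm_add_sub_le x.down y.down hx hy t
  exact sub_le_iff_le_add'.2 h

end SmoothnessOfLp

theorem IsomToClosedSubspace.of_ulift {Y W : Type*} [NormedAddCommGroup Y] [NormedSpace ℝ Y]
    [NormedAddCommGroup W] [NormedSpace ℝ W]
    (h : IsomToClosedSubspace (ULift.{u} Y) W) : IsomToClosedSubspace Y W := by
  obtain ⟨T, hT, c, hc, hle⟩ := h
  let U : Y →L[ℝ] ULift.{u} Y :=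
    { ULift.moduleEquiv.symm.toLinearMap with cont := continuous_uliftUp }
  exact ⟨T.comp U, hT.comp ULift.up_injective, c, hc, fun y => hle (ULift.up y)⟩

/-- A Banach space containing isomorphic copies of `ℓ_q` for every `q ∈ [2,∞)` admits no
equivalent uniformly smooth norm; in particular no Banach space with an equivalent uniformly
smooth norm can contain isomorphic copies of all separable Banach spaces whose norm is
`2`-uniformly smooth. -/
theorem no_uniformly_smooth_universal_space :
    (∀ (X : Type u) (_ : NormedAddCommGroup X) (_ : NormedSpace ℝ X) (_ : CompleteSpace X),
      (∀ q : ℝ, ∀ hq2 : 2 ≤ q,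
        letI : Fact (1 ≤ ENNReal.ofReal q) :=
          ⟨ENNReal.one_le_ofReal.2 (le_trans one_le_two hq2)⟩;
        IsomToClosedSubspace (lp (fun _ : ℕ => ℝ) (ENNReal.ofReal q)) X) →
      ¬ ∃ N : X → ℝ, IsEquivNorm X N ∧ IsUniformlySmoothNorm X N) ∧
    ¬ ∃ (W : Type u) (_ : NormedAddCommGroup W) (_ : NormedSpace ℝ W) (_ : CompleteSpace W),
        (∃ N : W → ℝ, IsEquivNorm W N ∧ IsUniformlySmoothNorm W N) ∧
        ∀ (Z : Type u) (_ : NormedAddCommGroup Z) (_ : NormedSpace ℝ Z) (_ : CompleteSpace Z),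
          TopologicalSpace.SeparableSpace Z →
          IsTwoUniformlySmoothNorm Z (fun z => ‖z‖) →
          IsomToClosedSubspace Z W := by
  constructor
  · rintro X _ _ _ hX ⟨N, hN, hs⟩
    refine hN.not_isom_lp hs fun k _ => hX _ ?_
    exact_mod_cast Nat.le_self_pow (Nat.succ_ne_zero k) 2
  · rintro ⟨W, _, _, _, ⟨N, hN, hs⟩, hW⟩
    refine hN.not_isom_lp hs fun k _ => IsomToClosedSubspace.of_ulift.{u} (hW _ _ _ inferInstance ?_
      (isTwoUniformlySmoothNorm_ulift_lp k))
    have := separableSpace_lp_s14 (n := 2 ^ (k + 1))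
    exact (ULift.up_surjective.denseRange).separableSpace continuous_uliftUp
end
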